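/- arXiv:2011.02064 — 2 statements merged into one kernel-verified Lean document; each statement's English description precedes it below -/
import Mathlib

section
/- For every κ > 0 and positive integer N there exists a constant C > 0 such that for all a > 0, x ≥ 3, T with 1 ≤ T ≤ x/3, and every (a,x,T,κ,N)-admissible test function φ, the transform φ̌(r) = 2 cosh(πr) ∫₀^∞ K_{2ir}(u) φ(u) du/u satisfies: (1) |φ̌(r)| ≤ C r^{−3/2} for 0 < r ≤ 1; (2) |φ̌(r)| ≤ C e^{−r/2} for 1 ≤ r ≤ a/(8x); (3) |φ̌(r)| ≤ C r^{−1} for max(a/(8x), 1) ≤ r ≤ a/x; (4) |φ̌(r)| ≤ C r^{−3/2} min(1, x/(rT)) for r ≥ max(a/x, 1). -/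
open Complex Finset Filter

noncomputable section

/-- The modified `K`-Bessel function of purely imaginary order:
`K_{iv}(u) = ∫₀^∞ e^{-u cosh t} cos(v t) dt`. -/
def Kbes (v u : ℝ) : ℝ := ∫ t in Set.Ioi (0 : ℝ), Real.exp (-u * Real.cosh t) * Real.cos (v * t)

/-- The integral transform `φ̌(r) = 2 cosh(πr) ∫₀^∞ K_{2ir}(u) φ(u) du/u`. -/
def phicheck (φ : ℝ → ℝ) (r : ℝ) : ℝ :=
  2 * Real.cosh (Real.pi * r) * ∫ u in Set.Ioi (0 : ℝ), Kbes (2 * r) u * φ u / u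

/-- `φ : [0,∞) → [0,1]` is an `(a,x,T,κ,N)`-admissible test function: it is `1` on
`[a/2x, a/x]`, vanishes for `t ≤ a/(2x+2T)` and `t ≥ a/(x-T)`, is differentiable with
`|φ'| ≤ κ x²/(aT)`, and `[0,∞)` is covered by at most `N` intervals on each of which both
`φ` and `φ'` are monotonic. -/
def Admissible (a x T κ : ℝ) (N : ℕ) (φ : ℝ → ℝ) : Prop :=
  (∀ t : ℝ, 0 ≤ φ t ∧ φ t ≤ 1) ∧
  (∀ t : ℝ, a / (2 * x) ≤ t → t ≤ a / x → φ t = 1) ∧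
  (∀ t : ℝ, t ≤ a / (2 * x + 2 * T) → φ t = 0) ∧
  (∀ t : ℝ, a / (x - T) ≤ t → φ t = 0) ∧
  Differentiable ℝ φ ∧
  (∀ t : ℝ, |deriv φ t| ≤ κ * x ^ 2 / (a * T)) ∧
  (∃ I : Fin N → Set ℝ, (∀ i, (I i).OrdConnected) ∧ Set.Ici (0 : ℝ) ⊆ ⋃ i, I i ∧
    ∀ i, (MonotoneOn φ (I i) ∨ AntitoneOn φ (I i)) ∧
      (MonotoneOn (deriv φ) (I i) ∨ AntitoneOn (deriv φ) (I i)))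

section Helpers


open MeasureTheory in
lemma ordConnected_integral_bound {m : ℝ → ℝ} {α β S : ℝ} (hS0 : 0 ≤ S)
    (hS : ∀ s t, α ≤ s → s ≤ t → t ≤ β → |∫ y in s..t, m y| ≤ S)
    {J : Set ℝ} (hJ : J.OrdConnected) (hsub : J ⊆ Set.Icc α β) :
    |∫ y in J, m y| ≤ S := by
  rcases J.eq_empty_or_nonempty with rfl | hne
  · simpa using hS0
  have hbb : BddBelow J := ⟨α, fun y hy => (hsub hy).1⟩
  have hba : BddAbove J := ⟨β, fun y hy => (hsub hy).2⟩
  have h1 : Set.Ioo (sInf J) (sSup J) ⊆ J := by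
    intro y hy
    obtain ⟨p, hp, hpy⟩ := exists_lt_of_csInf_lt hne hy.1
    obtain ⟨p', hp', hpy'⟩ := exists_lt_of_lt_csSup hne hy.2
    exact hJ.out hp hp' ⟨hpy.le, hpy'.le⟩
  have h2 : J ⊆ Set.Icc (sInf J) (sSup J) := fun y hy => ⟨csInf_le hbb hy, le_csSup hba hy⟩
  have hle : sInf J ≤ sSup J := by
    obtain ⟨y, hy⟩ := hne
    exact (h2 hy).1.trans (h2 hy).2
  have hae : (J : Set ℝ) =ᵐ[volume] Set.Ioc (sInf J) (sSup J) := by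
    apply LE.le.eventuallyLE h2 |>.trans_eq (Ioc_ae_eq_Icc (μ := volume) (a := sInf J) (b := sSup J)).symm |>.antisymm
    exact (Ioo_ae_eq_Ioc (μ := volume) (a := sInf J) (b := sSup J)).symm.trans_le (LE.le.eventuallyLE h1)
  rw [setIntegral_congr_set hae, ← intervalIntegral.integral_of_le hle]
  refine hS _ _ ?_ hle ?_
  · exact le_csInf hne fun y hy => (hsub hy).1
  · exact csSup_le hne fun y hy => (hsub hy).2

open MeasureTheory in
lemma union_integral_bound {m : ℝ → ℝ} {α β S : ℝ} (hS0 : 0 ≤ S)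
    (hm : IntegrableOn m (Set.Icc α β))
    (hS : ∀ s t, α ≤ s → s ≤ t → t ≤ β → |∫ y in s..t, m y| ≤ S) :
    ∀ (N : ℕ) (J : Fin N → Set ℝ), (∀ i, (J i).OrdConnected) → (∀ i, J i ⊆ Set.Icc α β) →
    |∫ y in ⋃ i, J i, m y| ≤ (2 ^ N - 1) * S := by
  intro N
  induction N with
  | zero => intro J _ _; simp
  | succ n ih =>
    intro J hJ hsub
    have e : (⋃ i, J i) = J 0 ∪ ⋃ i : Fin n, J i.succ := by
      ext y; simp [Fin.exists_fin_succ]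
    have hmeas : ∀ i, MeasurableSet (J i) := fun i => (hJ i).measurableSet
    set U := ⋃ i : Fin n, J i.succ with hU
    have hUm : MeasurableSet U := MeasurableSet.iUnion fun i => hmeas _
    have hUs : U ⊆ Set.Icc α β := Set.iUnion_subset fun i => hsub _
    have hI := ih (fun i => J i.succ) (fun i => hJ _) (fun i => hsub _)
    have hII := ih (fun i => J 0 ∩ J i.succ) (fun i => (hJ _).inter (hJ _))
      (fun i => Set.inter_subset_left.trans (hsub _))
    rw [← Set.inter_iUnion, ← hU] at hII
    have h0 := ordConnected_integral_bound hS0 hS (hJ 0) (hsub 0)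
    have k1 : ∫ y in J 0 ∪ U, m y = (∫ y in J 0, m y) + ∫ y in U \ J 0, m y := by
      rw [← Set.union_sdiff_self]
      exact setIntegral_union Set.disjoint_sdiff_right (hUm.diff (hmeas 0))
        (hm.mono_set (hsub 0)) (hm.mono_set (Set.sdiff_subset.trans hUs))
    have k2 := integral_inter_add_sdiff (μ := volume) (f := m) (hmeas 0) (hm.mono_set hUs)
    rw [Set.inter_comm] at k2
    have hp : (1:ℝ) ≤ 2 ^ n := one_le_pow₀ (by norm_num)
    rw [e, k1]
    have k3 : (∫ y in J 0, m y) + ∫ y in U \ J 0, m y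
        = (∫ y in J 0, m y) + (∫ y in U, m y) - ∫ y in J 0 ∩ U, m y := by rw [← k2]; ring
    rw [k3, pow_succ]
    rw [abs_le] at *
    constructor <;> linarith [hI.1, hI.2, hII.1, hII.2, h0.1, h0.2]

open MeasureTheory in
lemma level_set_bound {m g : ℝ → ℝ} {α β S B : ℝ} {N : ℕ} (hS0 : 0 ≤ S) (hB : 0 ≤ B)
    (hαβ : α ≤ β)
    (hm : IntegrableOn m (Set.Icc α β)) (hg : Measurable g)
    (hg0 : ∀ y, 0 ≤ g y) (hgB : ∀ y, g y ≤ B)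
    (hS : ∀ s t, α ≤ s → s ≤ t → t ≤ β → |∫ y in s..t, m y| ≤ S)
    (I : Fin N → Set ℝ) (hI : ∀ i, (I i).OrdConnected) (hcov : Set.Icc α β ⊆ ⋃ i, I i)
    (hmono : ∀ i, MonotoneOn g (I i) ∨ AntitoneOn g (I i)) :
    |∫ y in α..β, g y * m y| ≤ B * (2 ^ N * S) := by
  have hlev : ∀ s : ℝ, |∫ y in {y | y ∈ Set.Icc α β ∧ s < g y}, m y| ≤ 2 ^ N * S := by
    intro s
    have e : {y | y ∈ Set.Icc α β ∧ s < g y} = ⋃ i, {y | y ∈ Set.Icc α β ∧ y ∈ I i ∧ s < g y} := by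
      ext y
      simp only [Set.mem_ofPred_eq, Set.mem_iUnion]
      constructor
      · rintro ⟨h1, h2⟩
        obtain ⟨i, hi⟩ := Set.mem_iUnion.1 (hcov h1)
        exact ⟨i, h1, hi, h2⟩
      · rintro ⟨i, h1, h2, h3⟩
        exact ⟨h1, h3⟩
    rw [e]
    refine (union_integral_bound hS0 hm hS N _ ?_ ?_).trans ?_
    · intro i
      refine ⟨?_⟩
      rintro y ⟨hy1, hy2, hy3⟩ z ⟨hz1, hz2, hz3⟩ w hw
      have hwI := (hI i).out hy2 hz2 hw
      refine ⟨⟨hy1.1.trans hw.1, hw.2.trans hz1.2⟩, hwI, ?_⟩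
      rcases hmono i with h | h
      · exact hy3.trans_le (h hy2 hwI hw.1)
      · exact hz3.trans_le (h hwI hz2 hw.2)
    · intro i y hy; exact hy.1
    · nlinarith
  rw [intervalIntegral.integral_of_le hαβ, ← integral_Icc_eq_integral_Ioc]
  have hset : MeasurableSet {p : ℝ × ℝ | p.2 < g p.1} :=
    measurableSet_lt measurable_snd (hg.comp measurable_fst)
  let F : ℝ → ℝ → ℝ := fun y s => {p : ℝ × ℝ | p.2 < g p.1}.indicator (fun p => m p.1) (y, s)
  have hFint : Integrable (Function.uncurry F)
      ((volume.restrict (Set.Icc α β)).prod (volume.restrict (Set.Ioc 0 B))) := by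
    have : Function.uncurry F = {p : ℝ × ℝ | p.2 < g p.1}.indicator (fun p => m p.1) := by
      ext ⟨y, s⟩; rfl
    rw [this]
    refine Integrable.indicator ?_ hset
    have := Integrable.mul_prod (μ := volume.restrict (Set.Icc α β))
      (ν := volume.restrict (Set.Ioc 0 B)) hm (integrable_const (1:ℝ))
    simpa using this
  have h1 : ∀ y, g y * m y = ∫ s in Set.Ioc 0 B, F y s := by
    intro y
    have : ∀ s, F y s = (Set.Iio (g y)).indicator (fun _ => m y) s := by
      intro s
      simp only [F, Set.indicator, Set.mem_ofPred_eq, Set.mem_Iio]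
    simp_rw [this]
    rw [setIntegral_indicator measurableSet_Iio, setIntegral_const]
    have : (Set.Ioc 0 B ∩ Set.Iio (g y) : Set ℝ) = Set.Ioo 0 (g y) := by
      ext s; simp only [Set.mem_inter_iff, Set.mem_Ioc, Set.mem_Iio, Set.mem_Ioo]
      constructor
      · rintro ⟨⟨a, b⟩, c⟩; exact ⟨a, c⟩
      · rintro ⟨a, c⟩; exact ⟨⟨a, c.le.trans (hgB y)⟩, c⟩
    rw [this]
    simp [Measure.real, hg0 y]
  simp_rw [h1]
  rw [integral_integral_swap hFint]
  have h2 : ∀ s, ∫ y in Set.Icc α β, F y s = ∫ y in {y | y ∈ Set.Icc α β ∧ s < g y}, m y := by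
    intro s
    have : ∀ y, F y s = {y | s < g y}.indicator m y := by
      intro y
      simp only [F, Set.indicator, Set.mem_ofPred_eq]
    simp_rw [this]
    rw [setIntegral_indicator (measurableSet_lt measurable_const hg)]
    rfl
  simp_rw [h2]
  have := norm_setIntegral_le_of_norm_le_const (μ := volume) (s := Set.Ioc 0 B) (C := 2 ^ N * S)
    (f := fun s => ∫ y in {y | y ∈ Set.Icc α β ∧ s < g y}, m y) (by simp) (fun s _ => hlev s)
  rw [Real.norm_eq_abs] at this
  refine this.trans (le_of_eq ?_)
  simp [Measure.real, hB]
  ring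

/-- Twice the Bessel function of complex order `μ`. -/
def FF (μ : ℂ) (u : ℝ) : ℂ := ∫ t : ℝ, Complex.exp (μ * t - u * Real.cosh t)

open MeasureTheory

lemma integrable_exp_cosh (b : ℝ) {c : ℝ} (hc : 0 < c) :
    Integrable (fun t : ℝ => Real.exp (b * t - c * Real.cosh t)) := by
  have h := (integrable_exp_neg_mul_sq (b := c / 8) (by positivity)).const_mul
    (Real.exp (2 * b ^ 2 / c))
  refine h.mono' (by fun_prop) (Eventually.of_forall fun t => ?_)
  rw [Real.norm_eq_abs, abs_of_pos (Real.exp_pos _), ← Real.exp_add]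
  apply Real.exp_le_exp.2
  have h1 : t ^ 2 / 4 ≤ Real.cosh t := by
    have := Real.quadratic_le_exp_of_nonneg (abs_nonneg t)
    rw [← Real.cosh_abs, Real.cosh_eq]
    have h2 := Real.exp_pos (-|t|)
    have h3 := abs_nonneg t
    rw [sq_abs] at this
    linarith
  have h3 : (b / c - t / 4) ^ 2 * (2 * c) = 2 * b ^ 2 / c - b * t + c / 8 * t ^ 2 := by
    field_simp; ring
  have h2 : 0 ≤ (b / c - t / 4) ^ 2 * (2 * c) := by positivity
  nlinarith

lemma norm_FF_integrand (μ : ℂ) (u t : ℝ) :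
    ‖Complex.exp (μ * t - u * Real.cosh t)‖ = Real.exp (μ.re * t - u * Real.cosh t) := by
  rw [Complex.norm_exp]
  congr 1
  simp only [sub_re, mul_re, ofReal_re, ofReal_im]
  ring

lemma integrable_FF (μ : ℂ) {u : ℝ} (hu : 0 < u) :
    Integrable (fun t : ℝ => Complex.exp (μ * t - u * Real.cosh t)) := by
  refine (integrable_exp_cosh μ.re hu).mono' (by fun_prop) (Eventually.of_forall fun t => ?_)
  rw [norm_FF_integrand]

lemma FF_cosh_split (μ : ℂ) (u t : ℝ) :
    -(Real.cosh t : ℂ) * Complex.exp (μ * t - u * Real.cosh t) =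
      -(1 / 2) * (Complex.exp ((μ + 1) * t - u * Real.cosh t) +
        Complex.exp ((μ - 1) * t - u * Real.cosh t)) := by
  have e1 : (μ + 1) * t - u * Real.cosh t = (μ * t - u * Real.cosh t) + t := by ring
  have e2 : (μ - 1) * t - u * Real.cosh t = (μ * t - u * Real.cosh t) + (-t) := by ring
  rw [e1, e2, Complex.exp_add _ (t : ℂ), Complex.exp_add _ (-t : ℂ), Complex.ofReal_cosh, Complex.cosh]
  ring

lemma hasDerivAt_FF (μ : ℂ) {u : ℝ} (hu : 0 < u) :
    HasDerivAt (FF μ) (-(1 / 2) * (FF (μ + 1) u + FF (μ - 1) u)) u := by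
  have hb : Integrable (fun t : ℝ => (1 / 2) * (Real.exp ((μ.re + 1) * t - (u / 2) * Real.cosh t) +
      Real.exp ((μ.re - 1) * t - (u / 2) * Real.cosh t))) :=
    ((integrable_exp_cosh _ (by positivity)).add (integrable_exp_cosh _ (by positivity))).const_mul _
  have h := hasDerivAt_integral_of_dominated_loc_of_deriv_le (𝕜 := ℝ) (μ := volume)
    (F := fun (v : ℝ) (t : ℝ) => Complex.exp (μ * t - v * Real.cosh t))
    (F' := fun (v : ℝ) (t : ℝ) => -(Real.cosh t : ℂ) * Complex.exp (μ * t - v * Real.cosh t))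
    (x₀ := u) (s := Set.Ioi (u / 2)) (Ioi_mem_nhds (by linarith))
    (Eventually.of_forall fun v => by fun_prop) (integrable_FF μ hu) (by fun_prop)
    (Eventually.of_forall fun t v hv => ?_) hb (Eventually.of_forall fun t v hv => ?_)
  · refine h.2.congr_deriv ?_
    simp_rw [FF_cosh_split]
    rw [integral_const_mul, integral_add (integrable_FF _ hu) (integrable_FF _ hu)]
    rfl
  · rw [FF_cosh_split, norm_mul]
    have hv' : u / 2 < v := hv
    have hm : ∀ b : ℝ, Real.exp (b * t - v * Real.cosh t) ≤ Real.exp (b * t - u / 2 * Real.cosh t) := by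
      intro b
      apply Real.exp_le_exp.2
      nlinarith [Real.cosh_pos t]
    have h2 : ‖(-(1 / 2) : ℂ)‖ = 1 / 2 := by norm_num
    rw [h2]
    refine mul_le_mul_of_nonneg_left ((norm_add_le _ _).trans ?_) (by norm_num)
    rw [norm_FF_integrand, norm_FF_integrand]
    simp only [add_re, sub_re, one_re]
    exact add_le_add (hm _) (hm _)
  · have h0 : HasDerivAt (fun v : ℝ => (v : ℂ)) 1 v := Complex.ofRealCLM.hasDerivAt
    have h1 := ((h0.mul_const (Real.cosh t : ℂ)).const_sub (μ * t)).cexp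
    refine h1.congr_deriv ?_
    ring

lemma FF_recurrence (μ : ℂ) {u : ℝ} (hu : 0 < u) :
    μ * FF μ u = u / 2 * (FF (μ + 1) u - FF (μ - 1) u) := by
  have hd : ∀ t : ℝ, HasDerivAt (fun t : ℝ => Complex.exp (μ * t - u * Real.cosh t))
      (μ * Complex.exp (μ * t - u * Real.cosh t) -
        u / 2 * (Complex.exp ((μ + 1) * t - u * Real.cosh t) -
        Complex.exp ((μ - 1) * t - u * Real.cosh t))) t := by
    intro t
    have h0 : HasDerivAt (fun v : ℝ => (v : ℂ)) 1 t := Complex.ofRealCLM.hasDerivAt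
    have h00 : HasDerivAt (fun v : ℝ => (Real.cosh v : ℂ)) (Real.sinh t : ℂ) t :=
      (Real.hasDerivAt_cosh t).ofReal_comp
    have h1 := ((h0.const_mul μ).sub (h00.const_mul (u : ℂ))).cexp
    refine h1.congr_deriv ?_
    have e1 : (μ + 1) * t - u * Real.cosh t = (μ * t - u * Real.cosh t) + t := by ring
    have e2 : (μ - 1) * t - u * Real.cosh t = (μ * t - u * Real.cosh t) + (-t) := by ring
    rw [e1, e2, Complex.exp_add _ (t : ℂ), Complex.exp_add _ (-t : ℂ), Complex.ofReal_sinh, Complex.sinh]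
    simp only [Pi.sub_apply]
    ring
  have i1 := integrable_FF μ hu
  have i2 := integrable_FF (μ + 1) hu
  have i3 := integrable_FF (μ - 1) hu
  have i4 : Integrable (fun t : ℝ => (u / 2 : ℂ) * (Complex.exp ((μ + 1) * t - u * Real.cosh t) -
        Complex.exp ((μ - 1) * t - u * Real.cosh t))) := (i2.sub i3).const_mul (u / 2 : ℂ)
  have h := integral_eq_zero_of_hasDerivAt_of_integrable hd
    ((i1.const_mul μ).sub i4) i1
  rw [integral_sub (i1.const_mul μ) i4, integral_const_mul,
    integral_const_mul, integral_sub i2 i3] at h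
  exact sub_eq_zero.1 h

lemma FF_neg (μ : ℂ) (u : ℝ) : FF (-μ) u = FF μ u := by
  unfold FF
  rw [← integral_neg_eq_self]
  simp

lemma FF_conj (μ : ℂ) (u : ℝ) : (starRingEnd ℂ) (FF μ u) = FF ((starRingEnd ℂ) μ) u := by
  unfold FF
  rw [← integral_conj]
  congr 1
  ext t
  rw [← Complex.exp_conj, map_sub, map_mul, map_mul, conj_ofReal, conj_ofReal, conj_ofReal]

lemma FF_eq_Kbes (v : ℝ) {u : ℝ} (hu : 0 < u) : FF (v * I) u = ((2 * Kbes v u : ℝ) : ℂ) := by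
  apply Complex.ext
  · rw [ofReal_re]
    unfold FF Kbes
    have h1 : (∫ t : ℝ, Complex.exp (v * I * t - u * Real.cosh t)).re
        = ∫ t : ℝ, (Complex.exp (v * I * t - u * Real.cosh t)).re :=
      (integral_re (integrable_FF (v * I) hu)).symm
    rw [h1, ← integral_comp_abs (f := fun t => Real.exp (-u * Real.cosh t) * Real.cos (v * t))]
    congr 1
    ext t
    rw [Complex.exp_re]
    simp only [sub_re, mul_re, ofReal_re, ofReal_im, I_re, I_im, sub_im, mul_im, Real.cosh_abs]
    rcases abs_cases t with ⟨h, _⟩ | ⟨h, _⟩ <;> rw [h] <;> simp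
  · rw [ofReal_im]
    have h := FF_conj (v * I) u
    rw [map_mul, conj_I, conj_ofReal, mul_neg, FF_neg] at h
    exact Complex.conj_eq_iff_im.1 h

/-- The Bessel function in logarithmic variable. -/
def kk (v y : ℝ) : ℝ := 2 * Kbes v (Real.exp y)
/-- Its derivative (see below). -/
def kk1 (v y : ℝ) : ℝ := -(Real.exp y * (FF (1 + v * I) (Real.exp y)).re)

lemma FF_im (v : ℝ) {u : ℝ} (hu : 0 < u) :
    u * (FF (1 + v * I) u).im = v * (2 * Kbes v u) ∧
    FF (v * I - 1) u = (starRingEnd ℂ) (FF (1 + v * I) u) := by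
  have h1 : FF (v * I - 1) u = (starRingEnd ℂ) (FF (1 + v * I) u) := by
    rw [FF_conj, ← FF_neg]
    congr 1
    simp
    ring
  refine ⟨?_, h1⟩
  have h := FF_recurrence (v * I) hu
  rw [h1, add_comm (v * I : ℂ) 1, Complex.sub_conj, FF_eq_Kbes v hu] at h
  have := congrArg Complex.im h
  simp at this
  linarith

lemma hasDerivAt_kk (v y : ℝ) : HasDerivAt (kk v) (kk1 v y) y := by
  have hu := Real.exp_pos y
  have h := (hasDerivAt_FF (v * I) hu).scomp y (Real.hasDerivAt_exp y)
  have h2 := Complex.reCLM.hasFDerivAt.comp_hasDerivAt y h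
  have e : kk v = (⇑Complex.reCLM ∘ FF (v * I) ∘ Real.exp) := by
    ext z
    simp only [Function.comp, FF_eq_Kbes v (Real.exp_pos z)]
    simp [kk]
  rw [e]
  refine h2.congr_deriv ?_
  rw [(FF_im v hu).2, add_comm (v * I : ℂ) 1, Complex.add_conj]
  simp [kk1, -ofReal_exp]

lemma hasDerivAt_kk1 (v y : ℝ) :
    HasDerivAt (kk1 v) ((Real.exp (2 * y) - v ^ 2) * kk v y) y := by
  have hu := Real.exp_pos y
  have h := (hasDerivAt_FF (1 + v * I) hu).scomp y (Real.hasDerivAt_exp y)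
  have h2 := ((Real.hasDerivAt_exp y).mul (Complex.reCLM.hasFDerivAt.comp_hasDerivAt y h)).neg
  refine h2.congr_deriv ?_
  have e1 := FF_recurrence (1 + v * I) hu
  have e2 : (1 + v * I - 1 : ℂ) = v * I := by ring
  rw [e2, FF_eq_Kbes v hu] at e1
  rw [e2, FF_eq_Kbes v hu]
  have e3 := (FF_im v hu).1
  have e4 := congrArg Complex.re e1
  simp [-ofReal_exp] at e4
  have e5 : Real.exp (2 * y) = Real.exp y * Real.exp y := by rw [← Real.exp_add]; ring_nf
  simp [kk, e5, -ofReal_exp]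
  linear_combination (-Real.exp y) * e4 - v * e3

open Topology in
lemma norm_FF_le (μ : ℂ) {u : ℝ} (hu : 1 ≤ u) :
    ‖FF μ u‖ ≤ Real.exp (1 - u) * ∫ t : ℝ, Real.exp (μ.re * t - 1 * Real.cosh t) := by
  unfold FF
  refine (norm_integral_le_integral_norm _).trans ?_
  rw [← integral_const_mul]
  refine integral_mono (integrable_FF μ (by linarith)).norm
    ((integrable_exp_cosh _ one_pos).const_mul _) fun t => ?_
  simp only
  rw [norm_FF_integrand, ← Real.exp_add]
  apply Real.exp_le_exp.2
  nlinarith [Real.one_le_cosh t]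

open Topology in
lemma tendsto_FF_aux (μ : ℂ) :
    Tendsto (fun y : ℝ => Real.exp y * ‖FF μ (Real.exp y)‖) atTop (𝓝 0) := by
  set C := ∫ t : ℝ, Real.exp (μ.re * t - 1 * Real.cosh t)
  have h1 := (Real.tendsto_pow_mul_exp_neg_atTop_nhds_zero 1).comp Real.tendsto_exp_atTop
  have h2 := h1.const_mul (Real.exp 1 * C)
  rw [mul_zero] at h2
  refine squeeze_zero' (Eventually.of_forall fun y => by positivity) ?_ h2
  filter_upwards [eventually_ge_atTop 0] with y hy
  have h3 := norm_FF_le μ (Real.one_le_exp hy)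
  simp only [Function.comp, pow_one]
  calc _ ≤ Real.exp y * (Real.exp (1 - Real.exp y) * C) := by gcongr
    _ = _ := by rw [sub_eq_add_neg, Real.exp_add]; ring

open Topology in
lemma tendsto_kk1 (v : ℝ) : Tendsto (kk1 v) atTop (𝓝 0) := by
  refine squeeze_zero_norm (fun y => ?_) (tendsto_FF_aux (1 + v * I))
  unfold kk1
  rw [norm_neg, norm_mul, Real.norm_eq_abs, Real.abs_exp]
  gcongr
  exact Complex.abs_re_le_norm _

open Topology in
lemma tendsto_kk (v : ℝ) : Tendsto (kk v) atTop (𝓝 0) := by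
  refine squeeze_zero_norm' ?_ (tendsto_FF_aux (v * I))
  filter_upwards [eventually_ge_atTop 0] with y hy
  rw [FF_eq_Kbes v (Real.exp_pos y), Complex.norm_real]
  unfold kk
  have := Real.one_le_exp hy
  nlinarith [norm_nonneg (2 * Kbes v (Real.exp y))]

lemma kk_energy (v y : ℝ) :
    kk1 v y ^ 2 + v ^ 2 * kk v y ^ 2 = (Real.exp y * ‖FF (1 + v * I) (Real.exp y)‖) ^ 2 := by
  have h := (FF_im v (Real.exp_pos y)).1
  rw [mul_pow, Complex.sq_norm, Complex.normSq_apply]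
  unfold kk1 kk
  linear_combination -(v * (2 * Kbes v (Real.exp y)) +
    Real.exp y * (FF (1 + v * I) (Real.exp y)).im) * h

lemma integral_Ioi_exp {E : Type*} [NormedAddCommGroup E] [NormedSpace ℝ E] (g : ℝ → E) :
    ∫ x in Set.Ioi (0 : ℝ), g x = ∫ τ : ℝ, Real.exp τ • g (Real.exp τ) := by
  have h := integral_image_eq_integral_abs_deriv_smul (s := Set.univ) (f := Real.exp)
    (f' := Real.exp) MeasurableSet.univ (fun x _ => (Real.hasDerivAt_exp x).hasDerivWithinAt)
    Real.exp_injective.injOn g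
  rw [Set.image_univ, Real.range_exp] at h
  rw [h, setIntegral_univ]
  simp only [Real.abs_exp]

lemma integrable_Ioi_exp {E : Type*} [NormedAddCommGroup E] [NormedSpace ℝ E] (g : ℝ → E) :
    IntegrableOn g (Set.Ioi (0 : ℝ)) ↔ Integrable (fun τ : ℝ => Real.exp τ • g (Real.exp τ)) := by
  have h := integrableOn_image_iff_integrableOn_abs_deriv_smul (s := Set.univ) (f := Real.exp)
    (f' := Real.exp) MeasurableSet.univ (fun x _ => (Real.hasDerivAt_exp x).hasDerivWithinAt)
    Real.exp_injective.injOn g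
  rw [Set.image_univ, Real.range_exp, integrableOn_univ] at h
  rw [h]
  simp only [Real.abs_exp]

lemma Gamma_eq_exp_integral {s : ℂ} (hs : 0 < s.re) :
    Complex.Gamma s = ∫ τ : ℝ, Complex.exp (s * τ - Real.exp τ) := by
  rw [Complex.Gamma_eq_integral hs, Complex.GammaIntegral, integral_Ioi_exp]
  congr 1
  ext τ
  have hne : (Real.exp τ : ℂ) ≠ 0 := by exact_mod_cast (Real.exp_pos τ).ne'
  rw [Complex.real_smul, Complex.cpow_def_of_ne_zero hne, ← Complex.ofReal_log (Real.exp_pos τ).le,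
    Real.log_exp, Complex.ofReal_exp, Complex.ofReal_exp, ← Complex.exp_add, ← Complex.exp_add]
  congr 1
  push_cast
  ring

lemma integrable_exp_exp : Integrable (fun τ : ℝ => Real.exp (τ - Real.exp τ)) := by
  have h := (integrable_Ioi_exp (fun x : ℝ => Real.exp (-x))).1
    (by simpa using integrableOn_exp_neg_Ioi 0)
  refine h.congr (Eventually.of_forall fun τ => ?_)
  simp only [smul_eq_mul]
  rw [← Real.exp_add, sub_eq_add_neg]

lemma norm_FF_shift (v y : ℝ) :
    Real.exp y * ‖FF (1 + v * I) (Real.exp y)‖ = 2 *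
      ‖∫ τ : ℝ, Complex.exp ((1 + v * I) * τ - Real.exp τ
        - Real.exp (2 * y) / 4 * Real.exp (-τ))‖ := by
  unfold FF
  rw [← integral_add_right_eq_self _ (Real.log 2 - y)]
  have h : ∀ τ : ℝ, Complex.exp ((1 + v * I) * ((τ + (Real.log 2 - y) : ℝ) : ℂ) -
      (Real.exp y : ℂ) * (Real.cosh (τ + (Real.log 2 - y)) : ℂ)) =
      Complex.exp ((1 + v * I) * ((Real.log 2 - y : ℝ) : ℂ)) *
      Complex.exp ((1 + v * I) * τ - Real.exp τ
        - Real.exp (2 * y) / 4 * Real.exp (-τ)) := by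
    intro τ
    rw [← Complex.exp_add]
    congr 1
    have : Real.exp y * Real.cosh (τ + (Real.log 2 - y)) =
        Real.exp τ + Real.exp (2 * y) / 4 * Real.exp (-τ) := by
      rw [Real.cosh_eq, neg_add, Real.exp_add, Real.exp_add, neg_sub, Real.exp_sub, Real.exp_sub,
        Real.exp_log two_pos, two_mul, Real.exp_add]
      field_simp
      ring
    have h2 := congrArg (fun z : ℝ => (z : ℂ)) this
    push_cast at h2 ⊢
    linear_combination -h2
  simp_rw [h]
  rw [integral_const_mul, norm_mul, Complex.norm_exp]
  have : ((1 + v * I) * ((Real.log 2 - y : ℝ) : ℂ)).re = Real.log 2 - y := by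
    rw [Complex.re_mul_ofReal]; simp
  rw [this, Real.exp_sub, Real.exp_log two_pos, ← mul_assoc, mul_div_cancel₀ _ (Real.exp_pos y).ne']

open Topology in
lemma tendsto_energy (v : ℝ) :
    Tendsto (fun y => kk1 v y ^ 2 + v ^ 2 * kk v y ^ 2) atBot
      (𝓝 (4 * ‖Complex.Gamma (1 + v * I)‖ ^ 2)) := by
  simp_rw [kk_energy, norm_FF_shift]
  have h : Tendsto (fun y : ℝ => ∫ τ : ℝ, Complex.exp ((1 + v * I) * τ - Real.exp τ
        - Real.exp (2 * y) / 4 * Real.exp (-τ))) atBot (𝓝 (Complex.Gamma (1 + v * I))) := by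
    rw [Gamma_eq_exp_integral (by simp)]
    refine tendsto_integral_filter_of_dominated_convergence (fun τ => Real.exp (τ - Real.exp τ))
      (Eventually.of_forall fun y => by fun_prop) (Eventually.of_forall fun y =>
        Eventually.of_forall fun τ => ?_) integrable_exp_exp (Eventually.of_forall fun τ => ?_)
    · rw [Complex.norm_exp]
      apply Real.exp_le_exp.2
      have : ((1 + v * I) * τ - Real.exp τ - Real.exp (2 * y) / 4 * Real.exp (-τ) : ℂ).re
          = τ - Real.exp τ - Real.exp (2 * y) / 4 * Real.exp (-τ) := by
        have : (Real.exp (2 * y) / 4 * Real.exp (-τ) : ℂ)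
          = ((Real.exp (2 * y) / 4 * Real.exp (-τ) : ℝ) : ℂ) := by push_cast; rfl
        rw [this, sub_re, sub_re, ofReal_re, ofReal_re]
        simp
      rw [this]
      have : 0 ≤ Real.exp (2 * y) / 4 * Real.exp (-τ) := by positivity
      linarith
    · have h0 : Tendsto (fun y : ℝ => Real.exp (2 * y)) atBot (𝓝 0) :=
        Real.tendsto_exp_atBot.comp (tendsto_id.const_mul_atBot two_pos)
      have h1 : Tendsto (fun y : ℝ => (Real.exp (2 * y) : ℂ)) atBot (𝓝 ((0 : ℝ) : ℂ)) :=
        (Complex.continuous_ofReal.tendsto 0).comp h0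
      have h2 := ((h1.div_const 4).mul_const (Real.exp (-τ) : ℂ)).const_sub
        ((1 + v * I) * τ - Real.exp τ)
      have h3 := (Complex.continuous_exp.tendsto _).comp h2
      simpa [Function.comp_def] using h3
  have h2 := ((h.norm.const_mul 2).pow 2)
  rwa [mul_pow, show (2 : ℝ) ^ 2 = 4 by norm_num] at h2

lemma norm_Gamma_sq {v : ℝ} (hv : 0 < v) :
    ‖Complex.Gamma (1 + v * I)‖ ^ 2 = Real.pi * v / Real.sinh (Real.pi * v) := by
  have hvI : (v * I : ℂ) ≠ 0 := by simp [hv.ne']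
  have h1 : Complex.Gamma (1 + v * I) = v * I * Complex.Gamma (v * I) := by
    rw [add_comm, Complex.Gamma_add_one _ hvI]
  have h2 : (starRingEnd ℂ) (Complex.Gamma (1 + v * I)) = Complex.Gamma (1 - v * I) := by
    rw [← Complex.Gamma_conj]
    congr 1
    simp
    ring
  have h3 := Complex.mul_conj (Complex.Gamma (1 + v * I))
  rw [h2, h1, mul_assoc, Complex.Gamma_mul_Gamma_one_sub, ← mul_assoc, Complex.sin_mul_I, ← h1] at h3
  have hs : Real.sinh (Real.pi * v) ≠ 0 := by
    have : 0 < Real.sinh (Real.pi * v) := Real.sinh_pos_iff.2 (by positivity)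
    exact this.ne'
  have hs' : Complex.sinh (Real.pi * v) ≠ 0 := by exact_mod_cast hs
  rw [Complex.sq_norm]
  have h4 : ((Complex.normSq (Complex.Gamma (1 + v * I)) : ℝ) : ℂ)
      = ((Real.pi * v / Real.sinh (Real.pi * v) : ℝ) : ℂ) := by
    rw [← h3]
    push_cast
    have := Complex.I_ne_zero
    field_simp
  exact_mod_cast h4

lemma cosh_shift_re (t α : ℝ) : (Complex.cosh (t + α * I)).re = Real.cosh t * Real.cos α := by
  rw [Complex.cosh_add, Complex.cosh_mul_I, Complex.sinh_mul_I]
  have : (Complex.cosh t * Complex.cos α + Complex.sinh t * (Complex.sin α * I)) =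
    ((Real.cosh t * Real.cos α : ℝ) : ℂ) + ((Real.sinh t * Real.sin α : ℝ) : ℂ) * I := by
    push_cast; ring
  rw [this, add_re, ofReal_re, re_ofReal_mul]
  simp

/-- The shifted integrand. -/
def shf (v u α t : ℝ) : ℂ := Complex.exp (v * I * (t + α * I) - u * Complex.cosh (t + α * I))

lemma norm_shf (v u α t : ℝ) :
    ‖shf v u α t‖ = Real.exp (-(v * α) - u * (Real.cosh t * Real.cos α)) := by
  unfold shf
  rw [Complex.norm_exp, sub_re, Complex.re_ofReal_mul, cosh_shift_re]
  simp

lemma norm_sinh_shift (t α : ℝ) : ‖Complex.sinh (t + α * I)‖ ≤ Real.cosh t := by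
  rw [Complex.sinh, Real.cosh_eq, norm_div]
  have h1 : ‖Complex.exp (t + α * I)‖ = Real.exp t := by rw [Complex.norm_exp]; simp
  have h2 : ‖Complex.exp (-(t + α * I))‖ = Real.exp (-t) := by rw [Complex.norm_exp]; simp
  have h3 := norm_sub_le (Complex.exp (t + α * I)) (Complex.exp (-(t + α * I)))
  rw [h1, h2] at h3
  have h4 : ‖(2 : ℂ)‖ = 2 := by norm_num
  rw [h4]
  gcongr

lemma integrable_shf_bound (v : ℝ) {u c : ℝ} (hu : 0 < u) (hc : 0 < c) :
    Integrable (fun t : ℝ => (|v| + u * Real.cosh t) * Real.exp (|v| - u * c * Real.cosh t)) := by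
  have hb := fun b : ℝ => integrable_exp_cosh b (mul_pos hu hc)
  have h : Integrable (fun t : ℝ => Real.exp |v| * (|v| * Real.exp (0 * t - u * c * Real.cosh t) +
    u / 2 * (Real.exp (1 * t - u * c * Real.cosh t) + Real.exp (-1 * t - u * c * Real.cosh t)))) :=
    (((hb 0).const_mul _).add (((hb 1).add (hb (-1))).const_mul _)).const_mul _
  refine h.congr (Eventually.of_forall fun t => ?_)
  simp only [sub_eq_add_neg, Real.exp_add, zero_mul, Real.exp_zero, one_mul, neg_mul]
  rw [Real.cosh_eq t]
  ring

lemma shf_bound (v : ℝ) {u α t : ℝ} (hu : 0 < u) (hα : |α| ≤ 1) :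
    ‖(v * I - u * Complex.sinh (t + α * I)) * shf v u α t‖ ≤
      (|v| + u * Real.cosh t) * Real.exp (|v| - u * Real.cos 1 * Real.cosh t) := by
  rw [norm_mul, norm_shf]
  have h1 : ‖(v * I - u * Complex.sinh (t + α * I) : ℂ)‖ ≤ |v| + u * Real.cosh t := by
    refine (norm_sub_le _ _).trans ?_
    rw [norm_mul, norm_mul, Complex.norm_I, Complex.norm_real, Complex.norm_real, mul_one,
      Real.norm_eq_abs, Real.norm_eq_abs, abs_of_pos hu]
    gcongr
    exact norm_sinh_shift t α
  have hc : Real.cos 1 ≤ Real.cos α := by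
    rw [← Real.cos_abs α]
    exact Real.cos_le_cos_of_nonneg_of_le_pi (abs_nonneg _) (by linarith [Real.pi_gt_three]) hα
  have hv : -(v * α) ≤ |v| := by
    have := neg_abs_le (v * α)
    rw [abs_mul] at this
    nlinarith [abs_nonneg v]
  have hch := Real.cosh_pos t
  have : u * Real.cos 1 * Real.cosh t = u * (Real.cosh t * Real.cos 1) := by ring
  rw [this]
  gcongr

lemma integrable_shf (v : ℝ) {u α : ℝ} (hu : 0 < u) (hα : |α| ≤ 1) :
    Integrable (shf v u α) := by
  have hc : Real.cos 1 ≤ Real.cos α := by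
    rw [← Real.cos_abs α]
    exact Real.cos_le_cos_of_nonneg_of_le_pi (abs_nonneg _) (by linarith [Real.pi_gt_three]) hα
  have h := (integrable_exp_cosh 0 (mul_pos hu Real.cos_one_pos)).const_mul (Real.exp (-(v * α)))
  refine h.mono' (by unfold shf; fun_prop) (Eventually.of_forall fun t => ?_)
  rw [norm_shf, ← Real.exp_add]
  apply Real.exp_le_exp.2
  have := mul_le_mul_of_nonneg_left hc (mul_pos hu (Real.cosh_pos t)).le
  nlinarith

lemma hasDerivAt_shf_t (v u α t : ℝ) :
    HasDerivAt (fun t => shf v u α t) ((v * I - u * Complex.sinh (t + α * I)) * shf v u α t) t := by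
  have h0 : HasDerivAt (fun t : ℝ => (t + α * I : ℂ)) 1 t :=
    (Complex.ofRealCLM.hasDerivAt (x := t)).add_const _
  have h1 := ((h0.const_mul (v * I : ℂ)).sub
    (((Complex.hasDerivAt_cosh (t + α * I)).comp t h0).const_mul (u : ℂ))).cexp
  refine h1.congr_deriv ?_
  simp only [shf, Pi.sub_apply, Function.comp]
  ring

lemma hasDerivAt_shf_a (v u α t : ℝ) :
    HasDerivAt (fun α => shf v u α t)
      (I * ((v * I - u * Complex.sinh (t + α * I)) * shf v u α t)) α := by
  have h00 : HasDerivAt (fun α : ℝ => (α : ℂ)) 1 α := Complex.ofRealCLM.hasDerivAt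
  have h0 : HasDerivAt (fun α : ℝ => (t + α * I : ℂ)) I α := by
    simpa using (h00.mul_const I).const_add (t : ℂ)
  have h1 := ((h0.const_mul (v * I : ℂ)).sub
    (((Complex.hasDerivAt_cosh (t + α * I)).comp α h0).const_mul (u : ℂ))).cexp
  refine h1.congr_deriv ?_
  simp only [shf, Pi.sub_apply, Function.comp]
  ring

lemma hasDerivAt_int_shf (v : ℝ) {u α : ℝ} (hu : 0 < u) (hα : |α| < 1) :
    HasDerivAt (fun α => ∫ t, shf v u α t) 0 α := by
  have h := hasDerivAt_integral_of_dominated_loc_of_deriv_le (𝕜 := ℝ) (μ := volume)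
    (F := fun α t => shf v u α t)
    (F' := fun α t => I * ((v * I - u * Complex.sinh (t + α * I)) * shf v u α t))
    (x₀ := α) (s := Set.Ioo (-1) 1) (Ioo_mem_nhds (abs_lt.1 hα).1 (abs_lt.1 hα).2)
    (Eventually.of_forall fun v => by unfold shf; fun_prop) (integrable_shf v hu hα.le)
    (by unfold shf; fun_prop)
    (Eventually.of_forall fun t α hα => by
      rw [norm_mul, Complex.norm_I, one_mul]
      exact shf_bound v hu (abs_lt.2 hα).le)
    (integrable_shf_bound v hu Real.cos_one_pos)
    (Eventually.of_forall fun t α _ => hasDerivAt_shf_a v u α t)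
  refine h.2.congr_deriv ?_
  rw [integral_const_mul, integral_eq_zero_of_hasDerivAt_of_integrable (hasDerivAt_shf_t v u α) ?_
    (integrable_shf v hu hα.le), mul_zero]
  exact (integrable_shf_bound v hu Real.cos_one_pos).mono' (by unfold shf; fun_prop)
    (Eventually.of_forall fun t => shf_bound v hu hα.le)

lemma FF_shift (v : ℝ) {u : ℝ} (hu : 0 < u) :
    FF (v * I) u = ∫ t, shf v u (Real.pi / 4) t := by
  have hp : Real.pi / 4 < 1 := by linarith [Real.pi_lt_four]
  have hp0 : 0 < Real.pi / 4 := by positivity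
  have hd : ∀ α ∈ Set.Icc 0 (Real.pi / 4), HasDerivAt (fun α => ∫ t, shf v u α t) 0 α :=
    fun α hα => hasDerivAt_int_shf v hu (abs_lt.2 ⟨by linarith [hα.1], by linarith [hα.2]⟩)
  have h := constant_of_has_deriv_right_zero (f := fun α => ∫ t, shf v u α t) (a := 0)
    (b := Real.pi / 4) (fun α hα => (hd α hα).continuousAt.continuousWithinAt)
    (fun α hα => (hd α ⟨hα.1, hα.2.le⟩).hasDerivWithinAt) (Real.pi / 4) ⟨hp0.le, le_rfl⟩
  refine Eq.trans ?_ h.symm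
  unfold FF shf
  congr 1
  ext t
  simp

/-- Exponential decay of the Bessel function past the turning point. -/
lemma kk_exp_bound (v : ℝ) {y : ℝ} (hy : 3 ≤ Real.exp y) :
    |kk v y| ≤ Real.exp (-(v * (Real.pi / 4)) + (1 - Real.exp y * (√2 / 2))) *
      ∫ t : ℝ, Real.exp (0 * t - 1 * Real.cosh t) := by
  have hu := Real.exp_pos y
  have h1 : |kk v y| = ‖FF (v * I) (Real.exp y)‖ := by
    rw [FF_eq_Kbes v hu, Complex.norm_real]; rfl
  rw [h1, FF_shift v hu]
  refine (norm_integral_le_integral_norm _).trans ?_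
  rw [← integral_const_mul]
  have hp : |Real.pi / 4| ≤ 1 := by
    rw [abs_of_pos (by positivity)]; linarith [Real.pi_lt_four]
  refine integral_mono (integrable_shf v hu hp).norm
    ((integrable_exp_cosh _ one_pos).const_mul _) fun t => ?_
  simp only
  rw [norm_shf, ← Real.exp_add, Real.cos_pi_div_four]
  apply Real.exp_le_exp.2
  have h2 : 1 ≤ √2 := Real.one_le_sqrt.2 (by norm_num)
  have h3 : 1 ≤ Real.exp y * (√2 / 2) := by nlinarith
  nlinarith [Real.one_le_cosh t]

open Topology in
/-- Solutions of the Bessel equation in logarithmic variable, decaying at infinity, with energy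
`D` at `-∞`. -/
structure BesODE (ν D : ℝ) (k k1 : ℝ → ℝ) : Prop where
  hν : 2 ≤ ν
  hk : ∀ y, HasDerivAt k (k1 y) y
  hk1 : ∀ y, HasDerivAt k1 ((Real.exp (2 * y) - ν ^ 2) * k y) y
  hD : Tendsto (fun y => k1 y ^ 2 + ν ^ 2 * k y ^ 2) atBot (𝓝 D)
  hinf : Tendsto k atTop (𝓝 0)
  hinf1 : Tendsto k1 atTop (𝓝 0)

lemma hasDerivAt_exp_two (y : ℝ) :
    HasDerivAt (fun y : ℝ => Real.exp (2 * y)) (2 * Real.exp (2 * y)) y := by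
  have h := ((hasDerivAt_id y).const_mul 2).exp
  refine h.congr_deriv ?_
  simp only [id]
  ring

lemma exp_two_mono {y z : ℝ} (h : y ≤ z) : Real.exp (2 * y) ≤ Real.exp (2 * z) :=
  Real.exp_le_exp.2 (by linarith)

variable {ν D : ℝ} {k k1 : ℝ → ℝ}

lemma BesODE.D_nonneg (h : BesODE ν D k k1) : 0 ≤ D :=
  ge_of_tendsto h.hD (Eventually.of_forall fun y => by positivity)

lemma BesODE.energy_anti (h : BesODE ν D k k1) :
    Antitone (fun y => k1 y ^ 2 + (ν ^ 2 - Real.exp (2 * y)) * k y ^ 2) := by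
  have hd : ∀ y, HasDerivAt (fun y => k1 y ^ 2 + (ν ^ 2 - Real.exp (2 * y)) * k y ^ 2)
      (-(2 * Real.exp (2 * y) * k y ^ 2)) y := by
    intro y
    have h1 := ((h.hk1 y).pow 2).add
      (((hasDerivAt_exp_two y).const_sub (ν ^ 2)).mul ((h.hk y).pow 2))
    refine h1.congr_deriv ?_
    simp only [Pi.pow_apply, Nat.cast_ofNat]
    ring
  refine antitone_of_deriv_nonpos (fun y => (hd y).differentiableAt) fun y => ?_
  rw [(hd y).deriv]
  have : 0 ≤ 2 * Real.exp (2 * y) * k y ^ 2 := by positivity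
  linarith

lemma BesODE.energy_le (h : BesODE ν D k k1) (y : ℝ) :
    k1 y ^ 2 + (ν ^ 2 - Real.exp (2 * y)) * k y ^ 2 ≤ D := by
  refine ge_of_tendsto h.hD ?_
  filter_upwards [eventually_le_atBot y] with z hz
  have h1 := h.energy_anti hz
  simp only at h1
  have h2 : 0 ≤ Real.exp (2 * z) * k z ^ 2 := by positivity
  nlinarith

lemma BesODE.prod_nonpos (h : BesODE ν D k k1) {y : ℝ} (hy : ν ^ 2 ≤ Real.exp (2 * y)) :
    k y * k1 y ≤ 0 := by
  have hd : ∀ z, HasDerivAt (fun z => k z * k1 z)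
      (k1 z ^ 2 + (Real.exp (2 * z) - ν ^ 2) * k z ^ 2) z := by
    intro z
    refine ((h.hk z).mul (h.hk1 z)).congr_deriv ?_
    ring
  have hm : MonotoneOn (fun z => k z * k1 z) (Set.Ici y) := by
    refine monotoneOn_of_deriv_nonneg (convex_Ici y)
      (fun z _ => (hd z).continuousAt.continuousWithinAt)
      (fun z _ => (hd z).differentiableAt.differentiableWithinAt) fun z hz => ?_
    rw [(hd z).deriv]
    rw [interior_Ici] at hz
    have := exp_two_mono (le_of_lt hz)
    have h1 : 0 ≤ (Real.exp (2 * z) - ν ^ 2) * k z ^ 2 :=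
      mul_nonneg (by linarith) (sq_nonneg _)
    positivity
  have ht := h.hinf.mul h.hinf1
  rw [mul_zero] at ht
  refine ge_of_tendsto ht ?_
  filter_upwards [eventually_ge_atTop y] with z hz
  exact hm (Set.self_mem_Ici) hz hz

lemma BesODE.decay (h : BesODE ν D k k1) {y z : ℝ} (hy : ν ^ 2 ≤ Real.exp (2 * y)) (hz : y ≤ z) :
    k z ^ 2 ≤ k y ^ 2 ∧ k1 z ^ 2 ≤ k1 y ^ 2 := by
  constructor
  · have hm : AntitoneOn (fun z => k z ^ 2) (Set.Ici y) := by
      refine antitoneOn_of_deriv_nonpos (convex_Ici y)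
        (fun z _ => ((h.hk z).pow 2).continuousAt.continuousWithinAt)
        (fun z _ => ((h.hk z).pow 2).differentiableAt.differentiableWithinAt) fun z hz => ?_
      rw [interior_Ici] at hz
      have h1 := (h.hk z).pow 2
      have := h.prod_nonpos (hy.trans (exp_two_mono (le_of_lt hz)))
      change deriv (k ^ 2) z ≤ 0
      rw [h1.deriv]
      simp only [Nat.cast_ofNat, Nat.add_one_sub_one, pow_one]
      nlinarith
    exact hm (Set.self_mem_Ici) hz hz
  · have hm : AntitoneOn (fun z => k1 z ^ 2) (Set.Ici y) := by
      refine antitoneOn_of_deriv_nonpos (convex_Ici y)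
        (fun z _ => ((h.hk1 z).pow 2).continuousAt.continuousWithinAt)
        (fun z _ => ((h.hk1 z).pow 2).differentiableAt.differentiableWithinAt) fun z hz => ?_
      rw [interior_Ici] at hz
      have h1 := (h.hk1 z).pow 2
      have h2 := hy.trans (exp_two_mono (le_of_lt hz))
      have := h.prod_nonpos h2
      change deriv (k1 ^ 2) z ≤ 0
      rw [h1.deriv]
      simp only [Nat.cast_ofNat, Nat.add_one_sub_one, pow_one]
      nlinarith
    exact hm (Set.self_mem_Ici) hz hz

/-- The adiabatic invariant. -/
lemma BesODE.adiabatic (h : BesODE ν D k k1) {y1 : ℝ} (hq : Real.exp (2 * y1) < ν ^ 2)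
    (hs : Real.exp (2 * y1) ≤ √(ν ^ 2 - Real.exp (2 * y1)) ^ 3) {y : ℝ} (hy : y ≤ y1) :
    k1 y ^ 2 / √(ν ^ 2 - Real.exp (2 * y)) + √(ν ^ 2 - Real.exp (2 * y)) * k y ^ 2 ≤ 4 * (D / ν) := by
  have hν := h.hν
  set Q : ℝ → ℝ := fun y => √(ν ^ 2 - Real.exp (2 * y)) with hQ
  have hqp : ∀ z ≤ y1, 0 < ν ^ 2 - Real.exp (2 * z) := fun z hz => by
    have := exp_two_mono hz; linarith
  have hQp : ∀ z ≤ y1, 0 < Q z := fun z hz => Real.sqrt_pos.2 (hqp z hz)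
  have hQ2 : ∀ z ≤ y1, Q z ^ 2 = ν ^ 2 - Real.exp (2 * z) := fun z hz => Real.sq_sqrt (hqp z hz).le
  have hsz : ∀ z ≤ y1, Real.exp (2 * z) / Q z ^ 3 ≤ 1 := by
    intro z hz
    rw [div_le_one (pow_pos (hQp z hz) 3)]
    refine (exp_two_mono hz).trans (hs.trans ?_)
    refine pow_le_pow_left₀ (Real.sqrt_nonneg _) ?_ 3
    apply Real.sqrt_le_sqrt
    linarith [exp_two_mono hz]
  have hQd : ∀ z ≤ y1, HasDerivAt Q (-Real.exp (2 * z) / Q z) z := by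
    intro z hz
    have h1 := ((hasDerivAt_exp_two z).const_sub (ν ^ 2)).sqrt (hqp z hz).ne'
    refine h1.congr_deriv ?_
    have := (hQp z hz).ne'
    simp only [hQ] at this ⊢
    field_simp
  set H : ℝ → ℝ := fun z => (k1 z ^ 2 / Q z + Q z * k z ^ 2 -
    Real.exp (2 * z) / Q z ^ 3 * (k z * k1 z)) * (1 - Real.exp (2 * z) / Q z ^ 3 / 2) with hH
  have hHd : ∀ z ≤ y1, HasDerivAt H (-((2 * Real.exp (2 * z) / Q z ^ 3 +
      3 * Real.exp (2 * z) ^ 2 / Q z ^ 5) * ((k1 z ^ 2 / Q z + Q z * k z ^ 2) / 2 +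
      k z * k1 z * (1 - Real.exp (2 * z) / Q z ^ 3)))) z := by
    intro z hz
    have hQz := (hQp z hz).ne'
    have hk1' : HasDerivAt k1 (-(Q z ^ 2 * k z)) z := by
      refine (h.hk1 z).congr_deriv ?_
      rw [hQ2 z hz]; ring
    have hk := h.hk z
    have hQ' := hQd z hz
    have he := hasDerivAt_exp_two z
    have hsd := he.div (hQ'.pow 3) (pow_ne_zero 3 hQz)
    have h1 := ((((hk1'.pow 2).div hQ' hQz).add (hQ'.mul (hk.pow 2))).sub
      (hsd.mul (hk.mul hk1'))).mul ((hsd.div_const 2).const_sub 1)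
    refine h1.congr_deriv ?_
    simp only [Pi.pow_apply, Nat.cast_ofNat, Pi.mul_apply, Pi.add_apply, Pi.sub_apply, Pi.div_apply]
    field_simp
    ring
  have hkk : ∀ z ≤ y1, |k z * k1 z| ≤ (k1 z ^ 2 / Q z + Q z * k z ^ 2) / 2 := by
    intro z hz
    have hQz := hQp z hz
    have e1 : k1 z ^ 2 / Q z + Q z * k z ^ 2 - 2 * (k z * k1 z) = (k1 z - Q z * k z) ^ 2 / Q z := by
      field_simp; ring
    have e2 : k1 z ^ 2 / Q z + Q z * k z ^ 2 + 2 * (k z * k1 z) = (k1 z + Q z * k z) ^ 2 / Q z := by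
      field_simp; ring
    have e3 : 0 ≤ (k1 z - Q z * k z) ^ 2 / Q z := by positivity
    have e4 : 0 ≤ (k1 z + Q z * k z) ^ 2 / Q z := by positivity
    rw [abs_le]
    constructor <;> linarith
  have hs0 : ∀ z ≤ y1, 0 ≤ Real.exp (2 * z) / Q z ^ 3 := fun z hz => by
    have := hQp z hz
    positivity
  have hanti : AntitoneOn H (Set.Iic y1) := by
    refine antitoneOn_of_deriv_nonpos (convex_Iic y1)
      (fun z hz => (hHd z hz).continuousAt.continuousWithinAt)
      (fun z hz => (hHd z (Set.mem_Iic.1 (interior_subset hz))).differentiableAt.differentiableWithinAt)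
      fun z hz => ?_
    have hz' : z ≤ y1 := Set.mem_Iic.1 (interior_subset hz)
    rw [(hHd z hz').deriv, neg_nonpos]
    have hQz := hQp z hz'
    have a1 := abs_le.1 (hkk z hz')
    have a2 := hsz z hz'
    have a3 := hs0 z hz'
    refine mul_nonneg (by positivity) ?_
    have : -((k1 z ^ 2 / Q z + Q z * k z ^ 2) / 2) ≤ k z * k1 z * (1 - Real.exp (2 * z) / Q z ^ 3) := by
      have h0 : 0 ≤ (k1 z ^ 2 / Q z + Q z * k z ^ 2) / 2 := by positivity
      nlinarith
    linarith
  have hQlim : Tendsto Q atBot (nhds ν) := by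
    have h0 : Tendsto (fun y : ℝ => Real.exp (2 * y)) atBot (nhds 0) :=
      Real.tendsto_exp_atBot.comp (tendsto_id.const_mul_atBot two_pos)
    have h1 := (h0.const_sub (ν ^ 2)).sqrt
    rwa [sub_zero, Real.sqrt_sq (by linarith)] at h1
  have hlim : Tendsto (fun z => (k1 z ^ 2 + ν ^ 2 * k z ^ 2) / Q z) atBot (nhds (D / ν)) :=
    h.hD.div hQlim (by linarith)
  have hHy : H y ≤ D / ν := by
    refine ge_of_tendsto hlim ?_
    filter_upwards [eventually_le_atBot y] with z hz
    have hz1 := hz.trans hy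
    refine (hanti (Set.mem_Iic.2 hz1) (Set.mem_Iic.2 hy) hz).trans ?_
    have hQz := hQp z hz1
    have a1 := abs_le.1 (hkk z hz1)
    have a2 := hsz z hz1
    have a3 := hs0 z hz1
    have b1 : k1 z ^ 2 / Q z + Q z * k z ^ 2 ≤ (k1 z ^ 2 + ν ^ 2 * k z ^ 2) / Q z := by
      rw [add_div]
      have : Q z * k z ^ 2 = Q z ^ 2 * k z ^ 2 / Q z := by field_simp
      rw [this]
      rw [hQ2 z hz1]
      gcongr
      linarith [Real.exp_pos (2 * z)]
    refine le_trans ?_ b1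
    simp only [hH]
    set G := k1 z ^ 2 / Q z + Q z * k z ^ 2
    set s := Real.exp (2 * z) / Q z ^ 3
    have g0 : 0 ≤ G := by linarith
    have c1 : G - s * (k z * k1 z) ≤ G * (1 + s / 2) := by nlinarith
    calc _ ≤ G * (1 + s / 2) * (1 - s / 2) := by
          apply mul_le_mul_of_nonneg_right c1; linarith
      _ ≤ G := by nlinarith [mul_nonneg g0 (sq_nonneg s)]
  have a1 := abs_le.1 (hkk y hy)
  have a2 := hsz y hy
  have a3 := hs0 y hy
  simp only [hH] at hHy
  change k1 y ^ 2 / Q y + Q y * k y ^ 2 ≤ _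
  set G := k1 y ^ 2 / Q y + Q y * k y ^ 2
  set s := Real.exp (2 * y) / Q y ^ 3
  have g0 : 0 ≤ G := by linarith
  have c1 : G * (1 - s / 2) ≤ G - s * (k y * k1 y) := by nlinarith
  have c2 : G * (1 - s / 2) * (1 - s / 2) ≤ D / ν :=
    (mul_le_mul_of_nonneg_right c1 (by linarith)).trans hHy
  have c3 : (1 : ℝ) / 4 ≤ (1 - s / 2) * (1 - s / 2) := by nlinarith
  nlinarith

/-- Approximate antiderivative of `k`. -/
def PP (ν : ℝ) (k k1 : ℝ → ℝ) (y : ℝ) : ℝ :=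
  -(k1 y / (ν ^ 2 - Real.exp (2 * y))) +
    k y * (2 * Real.exp (2 * y) / (ν ^ 2 - Real.exp (2 * y)) ^ 2)

/-- The second derivative of `1/q`. -/
def hh (ν y : ℝ) : ℝ := 4 * Real.exp (2 * y) / (ν ^ 2 - Real.exp (2 * y)) ^ 2 +
  8 * Real.exp (2 * y) ^ 2 / (ν ^ 2 - Real.exp (2 * y)) ^ 3

lemma hasDerivAt_RR {y : ℝ} (hq : ν ^ 2 - Real.exp (2 * y) ≠ 0) :
    HasDerivAt (fun y => 2 * Real.exp (2 * y) / (ν ^ 2 - Real.exp (2 * y)) ^ 2) (hh ν y) y := by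
  have he := hasDerivAt_exp_two y
  have h1 := (he.const_mul 2).div ((he.const_sub (ν ^ 2)).pow 2) (pow_ne_zero 2 hq)
  refine h1.congr_deriv ?_
  simp only [hh, Pi.pow_apply, Nat.cast_ofNat, Nat.add_one_sub_one, pow_one]
  field_simp
  ring

lemma BesODE.hasDerivAt_PP (h : BesODE ν D k k1) {y : ℝ} (hq : ν ^ 2 - Real.exp (2 * y) ≠ 0) :
    HasDerivAt (PP ν k k1) (k y + k y * hh ν y) y := by
  have he := hasDerivAt_exp_two y
  have h1 := (((h.hk1 y).div (he.const_sub (ν ^ 2)) hq).neg).add ((h.hk y).mul (hasDerivAt_RR hq))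
  refine h1.congr_deriv ?_
  field_simp
  ring

lemma continuousOn_hh {A B : ℝ} (hq : ∀ y ∈ Set.Icc A B, ν ^ 2 - Real.exp (2 * y) ≠ 0) :
    ContinuousOn (hh ν) (Set.Icc A B) := by
  unfold hh
  refine ContinuousOn.add (ContinuousOn.div (by fun_prop) (by fun_prop) ?_)
    (ContinuousOn.div (by fun_prop) (by fun_prop) ?_)
  · exact fun y hy => pow_ne_zero _ (hq y hy)
  · exact fun y hy => pow_ne_zero _ (hq y hy)

lemma BesODE.cont (h : BesODE ν D k k1) : Continuous k :=
  continuous_iff_continuousAt.2 fun y => (h.hk y).continuousAt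

lemma BesODE.cont1 (h : BesODE ν D k k1) : Continuous k1 :=
  continuous_iff_continuousAt.2 fun y => (h.hk1 y).continuousAt

lemma BesODE.int_bound (h : BesODE ν D k k1) {A B M : ℝ} (hAB : A ≤ B)
    (hq : Real.exp (2 * B) < ν ^ 2) (hM : ∀ y ∈ Set.Icc A B, |k y| ≤ M) :
    |∫ y in A..B, k y| ≤ |PP ν k k1 A| + |PP ν k k1 B| +
      M * (2 * Real.exp (2 * B) / (ν ^ 2 - Real.exp (2 * B)) ^ 2) := by
  have hM0 : 0 ≤ M := (abs_nonneg _).trans (hM A ⟨le_rfl, hAB⟩)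
  have hqp : ∀ y ∈ Set.Icc A B, 0 < ν ^ 2 - Real.exp (2 * y) := fun y hy => by
    have := exp_two_mono hy.2; linarith
  have hqn : ∀ y ∈ Set.Icc A B, ν ^ 2 - Real.exp (2 * y) ≠ 0 := fun y hy => (hqp y hy).ne'
  have hch := continuousOn_hh hqn
  have hi1 : IntervalIntegrable k volume A B := h.cont.intervalIntegrable _ _
  have hi3 : IntervalIntegrable (hh ν) volume A B := hch.intervalIntegrable_of_Icc hAB
  have hi2 : IntervalIntegrable (fun y => k y * hh ν y) volume A B :=
    (h.cont.continuousOn.mul hch).intervalIntegrable_of_Icc hAB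
  have hu : Set.uIcc A B = Set.Icc A B := Set.uIcc_of_le hAB
  have e1 := intervalIntegral.integral_eq_sub_of_hasDerivAt
    (f := PP ν k k1) (f' := fun y => k y + k y * hh ν y) (a := A) (b := B)
    (fun y hy => h.hasDerivAt_PP (hqn y (hu ▸ hy))) (hi1.add hi2)
  rw [intervalIntegral.integral_add hi1 hi2] at e1
  have e2 := intervalIntegral.integral_eq_sub_of_hasDerivAt
    (f := fun y => 2 * Real.exp (2 * y) / (ν ^ 2 - Real.exp (2 * y)) ^ 2) (f' := hh ν)
    (a := A) (b := B) (fun y hy => hasDerivAt_RR (hqn y (hu ▸ hy))) hi3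
  have e3 : |∫ y in A..B, k y * hh ν y| ≤ ∫ y in A..B, M * hh ν y := by
    rw [← Real.norm_eq_abs]
    refine intervalIntegral.norm_integral_le_of_norm_le (μ := volume) hAB
      (Eventually.of_forall fun y hy => ?_) (hi3.const_mul M)
    have hy' : y ∈ Set.Icc A B := ⟨hy.1.le, hy.2⟩
    have h0 : 0 ≤ hh ν y := by
      have := hqp y hy'
      unfold hh; positivity
    rw [Real.norm_eq_abs, abs_mul, abs_of_nonneg h0]
    exact mul_le_mul_of_nonneg_right (hM y hy') h0
  rw [intervalIntegral.integral_const_mul, e2] at e3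
  have e4 : ∫ y in A..B, k y = PP ν k k1 B - PP ν k k1 A - ∫ y in A..B, k y * hh ν y := by
    linarith
  have e5 : 0 ≤ M * (2 * Real.exp (2 * A) / (ν ^ 2 - Real.exp (2 * A)) ^ 2) := by positivity
  rw [mul_sub] at e3
  rw [e4]
  have t1 := abs_sub (PP ν k k1 B - PP ν k k1 A) (∫ y in A..B, k y * hh ν y)
  have t2 := abs_sub (PP ν k k1 B) (PP ν k k1 A)
  linarith

lemma three_split {k : ℝ → ℝ} (hk : Continuous k) {y1 y2 c1 c2 c3 : ℝ} (h12 : y1 ≤ y2)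
    (p1 : 0 ≤ c1) (p2 : 0 ≤ c2) (p3 : 0 ≤ c3)
    (h1 : ∀ A B, A ≤ B → B ≤ y1 → |∫ y in A..B, k y| ≤ c1)
    (h2 : ∀ A B, y1 ≤ A → A ≤ B → B ≤ y2 → |∫ y in A..B, k y| ≤ c2)
    (h3 : ∀ A B, y2 ≤ A → A ≤ B → |∫ y in A..B, k y| ≤ c3) {A B : ℝ} (hAB : A ≤ B) :
    |∫ y in A..B, k y| ≤ c1 + c2 + c3 := by
  have hi := fun a b => hk.intervalIntegrable (μ := volume) a b
  set c := max A (min B y1) with hc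
  set d := max A (min B y2) with hd
  have hAc : A ≤ c := le_max_left _ _
  have hcd : c ≤ d := max_le_max le_rfl (min_le_min le_rfl h12)
  have hdB : d ≤ B := max_le hAB (min_le_left _ _)
  have e : ∫ y in A..B, k y = (∫ y in A..c, k y) + (∫ y in c..d, k y) + ∫ y in d..B, k y := by
    rw [intervalIntegral.integral_add_adjacent_intervals (hi _ _) (hi _ _),
      intervalIntegral.integral_add_adjacent_intervals (hi _ _) (hi _ _)]
  have b1 : |∫ y in A..c, k y| ≤ c1 := by
    rcases le_total A (min B y1) with hA | hA
    · exact h1 _ _ hAc (by rw [hc, max_eq_right hA]; exact min_le_right _ _)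
    · rw [hc, max_eq_left hA]; simpa using p1
  have b2 : |∫ y in c..d, k y| ≤ c2 := by
    rcases le_total c d with _ | _
    · rcases le_or_gt y1 c with hc1 | hc1
      · rcases le_total A (min B y2) with hA | hA
        · exact h2 _ _ hc1 hcd (by rw [hd, max_eq_right hA]; exact min_le_right _ _)
        · have : c = d := le_antisymm hcd (by rw [hd, max_eq_left hA]; exact hAc)
          rw [this]; simpa using p2
      · have : c = d := by
          have hm : min B y1 < y1 := lt_of_le_of_lt (le_max_right _ _) hc1
          have hB : B < y1 := by
            rcases min_lt_iff.1 hm with h | h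
            · exact h
            · exact absurd h (lt_irrefl _)
          rw [hc, hd, min_eq_left hB.le, min_eq_left (hB.le.trans h12)]
        rw [this]; simpa using p2
    · have : c = d := le_antisymm hcd (by assumption)
      rw [this]; simpa using p2
  have b3 : |∫ y in d..B, k y| ≤ c3 := by
    rcases le_or_gt y2 d with hd1 | hd1
    · exact h3 _ _ hd1 hdB
    · have : d = B := by
        have hm : min B y2 < y2 := lt_of_le_of_lt (le_max_right _ _) hd1
        have hB : B < y2 := by
          rcases min_lt_iff.1 hm with h | h
          · exact h
          · exact absurd h (lt_irrefl _)
        rw [hd, min_eq_left hB.le, max_eq_right hAB]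
      rw [this]; simpa using p3
  rw [e]
  calc _ ≤ |∫ y in A..c, k y| + |∫ y in c..d, k y| + |∫ y in d..B, k y| := abs_add_three _ _ _
    _ ≤ _ := by linarith

set_option maxHeartbeats 4000000 in
/-- Integral bound valid through the turning point. -/
lemma BesODE.int_bound_turning (h : BesODE ν D k k1) {A B : ℝ} (hAB : A ≤ B) :
    |∫ y in A..B, k y| ≤ 60 * (√(D / ν) / ν) := by
  have hν := h.hν
  have hν0 : 0 < ν := by linarith
  set g := √(D / ν) with hg
  have hg0 : 0 ≤ g := Real.sqrt_nonneg _
  have hg2 : D / ν = g ^ 2 := (Real.sq_sqrt (div_nonneg h.D_nonneg hν0.le)).symm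
  obtain ⟨p, hp0, hp3⟩ : ∃ p : ℝ, 0 < p ∧ p ^ 3 = ν :=
    ⟨ν ^ (1 / 3 : ℝ), by positivity, by
      rw [← Real.rpow_natCast, ← Real.rpow_mul hν0.le]; norm_num⟩
  have hp1 : 5 / 4 ≤ p := by
    by_contra hcon
    push Not at hcon
    have : p ^ 3 < (5 / 4) ^ 3 := pow_lt_pow_left₀ hcon hp0.le (by norm_num)
    norm_num at this
    linarith
  set ε := 1 / p ^ 2 with hε
  have hε0 : 0 < ε := by positivity
  have hεp : ε * p ^ 2 = 1 := by rw [hε]; field_simp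
  have hε1 : ε ≤ 3 / 4 := by
    have : 3 / 2 ≤ p ^ 2 := by nlinarith
    nlinarith
  set L := Real.log ν with hL
  have hexpL : Real.exp (2 * L) = p ^ 6 := by
    rw [two_mul, Real.exp_add, Real.exp_log hν0, ← hp3]; ring
  set y1 := L - 2 * ε with hy1
  set y2 := L + ε with hy2
  have hν2 : ν ^ 2 = p ^ 6 := by rw [← hp3]; ring
  have hp6 : p ^ 6 * ε = p ^ 4 := by
    calc p ^ 6 * ε = p ^ 4 * (ε * p ^ 2) := by ring
      _ = _ := by rw [hεp, mul_one]
  -- bounds for q at y1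
  have hq1 : p ^ 4 ≤ ν ^ 2 - Real.exp (2 * y1) := by
    have e1 : Real.exp (2 * y1) = p ^ 6 * Real.exp (-(4 * ε)) := by
      rw [← hexpL, ← Real.exp_add]; congr 1; rw [hy1]; ring
    have e2 : Real.exp (-(4 * ε)) ≤ 1 - ε := by
      rw [Real.exp_neg, inv_le_comm₀ (Real.exp_pos _) (by linarith)]
      refine le_trans ?_ (Real.add_one_le_exp (4 * ε))
      rw [inv_le_iff_one_le_mul₀ (by linarith)]
      nlinarith
    have : p ^ 6 * Real.exp (-(4 * ε)) ≤ p ^ 6 * (1 - ε) := by gcongr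
    rw [e1, hν2]
    linarith
  have hq1' : ν ^ 2 - Real.exp (2 * y1) ≤ 4 * p ^ 4 := by
    have e1 : Real.exp (2 * y1) = p ^ 6 * Real.exp (-(4 * ε)) := by
      rw [← hexpL, ← Real.exp_add]; congr 1; rw [hy1]; ring
    have := Real.add_one_le_exp (-(4 * ε))
    have : p ^ 6 * (-(4 * ε) + 1) ≤ p ^ 6 * Real.exp (-(4 * ε)) := by gcongr
    rw [e1, hν2]
    linarith
  have hq2 : 2 * p ^ 4 ≤ Real.exp (2 * y2) - ν ^ 2 := by
    have e1 : Real.exp (2 * y2) = p ^ 6 * Real.exp (2 * ε) := by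
      rw [← hexpL, ← Real.exp_add]; congr 1; rw [hy2]; ring
    have := Real.add_one_le_exp (2 * ε)
    have : p ^ 6 * (2 * ε + 1) ≤ p ^ 6 * Real.exp (2 * ε) := by gcongr
    rw [e1, hν2]
    linarith
  have hlt1 : Real.exp (2 * y1) < ν ^ 2 := by have : 0 < p ^ 4 := by positivity
                                              linarith
  have hQge : ∀ y ≤ y1, p ^ 2 ≤ √(ν ^ 2 - Real.exp (2 * y)) := by
    intro y hy
    apply Real.le_sqrt_of_sq_le
    have := exp_two_mono hy
    calc (p ^ 2) ^ 2 = p ^ 4 := by ring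
      _ ≤ _ := by linarith
  have hs1 : Real.exp (2 * y1) ≤ √(ν ^ 2 - Real.exp (2 * y1)) ^ 3 := by
    have := pow_le_pow_left₀ (by positivity) (hQge y1 le_rfl) 3
    refine le_trans ?_ this
    calc _ ≤ ν ^ 2 := hlt1.le
      _ = _ := by rw [hν2]; ring
  have hG := fun y (hy : y ≤ y1) => h.adiabatic hlt1 hs1 hy
  rw [hg2] at hG
  -- region 1 pointwise
  have hk_1 : ∀ y ≤ y1, |k y| ≤ 2 * g / p := by
    intro y hy
    have a1 := hG y hy
    have a2 := hQge y hy
    set Q := √(ν ^ 2 - Real.exp (2 * y))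
    have hQ0 : 0 < Q := lt_of_lt_of_le (by positivity) a2
    have a3 : 0 ≤ k1 y ^ 2 / Q := by positivity
    have a4 : p ^ 2 * k y ^ 2 ≤ 4 * g ^ 2 := by nlinarith [sq_nonneg (k y)]
    apply abs_le_of_sq_le_sq _ (by positivity)
    rw [div_pow, le_div_iff₀ (by positivity)]
    linarith
  have hk1_1 : ∀ y ≤ y1, k1 y ^ 2 ≤ 4 * g ^ 2 * √(ν ^ 2 - Real.exp (2 * y)) := by
    intro y hy
    have a1 := hG y hy
    have a2 := hQge y hy
    set Q := √(ν ^ 2 - Real.exp (2 * y))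
    have hQ0 : 0 < Q := lt_of_lt_of_le (by positivity) a2
    have a3 : 0 ≤ Q * k y ^ 2 := by positivity
    rw [← div_le_iff₀ hQ0]
    linarith
  have hP : ∀ y ≤ y1, |PP ν k k1 y| ≤ 6 * (g / ν) := by
    intro y hy
    have a2 := hQge y hy
    have a5 := hk1_1 y hy
    have hqp : 0 < ν ^ 2 - Real.exp (2 * y) := by linarith [exp_two_mono hy]
    have hQ2 : √(ν ^ 2 - Real.exp (2 * y)) ^ 2 = ν ^ 2 - Real.exp (2 * y) := Real.sq_sqrt hqp.le
    have hw : Real.exp (2 * y) ≤ p ^ 6 := by rw [← hν2]; linarith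
    unfold PP
    rw [← hQ2]
    set Q := √(ν ^ 2 - Real.exp (2 * y))
    have hQ0 : 0 < Q := lt_of_lt_of_le (by positivity) a2
    have b1 : |k1 y / Q ^ 2| ≤ 2 * (g / ν) := by
      apply abs_le_of_sq_le_sq _ (by positivity)
      rw [div_pow, div_le_iff₀ (by positivity)]
      have c1 : p ^ 6 ≤ Q ^ 3 := by
        have := pow_le_pow_left₀ (by positivity) a2 3
        calc _ = (p ^ 2) ^ 3 := by ring
          _ ≤ _ := this
      have c2 : (2 * (g / ν)) ^ 2 * (Q ^ 2) ^ 2 = 4 * g ^ 2 * Q * (Q ^ 3 / p ^ 6) := by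
        rw [← hν2]; field_simp; ring
      rw [c2]
      have c3 : 1 ≤ Q ^ 3 / p ^ 6 := by rw [one_le_div (by positivity)]; exact c1
      calc _ ≤ 4 * g ^ 2 * Q * 1 := by linarith
        _ ≤ _ := by gcongr
    have b2 : |k y * (2 * Real.exp (2 * y) / (Q ^ 2) ^ 2)| ≤ 4 * (g / ν) := by
      rw [abs_mul]
      have c1 : |2 * Real.exp (2 * y) / (Q ^ 2) ^ 2| ≤ 2 * p ^ 6 / ((p ^ 2) ^ 2) ^ 2 := by
        rw [abs_of_nonneg (by positivity)]
        gcongr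
      calc _ ≤ (2 * g / p) * (2 * p ^ 6 / ((p ^ 2) ^ 2) ^ 2) :=
            mul_le_mul (hk_1 y hy) c1 (abs_nonneg _) (by positivity)
        _ = _ := by rw [← hp3]; field_simp; ring
    calc _ ≤ |-(k1 y / Q ^ 2)| + |k y * (2 * Real.exp (2 * y) / (Q ^ 2) ^ 2)| := abs_add_le _ _
      _ ≤ _ := by rw [abs_neg]; linarith
  have hR1 : ∀ A B, A ≤ B → B ≤ y1 → |∫ y in A..B, k y| ≤ 16 * (g / ν) := by
    intro A B hAB hB
    have hlt : Real.exp (2 * B) < ν ^ 2 := lt_of_le_of_lt (exp_two_mono hB) hlt1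
    have := h.int_bound hAB hlt (M := 2 * g / p) (fun y hy => hk_1 y (hy.2.trans hB))
    have e1 := hP A (hAB.trans hB)
    have e2 := hP B hB
    have e3 : 2 * g / p * (2 * Real.exp (2 * B) / (ν ^ 2 - Real.exp (2 * B)) ^ 2) ≤ 4 * (g / ν) := by
      have c0 : p ^ 4 ≤ ν ^ 2 - Real.exp (2 * B) := by linarith [exp_two_mono hB]
      calc _ ≤ 2 * g / p * (2 * p ^ 6 / (p ^ 4) ^ 2) := by
            gcongr
            rw [← hν2]; exact hlt.le
        _ = _ := by rw [← hp3]; field_simp; ring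
    linarith
  -- region between y1 and L
  have hyL : y1 ≤ L := by rw [hy1]; linarith
  have hk1_2a : ∀ y, y1 ≤ y → y ≤ L → k1 y ^ 2 ≤ (3 * g * p) ^ 2 := by
    intro y hya hyb
    have a1 := h.energy_anti hya
    simp only at a1
    have a2 := hG y1 le_rfl
    have a3 : Real.exp (2 * y) ≤ ν ^ 2 := by rw [hν2, ← hexpL]; exact exp_two_mono hyb
    have a4 : 0 ≤ (ν ^ 2 - Real.exp (2 * y)) * k y ^ 2 := mul_nonneg (by linarith) (sq_nonneg _)
    have hqp : 0 < ν ^ 2 - Real.exp (2 * y1) := by linarith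
    have hQ2 : √(ν ^ 2 - Real.exp (2 * y1)) ^ 2 = ν ^ 2 - Real.exp (2 * y1) := Real.sq_sqrt hqp.le
    have a6 : √(ν ^ 2 - Real.exp (2 * y1)) ≤ 2 * p ^ 2 := by
      rw [Real.sqrt_le_left (by positivity)]
      calc _ ≤ _ := hq1'
        _ = _ := by ring
    have a5 := hQge y1 le_rfl
    rw [← hQ2] at a1
    set Q := √(ν ^ 2 - Real.exp (2 * y1))
    have hQ0 : 0 < Q := lt_of_lt_of_le (by positivity) a5
    have a7 : k1 y1 ^ 2 + Q ^ 2 * k y1 ^ 2 = Q * (k1 y1 ^ 2 / Q + Q * k y1 ^ 2) := by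
      field_simp
    have a8 : Q * (k1 y1 ^ 2 / Q + Q * k y1 ^ 2) ≤ 2 * p ^ 2 * (4 * g ^ 2) :=
      mul_le_mul a6 a2 (by positivity) (by positivity)
    nlinarith [mul_nonneg (sq_nonneg g) (sq_nonneg p)]
  have hL2 : ν ^ 2 ≤ Real.exp (2 * L) := by rw [hν2, hexpL]
  have hk1_2 : ∀ y, y1 ≤ y → |k1 y| ≤ 3 * g * p := by
    intro y hy
    apply abs_le_of_sq_le_sq _ (by positivity)
    rcases le_total y L with hyl | hyl
    · exact hk1_2a y hy hyl
    · exact (h.decay hL2 hyl).2.trans (hk1_2a L hyL le_rfl)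
  have hk_2a : ∀ y, y1 ≤ y → y ≤ L → |k y| ≤ 8 * g / p := by
    intro y hya hyb
    have e := intervalIntegral.integral_eq_sub_of_hasDerivAt (fun y _ => h.hk y)
      (h.cont1.intervalIntegrable y1 y)
    have e2 : ‖∫ z in y1..y, k1 z‖ ≤ (3 * g * p) * |y - y1| := by
      apply intervalIntegral.norm_integral_le_of_norm_le_const
      intro z hz
      rw [Set.uIoc_of_le hya] at hz
      exact hk1_2 z hz.1.le
    rw [e, Real.norm_eq_abs, abs_of_nonneg (by linarith : 0 ≤ y - y1)] at e2
    have e3 := hk_1 y1 le_rfl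
    have e4 : 3 * g * p * (y - y1) ≤ 6 * g / p := by
      calc _ ≤ 3 * g * p * (2 * ε) := by
            gcongr
            rw [hy1]; linarith
        _ = _ := by rw [hε]; field_simp; ring
    have e5 : |k y| ≤ |k y - k y1| + |k y1| := by
      have := abs_add_le (k y - k y1) (k y1)
      simpa using this
    have e6 : 6 * g / p + 2 * g / p = 8 * g / p := by ring
    linarith
  have hk_2 : ∀ y, y1 ≤ y → |k y| ≤ 8 * g / p := by
    intro y hy
    rcases le_total y L with hyl | hyl
    · exact hk_2a y hy hyl
    · exact (sq_le_sq.1 (h.decay hL2 hyl).1).trans (hk_2a L hyL le_rfl)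
  have hR2 : ∀ A B, y1 ≤ A → A ≤ B → B ≤ y2 → |∫ y in A..B, k y| ≤ 24 * (g / ν) := by
    intro A B hA hAB hB
    have e2 : ‖∫ z in A..B, k z‖ ≤ (8 * g / p) * |B - A| := by
      apply intervalIntegral.norm_integral_le_of_norm_le_const
      intro z hz
      rw [Set.uIoc_of_le hAB] at hz
      exact hk_2 z (hA.trans hz.1.le)
    rw [Real.norm_eq_abs, abs_of_nonneg (by linarith : 0 ≤ B - A)] at e2
    refine e2.trans ?_
    calc _ ≤ 8 * g / p * (3 * ε) := by
          gcongr
          rw [hy2] at hB; rw [hy1] at hA; linarith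
      _ = _ := by rw [hε, ← hp3]; field_simp; ring
  have hR3 : ∀ A B, y2 ≤ A → A ≤ B → |∫ y in A..B, k y| ≤ 20 * (g / ν) := by
    intro A B hA hAB
    have hqp : ∀ y, A ≤ y → 2 * p ^ 4 ≤ Real.exp (2 * y) - ν ^ 2 := fun y hy => by
      linarith [exp_two_mono (hA.trans hy)]
    have hqn : ∀ y, A ≤ y → 0 < Real.exp (2 * y) - ν ^ 2 := fun y hy =>
      lt_of_lt_of_le (by positivity) (hqp y hy)
    have hy12 : y1 ≤ A := by rw [hy2] at hA; rw [hy1]; linarith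
    have hu : Set.uIcc A B = Set.Icc A B := Set.uIcc_of_le hAB
    have hd1 : ∀ y ∈ Set.uIcc A B, HasDerivAt (fun y => k1 y * (Real.exp (2 * y) - ν ^ 2)⁻¹)
        (k y + k1 y * (-(2 * Real.exp (2 * y)) / (Real.exp (2 * y) - ν ^ 2) ^ 2)) y := by
      intro y hy
      rw [hu] at hy
      have hn := (hqn y hy.1).ne'
      have := (h.hk1 y).mul (((hasDerivAt_exp_two y).sub_const (ν ^ 2)).inv hn)
      refine this.congr_deriv ?_
      simp only [Pi.inv_apply]
      field_simp
    have hd2 : ∀ y ∈ Set.uIcc A B, HasDerivAt (fun y => (Real.exp (2 * y) - ν ^ 2)⁻¹)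
        (-(2 * Real.exp (2 * y)) / (Real.exp (2 * y) - ν ^ 2) ^ 2) y := by
      intro y hy
      rw [hu] at hy
      exact ((hasDerivAt_exp_two y).sub_const (ν ^ 2)).inv (hqn y hy.1).ne'
    have hc : ContinuousOn (fun y => -(2 * Real.exp (2 * y)) / (Real.exp (2 * y) - ν ^ 2) ^ 2)
        (Set.Icc A B) :=
      ContinuousOn.div (by fun_prop) (by fun_prop) fun y hy => pow_ne_zero _ (hqn y hy.1).ne'
    have hi1 : IntervalIntegrable k volume A B := h.cont.intervalIntegrable _ _
    have hi3 := hc.intervalIntegrable_of_Icc (μ := volume) hAB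
    have hi2 : IntervalIntegrable (fun y => k1 y *
        (-(2 * Real.exp (2 * y)) / (Real.exp (2 * y) - ν ^ 2) ^ 2)) volume A B :=
      (h.cont1.continuousOn.mul hc).intervalIntegrable_of_Icc hAB
    have e1 := intervalIntegral.integral_eq_sub_of_hasDerivAt hd1 (hi1.add hi2)
    have e2 := intervalIntegral.integral_eq_sub_of_hasDerivAt hd2 hi3
    rw [intervalIntegral.integral_add hi1 hi2] at e1
    have e3 : |∫ y in A..B, k1 y * (-(2 * Real.exp (2 * y)) / (Real.exp (2 * y) - ν ^ 2) ^ 2)| ≤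
        ∫ y in A..B, (-(3 * g * p)) * (-(2 * Real.exp (2 * y)) / (Real.exp (2 * y) - ν ^ 2) ^ 2) := by
      rw [← Real.norm_eq_abs]
      refine intervalIntegral.norm_integral_le_of_norm_le (μ := volume) hAB
        (Eventually.of_forall fun y hy => ?_) (hi3.const_mul _)
      have h0 : 0 ≤ 2 * Real.exp (2 * y) / (Real.exp (2 * y) - ν ^ 2) ^ 2 := by positivity
      rw [Real.norm_eq_abs, neg_div, abs_mul, abs_neg, abs_of_nonneg h0, neg_mul_neg]
      exact mul_le_mul_of_nonneg_right (hk1_2 y (hy12.trans hy.1.le)) h0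
    rw [intervalIntegral.integral_const_mul, e2] at e3
    have w : ∀ y, A ≤ y → 0 ≤ (Real.exp (2 * y) - ν ^ 2)⁻¹ ∧
        (3 * g * p) * (Real.exp (2 * y) - ν ^ 2)⁻¹ ≤ 3 / 2 * (g / ν) := by
      intro y hy
      refine ⟨(inv_pos.2 (hqn y hy)).le, ?_⟩
      calc _ ≤ (3 * g * p) * (2 * p ^ 4)⁻¹ := by
            gcongr
            exact hqp y hy
        _ = _ := by rw [← hp3]; field_simp
    have wA := w A le_rfl
    have wB := w B hAB
    have f1 : ∀ y, A ≤ y → |k1 y * (Real.exp (2 * y) - ν ^ 2)⁻¹| ≤ 3 / 2 * (g / ν) := by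
      intro y hy
      rw [abs_mul, abs_of_nonneg (w y hy).1]
      exact (mul_le_mul_of_nonneg_right (hk1_2 y (hy12.trans hy)) (w y hy).1).trans (w y hy).2
    have fA := abs_le.1 (f1 A le_rfl)
    have fB := abs_le.1 (f1 B hAB)
    have e3' := abs_le.1 e3
    have n0 : 0 ≤ g / ν := by positivity
    have n1 : 0 ≤ 3 * g * p * (Real.exp (2 * B) - ν ^ 2)⁻¹ := mul_nonneg (by positivity) wB.1
    rw [abs_le]
    constructor <;> linarith
  have := three_split h.cont (by rw [hy1, hy2]; linarith) (by positivity) (by positivity)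
    (by positivity) hR1 hR2 hR3 hAB
  linarith

lemma small_facts {ν y : ℝ} (hν : 2 ≤ ν) (hy : Real.exp (2 * y) ≤ 9 / 16 * ν ^ 2) :
    7 / 16 * ν ^ 2 ≤ ν ^ 2 - Real.exp (2 * y) ∧
    1 / (ν ^ 2 - Real.exp (2 * y)) ≤ 3 / ν ^ 2 ∧
    Real.exp (2 * y) / (ν ^ 2 - Real.exp (2 * y)) ^ 2 ≤ 3 / ν ^ 2 ∧
    Real.exp (2 * y) ^ 2 / (ν ^ 2 - Real.exp (2 * y)) ^ 3 ≤ 4 / ν ^ 2 := by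
  have hν0 : 0 < ν ^ 2 := by positivity
  have hE : 0 < Real.exp (2 * y) := Real.exp_pos _
  set E := Real.exp (2 * y)
  set n := ν ^ 2
  have hq : 7 / 16 * n ≤ n - E := by linarith
  have hq0 : 0 < n - E := by linarith
  refine ⟨hq, ?_, ?_, ?_⟩
  · rw [div_le_div_iff₀ hq0 hν0]; linarith
  · calc E / (n - E) ^ 2 ≤ (9 / 16 * n) / (7 / 16 * n) ^ 2 := by gcongr
      _ = (144 / 49) / n := by field_simp; norm_num
      _ ≤ 3 / n := by gcongr; norm_num
  · calc E ^ 2 / (n - E) ^ 3 ≤ (9 / 16 * n) ^ 2 / (7 / 16 * n) ^ 3 := by gcongr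
      _ = (1296 / 343) / n := by field_simp; norm_num
      _ ≤ 4 / n := by gcongr; norm_num

lemma BesODE.small_k (h : BesODE ν D k k1) {y : ℝ} (hy : Real.exp (2 * y) ≤ 9 / 16 * ν ^ 2) :
    |k y| ≤ 2 * (√D / ν) ∧ |k1 y| ≤ √D := by
  have hν := h.hν
  have hν0 : 0 < ν := by linarith
  have hd : √D ^ 2 = D := Real.sq_sqrt h.D_nonneg
  have hd0 : 0 ≤ √D := Real.sqrt_nonneg _
  have he := h.energy_le y
  obtain ⟨hq, -⟩ := small_facts hν hy
  have h1 : 7 / 16 * ν ^ 2 * k y ^ 2 ≤ (ν ^ 2 - Real.exp (2 * y)) * k y ^ 2 := by gcongr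
  constructor
  · apply abs_le_of_sq_le_sq _ (by positivity)
    rw [mul_pow, div_pow, ← mul_div_assoc, le_div_iff₀ (by positivity), hd]
    nlinarith [sq_nonneg (k1 y), mul_nonneg (sq_nonneg ν) (sq_nonneg (k y))]
  · apply abs_le_of_sq_le_sq _ (by positivity)
    rw [hd]
    nlinarith [sq_nonneg (k1 y), mul_nonneg (sq_nonneg ν) (sq_nonneg (k y))]

lemma BesODE.small_PP (h : BesODE ν D k k1) {y : ℝ} (hy : Real.exp (2 * y) ≤ 9 / 16 * ν ^ 2) :
    |PP ν k k1 y| ≤ 9 * (√D / ν ^ 2) := by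
  have hν := h.hν
  have hν0 : 0 < ν := by linarith
  have hd0 : 0 ≤ √D := Real.sqrt_nonneg _
  obtain ⟨hq, f1, f2, -⟩ := small_facts hν hy
  obtain ⟨b1, b2⟩ := h.small_k hy
  have hq0 : 0 < ν ^ 2 - Real.exp (2 * y) := lt_of_lt_of_le (by positivity) hq
  unfold PP
  have e1 : |-(k1 y / (ν ^ 2 - Real.exp (2 * y)))| ≤ 3 * (√D / ν ^ 2) := by
    rw [abs_neg, div_eq_mul_one_div, abs_mul, abs_of_pos (one_div_pos.2 hq0)]
    calc _ ≤ √D * (3 / ν ^ 2) := mul_le_mul b2 f1 (one_div_pos.2 hq0).le hd0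
      _ = _ := by ring
  have e2 : |k y * (2 * Real.exp (2 * y) / (ν ^ 2 - Real.exp (2 * y)) ^ 2)| ≤
      6 * (√D / ν ^ 2) := by
    rw [abs_mul, mul_div_assoc, abs_of_nonneg (a := 2 * _) (by positivity)]
    have : 1 / ν ≤ 1 / 2 := by gcongr
    calc _ ≤ 2 * (√D / ν) * (2 * (3 / ν ^ 2)) := by gcongr
      _ = 12 * (√D / ν ^ 2) * (1 / ν) := by field_simp; ring
      _ ≤ 12 * (√D / ν ^ 2) * (1 / 2) := by gcongr
      _ = _ := by ring
  refine (abs_add_le _ _).trans ?_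
  linarith

lemma small_hh {ν y : ℝ} (hν : 2 ≤ ν) (hy : Real.exp (2 * y) ≤ 9 / 16 * ν ^ 2) :
    0 ≤ hh ν y ∧ hh ν y ≤ 44 / ν ^ 2 := by
  obtain ⟨hq, f1, f2, f3⟩ := small_facts hν hy
  have hν0 : 0 < ν := by linarith
  have hq0 : 0 < ν ^ 2 - Real.exp (2 * y) := lt_of_lt_of_le (by positivity) hq
  unfold hh
  refine ⟨by positivity, ?_⟩
  rw [mul_div_assoc, mul_div_assoc]
  have : 44 / ν ^ 2 = 4 * (3 / ν ^ 2) + 8 * (4 / ν ^ 2) := by ring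
  linarith

lemma small_mono {ν y B : ℝ} (hyB : y ≤ B) (hB : Real.exp (2 * B) ≤ 9 / 16 * ν ^ 2) :
    Real.exp (2 * y) ≤ 9 / 16 * ν ^ 2 := (exp_two_mono hyB).trans hB

lemma BesODE.small_int (h : BesODE ν D k k1) {A B : ℝ} (hAB : A ≤ B)
    (hB : Real.exp (2 * B) ≤ 9 / 16 * ν ^ 2) :
    |∫ y in A..B, k y| ≤ 24 * (√D / ν ^ 2) := by
  have hν := h.hν
  have hν0 : 0 < ν := by linarith
  have hd0 : 0 ≤ √D := Real.sqrt_nonneg _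
  obtain ⟨hq, f1, f2, -⟩ := small_facts hν hB
  have hq0 : 0 < ν ^ 2 - Real.exp (2 * B) := lt_of_lt_of_le (by positivity) hq
  have e := h.int_bound hAB (by linarith) (M := 2 * (√D / ν))
    (fun y hy => (h.small_k (small_mono hy.2 hB)).1)
  have e1 := h.small_PP hB
  have e2 := h.small_PP (small_mono hAB hB)
  have e3 : 2 * (√D / ν) * (2 * Real.exp (2 * B) / (ν ^ 2 - Real.exp (2 * B)) ^ 2) ≤
      6 * (√D / ν ^ 2) := by
    rw [mul_div_assoc]
    have : 1 / ν ≤ 1 / 2 := by gcongr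
    calc _ ≤ 2 * (√D / ν) * (2 * (3 / ν ^ 2)) := by gcongr
      _ = 12 * (√D / ν ^ 2) * (1 / ν) := by field_simp; ring
      _ ≤ 12 * (√D / ν ^ 2) * (1 / 2) := by gcongr
      _ = _ := by ring
  linarith

lemma BesODE.contOn_PP (h : BesODE ν D k k1) {A B : ℝ}
    (hB : Real.exp (2 * B) ≤ 9 / 16 * ν ^ 2) : ContinuousOn (PP ν k k1) (Set.Icc A B) := by
  intro y hy
  obtain ⟨hq, -⟩ := small_facts h.hν (small_mono hy.2 hB)
  have hν0 : 0 < ν := by linarith [h.hν]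
  exact (h.hasDerivAt_PP (lt_of_lt_of_le (by positivity) hq).ne').continuousAt.continuousWithinAt

lemma BesODE.small_int_PP (h : BesODE ν D k k1) {A B U : ℝ} (hAB : A ≤ B) (hAB3 : B - A ≤ 3)
    (hB : Real.exp (2 * B) ≤ 9 / 16 * ν ^ 2) (hU : Real.exp B ≤ U) :
    |∫ y in A..B, Real.exp y * PP ν k k1 y| ≤ 150 * (√D * U / ν ^ 3) := by
  have hν := h.hν
  have hν0 : 0 < ν := by linarith
  have hd0 : 0 ≤ √D := Real.sqrt_nonneg _
  have hU0 : 0 < U := (Real.exp_pos _).trans_le hU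
  have hqp : ∀ y ∈ Set.Icc A B, 0 < ν ^ 2 - Real.exp (2 * y) := fun y hy => by
    obtain ⟨hq, -⟩ := small_facts hν (small_mono hy.2 hB)
    exact lt_of_lt_of_le (by positivity) hq
  have hqn : ∀ y ∈ Set.Icc A B, ν ^ 2 - Real.exp (2 * y) ≠ 0 := fun y hy => (hqp y hy).ne'
  have hu : Set.uIcc A B = Set.Icc A B := Set.uIcc_of_le hAB
  set w : ℝ → ℝ := fun y => Real.exp y * (1 / (ν ^ 2 - Real.exp (2 * y)) +
    4 * (Real.exp (2 * y) / (ν ^ 2 - Real.exp (2 * y)) ^ 2)) with hw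
  have hder : ∀ y ∈ Set.uIcc A B,
      HasDerivAt (fun y => Real.exp y * k y / (ν ^ 2 - Real.exp (2 * y)))
        (k y * w y - Real.exp y * PP ν k k1 y) y := by
    intro y hy
    rw [hu] at hy
    have hn := hqn y hy
    have := ((Real.hasDerivAt_exp y).mul (h.hk y)).div
      ((hasDerivAt_exp_two y).const_sub (ν ^ 2)) hn
    refine this.congr_deriv ?_
    simp only [hw, PP, Pi.mul_apply]
    field_simp
    ring
  have hcw : ContinuousOn w (Set.Icc A B) := by
    refine ContinuousOn.mul (by fun_prop) (ContinuousOn.add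
      (ContinuousOn.div (by fun_prop) (by fun_prop) hqn)
      (ContinuousOn.mul (by fun_prop) (ContinuousOn.div (by fun_prop) (by fun_prop)
        fun y hy => pow_ne_zero _ (hqn y hy))))
  have hi1 : IntervalIntegrable (fun y => k y * w y) volume A B :=
    (h.cont.continuousOn.mul hcw).intervalIntegrable_of_Icc hAB
  have hi2 : IntervalIntegrable (fun y => Real.exp y * PP ν k k1 y) volume A B :=
    (Real.continuous_exp.continuousOn.mul (h.contOn_PP hB)).intervalIntegrable_of_Icc hAB
  have e1 := intervalIntegral.integral_eq_sub_of_hasDerivAt hder (hi1.sub hi2)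
  rw [intervalIntegral.integral_sub hi1 hi2] at e1
  have hexp : ∀ y ≤ B, Real.exp y ≤ U := fun y hy => (Real.exp_le_exp.2 hy).trans hU
  have e2 : ‖∫ y in A..B, k y * w y‖ ≤ (30 * (√D * U / ν ^ 3)) * |B - A| := by
    apply intervalIntegral.norm_integral_le_of_norm_le_const
    intro y hy
    rw [Set.uIoc_of_le hAB] at hy
    have hy' : y ∈ Set.Icc A B := ⟨hy.1.le, hy.2⟩
    obtain ⟨-, f1, f2, -⟩ := small_facts hν (small_mono hy.2 hB)
    have hq0 := hqp y hy'
    have hw0 : 0 ≤ w y := by simp only [hw]; positivity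
    have hw1 : w y ≤ U * (3 / ν ^ 2 + 4 * (3 / ν ^ 2)) := by
      simp only [hw]
      gcongr
      exact hexp y hy.2
    rw [Real.norm_eq_abs, abs_mul, abs_of_nonneg hw0]
    calc _ ≤ 2 * (√D / ν) * (U * (3 / ν ^ 2 + 4 * (3 / ν ^ 2))) :=
          mul_le_mul (h.small_k (small_mono hy.2 hB)).1 hw1 hw0 (by positivity)
      _ = _ := by field_simp; ring
  have b : ∀ y ∈ Set.Icc A B, |Real.exp y * k y / (ν ^ 2 - Real.exp (2 * y))| ≤
      6 * (√D * U / ν ^ 3) := by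
    intro y hy
    obtain ⟨-, f1, -⟩ := small_facts hν (small_mono hy.2 hB)
    have hq0 := hqp y hy
    rw [div_eq_mul_one_div, abs_mul, abs_mul, abs_of_pos (one_div_pos.2 hq0),
      abs_of_pos (Real.exp_pos _)]
    calc _ ≤ U * (2 * (√D / ν)) * (3 / ν ^ 2) := by
          gcongr
          · exact hexp y hy.2
          · exact (h.small_k (small_mono hy.2 hB)).1
      _ = _ := by field_simp; ring
  have bA := abs_le.1 (b A ⟨le_rfl, hAB⟩)
  have bB := abs_le.1 (b B ⟨hAB, le_rfl⟩)
  have hX : 0 ≤ √D * U / ν ^ 3 := by positivity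
  rw [Real.norm_eq_abs, abs_of_nonneg (by linarith : 0 ≤ B - A)] at e2
  have e3 : 30 * (√D * U / ν ^ 3) * (B - A) ≤ 30 * (√D * U / ν ^ 3) * 3 := by gcongr
  have e4 := abs_le.1 (e2.trans e3)
  rw [abs_le]
  constructor <;> linarith

lemma BesODE.parts (h : BesODE ν D k k1) {α β K : ℝ} (hAB : α ≤ β) (hAB3 : β - α ≤ 3)
    (hB : Real.exp (2 * β) ≤ 9 / 16 * ν ^ 2) {φ : ℝ → ℝ} (hφ : Differentiable ℝ φ)
    (hφ1 : ∀ t, |φ t| ≤ 1)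
    (hK : ∀ t, |deriv φ t| ≤ K) (hα0 : φ (Real.exp α) = 0) (hβ0 : φ (Real.exp β) = 0) :
    |∫ y in α..β, φ (Real.exp y) * k y| ≤
      |∫ y in α..β, deriv φ (Real.exp y) * (Real.exp y * PP ν k k1 y)| +
      300 * (√D / ν ^ 3) := by
  have hν := h.hν
  have hν0 : 0 < ν := by linarith
  have hd0 : 0 ≤ √D := Real.sqrt_nonneg _
  have hu : Set.uIcc α β = Set.Icc α β := Set.uIcc_of_le hAB
  have hqp : ∀ y ∈ Set.Icc α β, 0 < ν ^ 2 - Real.exp (2 * y) := fun y hy => by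
    obtain ⟨hq, -⟩ := small_facts hν (small_mono hy.2 hB)
    exact lt_of_lt_of_le (by positivity) hq
  have hqn : ∀ y ∈ Set.Icc α β, ν ^ 2 - Real.exp (2 * y) ≠ 0 := fun y hy => (hqp y hy).ne'
  have hφe : Continuous fun y => φ (Real.exp y) := hφ.continuous.comp Real.continuous_exp
  have hder : ∀ y ∈ Set.uIcc α β, HasDerivAt (fun y => φ (Real.exp y) * PP ν k k1 y)
      (deriv φ (Real.exp y) * (Real.exp y * PP ν k k1 y) +
        (φ (Real.exp y) * k y + φ (Real.exp y) * (k y * hh ν y))) y := by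
    intro y hy
    rw [hu] at hy
    have := ((hφ (Real.exp y)).hasDerivAt.comp y (Real.hasDerivAt_exp y)).mul
      (h.hasDerivAt_PP (hqn y hy))
    refine this.congr_deriv ?_
    simp only [Function.comp]
    ring
  have hcP : ContinuousOn (fun y => Real.exp y * PP ν k k1 y) (Set.Icc α β) :=
    Real.continuous_exp.continuousOn.mul (h.contOn_PP hB)
  have hiP : IntervalIntegrable (fun y => Real.exp y * PP ν k k1 y) volume α β :=
    hcP.intervalIntegrable_of_Icc hAB
  have hi1 : IntervalIntegrable
      (fun y => deriv φ (Real.exp y) * (Real.exp y * PP ν k k1 y)) volume α β := by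
    rw [intervalIntegrable_iff_integrableOn_Icc_of_le hAB] at hiP ⊢
    refine Integrable.bdd_mul (c := K) hiP ?_ ?_
    · exact ((measurable_deriv φ).comp Real.measurable_exp).aestronglyMeasurable
    · exact Eventually.of_forall fun y => hK _
  have hi2 : IntervalIntegrable (fun y => φ (Real.exp y) * k y) volume α β :=
    (hφe.mul h.cont).intervalIntegrable _ _
  have hi3 : IntervalIntegrable (fun y => φ (Real.exp y) * (k y * hh ν y)) volume α β :=
    (hφe.continuousOn.mul (h.cont.continuousOn.mul
      (continuousOn_hh hqn))).intervalIntegrable_of_Icc hAB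
  have e1 := intervalIntegral.integral_eq_sub_of_hasDerivAt hder (hi1.add (hi2.add hi3))
  rw [intervalIntegral.integral_add hi1 (hi2.add hi3), intervalIntegral.integral_add hi2 hi3,
    hα0, hβ0] at e1
  have e2 : ‖∫ y in α..β, φ (Real.exp y) * (k y * hh ν y)‖ ≤
      (88 * (√D / ν ^ 3)) * |β - α| := by
    apply intervalIntegral.norm_integral_le_of_norm_le_const
    intro y hy
    rw [Set.uIoc_of_le hAB] at hy
    obtain ⟨f0, f1⟩ := small_hh hν (small_mono hy.2 hB)
    rw [Real.norm_eq_abs, abs_mul, abs_mul, abs_of_nonneg f0]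
    calc _ ≤ 1 * (2 * (√D / ν) * (44 / ν ^ 2)) := by
          gcongr
          · exact hφ1 _
          · exact (h.small_k (small_mono hy.2 hB)).1
      _ = _ := by field_simp; ring
  rw [Real.norm_eq_abs, abs_of_nonneg (by linarith : 0 ≤ β - α)] at e2
  have hX : 0 ≤ √D / ν ^ 3 := by positivity
  have e3 : 88 * (√D / ν ^ 3) * (β - α) ≤ 88 * (√D / ν ^ 3) * 3 := by gcongr
  have e4 : ∫ y in α..β, φ (Real.exp y) * k y =
      -(∫ y in α..β, deriv φ (Real.exp y) * (Real.exp y * PP ν k k1 y)) -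
        ∫ y in α..β, φ (Real.exp y) * (k y * hh ν y) := by linarith
  rw [e4]
  refine (abs_sub _ _).trans ?_
  rw [abs_neg]
  linarith

lemma phicheck_eq {φ : ℝ → ℝ} {r α β : ℝ} (hαβ : α ≤ β)
    (h0 : ∀ y, y ≤ α → φ (Real.exp y) = 0) (h1 : ∀ y, β ≤ y → φ (Real.exp y) = 0) :
    phicheck φ r = Real.cosh (Real.pi * r) * ∫ y in α..β, φ (Real.exp y) * kk (2 * r) y := by
  unfold phicheck
  rw [integral_Ioi_exp, mul_comm 2, mul_assoc]
  congr 1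
  rw [← integral_const_mul, intervalIntegral.integral_of_le hαβ, setIntegral_eq_integral_of_forall_compl_eq_zero]
  · congr 1
    ext y
    unfold kk
    have := (Real.exp_pos y).ne'
    simp only [smul_eq_mul]
    field_simp
  · intro y hy
    have : φ (Real.exp y) = 0 := by
      by_cases h : y ≤ α
      · exact h0 y h
      · push Not at h
        refine h1 y ?_
        by_contra hc
        push Not at hc
        exact hy ⟨h, hc.le⟩
    rw [this, zero_mul]

/-- The normalised data extracted from an admissible function. -/
structure Dat (κ a x T : ℝ) (N : ℕ) (φ : ℝ → ℝ) (α β : ℝ) : Prop where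
  hαβ : α ≤ β
  h3 : β - α ≤ 3
  hα : 3 / 8 * (a / x) ≤ Real.exp α
  hβ : Real.exp β ≤ 3 / 2 * (a / x)
  hφ0 : ∀ t, 0 ≤ φ t
  hφ1 : ∀ t, φ t ≤ 1
  hd : Differentiable ℝ φ
  hK : ∀ t, |deriv φ t| ≤ κ * x ^ 2 / (a * T)
  hza : φ (Real.exp α) = 0
  hzb : φ (Real.exp β) = 0
  heq : ∀ r, phicheck φ r =
    Real.cosh (Real.pi * r) * ∫ y in α..β, φ (Real.exp y) * kk (2 * r) y
  hI : ∃ I : Fin N → Set ℝ, (∀ i, (I i).OrdConnected) ∧ (∀ s, s ⊆ ⋃ i, I i) ∧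
    (∀ i, MonotoneOn (fun y => φ (Real.exp y)) (I i) ∨ AntitoneOn (fun y => φ (Real.exp y)) (I i)) ∧
    (∀ i, MonotoneOn (fun y => deriv φ (Real.exp y)) (I i) ∨
      AntitoneOn (fun y => deriv φ (Real.exp y)) (I i))

lemma exists_dat {κ a x T : ℝ} {N : ℕ} {φ : ℝ → ℝ} (ha : 0 < a) (hx : 3 ≤ x) (hT : 1 ≤ T)
    (hTx : T ≤ x / 3) (h : Admissible a x T κ N φ) : ∃ α β, Dat κ a x T N φ α β := by
  obtain ⟨h01, -, hz0, hz1, hd, hK, I, hI, hcov, hmono⟩ := h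
  have hx0 : 0 < x := by linarith
  have p1 : 0 < a / (2 * x + 2 * T) := by positivity
  have hxT : 0 < x - T := by linarith
  have p2 : 0 < a / (x - T) := by positivity
  have q1 : 3 / 8 * (a / x) ≤ a / (2 * x + 2 * T) := by
    rw [show 3 / 8 * (a / x) = a / (8 / 3 * x) by field_simp]
    gcongr
    linarith
  have q2 : a / (x - T) ≤ 3 / 2 * (a / x) := by
    rw [show 3 / 2 * (a / x) = a / (2 / 3 * x) by field_simp]
    gcongr
    linarith
  have e1 : Real.exp (Real.log (a / (2 * x + 2 * T))) = a / (2 * x + 2 * T) := Real.exp_log p1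
  have e2 : Real.exp (Real.log (a / (x - T))) = a / (x - T) := Real.exp_log p2
  have hαβ : Real.log (a / (2 * x + 2 * T)) ≤ Real.log (a / (x - T)) := by
    apply Real.log_le_log p1
    gcongr
    linarith
  refine ⟨Real.log (a / (2 * x + 2 * T)), Real.log (a / (x - T)), hαβ, ?_, by rwa [e1], by rwa [e2],
    fun t => (h01 t).1, fun t => (h01 t).2, hd, hK, hz0 _ e1.le, hz1 _ e2.ge, fun r => ?_, ?_⟩
  · have : Real.log (a / (x - T)) ≤ Real.log (4 * (a / (2 * x + 2 * T))) := by
      apply Real.log_le_log p2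
      have hap : 0 < a / x := by positivity
      linarith
    rw [Real.log_mul (by norm_num) p1.ne'] at this
    have h4 := Real.log_le_sub_one_of_pos (show (0 : ℝ) < 4 by norm_num)
    linarith
  · refine phicheck_eq hαβ (fun y hy => hz0 _ ?_) (fun y hy => hz1 _ ?_)
    · rw [← e1]; exact Real.exp_le_exp.2 hy
    · rw [← e2]; exact Real.exp_le_exp.2 hy
  · have hme : Monotone Real.exp := Real.exp_monotone
    refine ⟨fun i => Real.exp ⁻¹' I i, fun i => ?_, fun s y _ => ?_, fun i => ?_, fun i => ?_⟩
    · exact (hI i).preimage_mono hme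
    · have := hcov (Real.exp_pos y).le
      simpa using this
    · rcases (hmono i).1 with h | h
      · exact Or.inl fun y hy z hz hyz => h hy hz (hme hyz)
      · exact Or.inr fun y hy z hz hyz => h hy hz (hme hyz)
    · rcases (hmono i).2 with h | h
      · exact Or.inl fun y hy z hz hyz => h hy hz (hme hyz)
      · exact Or.inr fun y hy z hz hyz => h hy hz (hme hyz)

/-- Trivial bound from a pointwise bound on the kernel. -/
lemma Dat.trivial_bound {κ a x T α β : ℝ} {N : ℕ} {φ : ℝ → ℝ} (d : Dat κ a x T N φ α β) {r M : ℝ}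
    (hM : ∀ y, α ≤ y → |kk (2 * r) y| ≤ M) :
    |phicheck φ r| ≤ Real.cosh (Real.pi * r) * (3 * M) := by
  have hM0 : 0 ≤ M := (abs_nonneg _).trans (hM α le_rfl)
  rw [d.heq, abs_mul, abs_of_pos (Real.cosh_pos _)]
  gcongr
  have : ‖∫ y in α..β, φ (Real.exp y) * kk (2 * r) y‖ ≤ M * |β - α| := by
    apply intervalIntegral.norm_integral_le_of_norm_le_const
    intro y hy
    rw [Set.uIoc_of_le d.hαβ] at hy
    rw [Real.norm_eq_abs, abs_mul, abs_of_nonneg (d.hφ0 _)]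
    calc _ ≤ 1 * M := by
          gcongr
          · exact d.hφ1 _
          · exact hM y hy.1.le
      _ = M := one_mul M
  rw [Real.norm_eq_abs, abs_of_nonneg (by linarith [d.hαβ] : 0 ≤ β - α)] at this
  refine this.trans ?_
  have := mul_le_mul_of_nonneg_left d.h3 hM0
  linarith

lemma kk_small_bound {v : ℝ} (hv : 0 < v) (y : ℝ) :
    |kk v y| ≤ 2 * (∫ τ : ℝ, Real.exp (τ - Real.exp τ)) / v := by
  have h := kk_energy v y
  rw [norm_FF_shift] at h
  have hn : ‖∫ τ : ℝ, Complex.exp ((1 + v * I) * τ - Real.exp τ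
        - Real.exp (2 * y) / 4 * Real.exp (-τ))‖ ≤ ∫ τ : ℝ, Real.exp (τ - Real.exp τ) := by
    refine norm_integral_le_of_norm_le integrable_exp_exp (Eventually.of_forall fun τ => ?_)
    rw [Complex.norm_exp]
    apply Real.exp_le_exp.2
    have e : ((1 + v * I) * τ - Real.exp τ - Real.exp (2 * y) / 4 * Real.exp (-τ) : ℂ) =
      ((τ - Real.exp τ - Real.exp (2 * y) / 4 * Real.exp (-τ) : ℝ) : ℂ) + ((v * τ : ℝ) : ℂ) * I := by
      push_cast; ring
    rw [e, add_re, ofReal_re, re_ofReal_mul, I_re]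
    have : 0 < Real.exp (2 * y) / 4 * Real.exp (-τ) := by positivity
    linarith
  set M := ∫ τ : ℝ, Real.exp (τ - Real.exp τ)
  have hM : 0 ≤ M := (norm_nonneg _).trans hn
  rw [le_div_iff₀ hv]
  have : |kk v y * v| ≤ 2 * M := by
    apply abs_le_of_sq_le_sq _ (by positivity)
    have h2 : (2 * ‖∫ τ : ℝ, Complex.exp ((1 + v * I) * τ - Real.exp τ
        - Real.exp (2 * y) / 4 * Real.exp (-τ))‖) ^ 2 ≤ (2 * M) ^ 2 := by gcongr
    nlinarith [sq_nonneg (kk1 v y)]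
  rwa [abs_mul, abs_of_pos hv] at this

lemma regime1 : ∃ C : ℝ, ∀ (κ a x T : ℝ) (N : ℕ) (φ : ℝ → ℝ) (α β : ℝ), Dat κ a x T N φ α β →
    ∀ r : ℝ, 0 < r → r ≤ 1 → |phicheck φ r| ≤ C * r ^ (-(3 : ℝ) / 2) := by
  set M := ∫ τ : ℝ, Real.exp (τ - Real.exp τ) with hMdef
  have hM : 0 ≤ M := integral_nonneg fun τ => (Real.exp_pos _).le
  refine ⟨Real.cosh Real.pi * (3 * M), fun κ a x T N φ α β d r hr hr1 => ?_⟩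
  have := d.trivial_bound (r := r) (M := M / r) fun y _ => by
    refine (kk_small_bound (by linarith : 0 < 2 * r) y).trans (le_of_eq ?_)
    rw [← hMdef]; field_simp
  refine this.trans ?_
  have h1 : Real.cosh (Real.pi * r) ≤ Real.cosh Real.pi := by
    rw [Real.cosh_le_cosh, abs_of_pos (by positivity), abs_of_pos Real.pi_pos]
    nlinarith [Real.pi_pos]
  have h2 : r⁻¹ ≤ r ^ (-(3 : ℝ) / 2) := by
    rw [← Real.rpow_neg_one]
    exact Real.rpow_le_rpow_of_exponent_ge hr hr1 (by norm_num)
  calc _ ≤ Real.cosh Real.pi * (3 * (M / r)) := by gcongr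
    _ = Real.cosh Real.pi * (3 * M) * r⁻¹ := by ring
    _ ≤ _ := by
      have := Real.cosh_pos Real.pi
      gcongr

lemma regime2 : ∃ C : ℝ, ∀ (κ a x T : ℝ) (N : ℕ) (φ : ℝ → ℝ) (α β : ℝ), Dat κ a x T N φ α β →
    ∀ r : ℝ, 0 < x → 1 ≤ r → r ≤ a / (8 * x) → |phicheck φ r| ≤ C * Real.exp (-r / 2) := by
  set M := ∫ t : ℝ, Real.exp (0 * t - 1 * Real.cosh t) with hMdef
  have hM : 0 ≤ M := integral_nonneg fun τ => (Real.exp_pos _).le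
  refine ⟨3 * M * Real.exp 1, fun κ a x T N φ α β d r hx hr hra => ?_⟩
  have hα : 3 * r ≤ Real.exp α := by
    have e : a / (8 * x) = 1 / 8 * (a / x) := by field_simp
    have := d.hα
    linarith
  have := d.trivial_bound (r := r)
    (M := Real.exp (-(2 * r * (Real.pi / 4)) + (1 - 3 * r * (√2 / 2))) * M) fun y hy => by
    have hy3 : 3 * r ≤ Real.exp y := hα.trans (Real.exp_le_exp.2 hy)
    refine (kk_exp_bound (2 * r) (by linarith)).trans ?_
    gcongr
  refine this.trans ?_
  have h1 : Real.cosh (Real.pi * r) ≤ Real.exp (Real.pi * r) := by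
    rw [Real.cosh_eq]
    have : Real.exp (-(Real.pi * r)) ≤ Real.exp (Real.pi * r) :=
      Real.exp_le_exp.2 (by nlinarith [Real.pi_pos])
    linarith
  have hs : (1.414 : ℝ) ≤ √2 := by
    apply Real.le_sqrt_of_sq_le; norm_num
  have hpi := Real.pi_lt_d2
  calc _ ≤ Real.exp (Real.pi * r) *
        (3 * (Real.exp (-(2 * r * (Real.pi / 4)) + (1 - 3 * r * (√2 / 2))) * M)) := by gcongr
    _ = 3 * M * Real.exp (Real.pi * r + (-(2 * r * (Real.pi / 4)) + (1 - 3 * r * (√2 / 2)))) := by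
      rw [Real.exp_add (Real.pi * r)]; ring
    _ ≤ 3 * M * Real.exp (1 + -r / 2) := by
      refine mul_le_mul_of_nonneg_left (Real.exp_le_exp.2 ?_) (by positivity)
      nlinarith
    _ = _ := by rw [Real.exp_add]; ring

lemma besODE_kk {r : ℝ} (hr : 1 ≤ r) :
    BesODE (2 * r) (4 * (Real.pi * (2 * r) / Real.sinh (Real.pi * (2 * r))))
      (kk (2 * r)) (kk1 (2 * r)) where
  hν := by linarith
  hk := hasDerivAt_kk _
  hk1 := hasDerivAt_kk1 _
  hD := by
    rw [← norm_Gamma_sq (by linarith)]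
    exact tendsto_energy _
  hinf := tendsto_kk _
  hinf1 := tendsto_kk1 _

lemma cosh_sqrt_D {r : ℝ} (hr : 1 ≤ r) : Real.cosh (Real.pi * r) *
    √(4 * (Real.pi * (2 * r) / Real.sinh (Real.pi * (2 * r)))) ≤ 6 * √r := by
  have hr0 : 0 < r := by linarith
  have hz : 0 < Real.pi * r := by positivity
  have hs : 0 < Real.sinh (Real.pi * r) := Real.sinh_pos_iff.2 hz
  have hc : 0 < Real.cosh (Real.pi * r) := Real.cosh_pos _
  have e1 : Real.sinh (Real.pi * (2 * r)) = 2 * Real.sinh (Real.pi * r) * Real.cosh (Real.pi * r) := by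
    rw [← Real.sinh_two_mul]; congr 1; ring
  have hcs : Real.cosh (Real.pi * r) ≤ 1.2 * Real.sinh (Real.pi * r) := by
    have h1 : Real.cosh (Real.pi * r) ^ 2 = Real.sinh (Real.pi * r) ^ 2 + 1 := Real.cosh_sq _
    have h2 : Real.pi * r ≤ Real.sinh (Real.pi * r) := Real.self_le_sinh_iff.2 hz.le
    have h3 : 3 ≤ Real.sinh (Real.pi * r) := by nlinarith [Real.pi_gt_three]
    nlinarith
  rw [e1]
  have hD0 : 0 ≤ 4 * (Real.pi * (2 * r) / (2 * Real.sinh (Real.pi * r) * Real.cosh (Real.pi * r))) := by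
    positivity
  apply le_of_sq_le_sq _ (by positivity)
  rw [mul_pow, mul_pow, Real.sq_sqrt hD0, Real.sq_sqrt hr0.le]
  have e2 : Real.cosh (Real.pi * r) ^ 2 *
      (4 * (Real.pi * (2 * r) / (2 * Real.sinh (Real.pi * r) * Real.cosh (Real.pi * r)))) =
      4 * Real.pi * r * (Real.cosh (Real.pi * r) / Real.sinh (Real.pi * r)) := by
    field_simp
  rw [e2]
  have h4 : Real.cosh (Real.pi * r) / Real.sinh (Real.pi * r) ≤ 1.2 := by
    rw [div_le_iff₀ hs]; exact hcs
  calc _ ≤ 4 * Real.pi * r * 1.2 := by gcongr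
    _ ≤ _ := by nlinarith [Real.pi_lt_d2]

/-- Bound through the level-set inequality. -/
lemma Dat.level {κ a x T α β : ℝ} {N : ℕ} {φ : ℝ → ℝ} (d : Dat κ a x T N φ α β) {r S : ℝ}
    (hS0 : 0 ≤ S) (hS : ∀ s t, α ≤ s → s ≤ t → t ≤ β → |∫ y in s..t, kk (2 * r) y| ≤ S) :
    |phicheck φ r| ≤ 2 ^ N * (Real.cosh (Real.pi * r) * S) := by
  obtain ⟨I, hI, hcov, hm, -⟩ := d.hI
  have hc : Continuous (kk (2 * r)) :=
    continuous_iff_continuousAt.2 fun y => (hasDerivAt_kk _ y).continuousAt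
  have hφe : Continuous fun y => φ (Real.exp y) := d.hd.continuous.comp Real.continuous_exp
  have := level_set_bound (m := kk (2 * r)) (g := fun y => φ (Real.exp y)) hS0 zero_le_one d.hαβ
    hc.continuousOn.integrableOn_Icc hφe.measurable (fun y => d.hφ0 _) (fun y => d.hφ1 _) hS
    I hI (hcov _) hm
  rw [d.heq, abs_mul, abs_of_pos (Real.cosh_pos _)]
  calc _ ≤ Real.cosh (Real.pi * r) * (1 * (2 ^ N * S)) :=
        mul_le_mul_of_nonneg_left this (Real.cosh_pos _).le
    _ = _ := by ring

lemma regime3 (N : ℕ) : ∃ C : ℝ, ∀ (κ a x T : ℝ) (φ : ℝ → ℝ) (α β : ℝ), Dat κ a x T N φ α β →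
    ∀ r : ℝ, 1 ≤ r → |phicheck φ r| ≤ C / r := by
  refine ⟨2 ^ N * 180, fun κ a x T φ α β d r hr => ?_⟩
  have hr0 : 0 < r := by linarith
  have hB := besODE_kk hr
  have hcD := cosh_sqrt_D hr
  set D := 4 * (Real.pi * (2 * r) / Real.sinh (Real.pi * (2 * r)))
  have hs : 0 < √r := Real.sqrt_pos.2 hr0
  have := d.level (r := r) (S := 60 * (√(D / (2 * r)) / (2 * r))) (by positivity)
    fun s t _ hst _ => hB.int_bound_turning hst
  refine this.trans ?_
  rw [mul_div_assoc ((2 : ℝ) ^ N) 180 r]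
  refine mul_le_mul_of_nonneg_left ?_ (by positivity)
  have e1 : √(D / (2 * r)) ≤ √D / √r := by
    rw [← Real.sqrt_div' _ hr0.le]
    apply Real.sqrt_le_sqrt
    have := hB.D_nonneg
    gcongr
    linarith
  have hc : 0 < Real.cosh (Real.pi * r) := Real.cosh_pos _
  calc _ ≤ Real.cosh (Real.pi * r) * (60 * ((√D / √r) / (2 * r))) := by gcongr
    _ = (Real.cosh (Real.pi * r) * √D) * (30 / (√r * r)) := by field_simp; ring
    _ ≤ (6 * √r) * (30 / (√r * r)) := by gcongr
    _ = 180 / r := by field_simp; norm_num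

lemma rpow_half {r : ℝ} (hr : 0 < r) : √r / r ^ 2 = r ^ (-(3 : ℝ) / 2) := by
  rw [Real.sqrt_eq_rpow, ← Real.rpow_natCast, ← Real.rpow_sub hr]
  norm_num

lemma regime4 (κ : ℝ) (hκ : 0 < κ) (N : ℕ) : ∃ C : ℝ, 0 ≤ C ∧
    ∀ (a x T : ℝ) (φ : ℝ → ℝ) (α β : ℝ),
    0 < a → 3 ≤ x → 1 ≤ T → T ≤ x / 3 → Dat κ a x T N φ α β →
    ∀ r : ℝ, a / x ≤ r → 1 ≤ r →
      |phicheck φ r| ≤ C * r ^ (-(3 : ℝ) / 2) * min 1 (x / (r * T)) := by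
  refine ⟨2 ^ N * 36 + (κ * 2 ^ N * 10000 + 1000), by positivity,
    fun a x T φ α β ha hx hT hTx d r hra hr => ?_⟩
  have hr0 : 0 < r := by linarith
  have hx0 : 0 < x := by linarith
  have hT0 : 0 < T := by linarith
  have hax : 0 < a / x := by positivity
  have hB := besODE_kk hr
  have hcD := cosh_sqrt_D hr
  set D := 4 * (Real.pi * (2 * r) / Real.sinh (Real.pi * (2 * r)))
  have hs : 0 < √r := Real.sqrt_pos.2 hr0
  have hc : 0 < Real.cosh (Real.pi * r) := Real.cosh_pos _
  have hβr : Real.exp (2 * β) ≤ 9 / 16 * (2 * r) ^ 2 := by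
    have h1 : Real.exp β ≤ 3 / 2 * r := d.hβ.trans (by linarith)
    have h2 : Real.exp (2 * β) = Real.exp β ^ 2 := by rw [two_mul, Real.exp_add, sq]
    rw [h2]
    calc _ ≤ (3 / 2 * r) ^ 2 := by gcongr
      _ = _ := by ring
  have hp : 0 < r ^ (-(3 : ℝ) / 2) := Real.rpow_pos_of_pos hr0 _
  -- first bound
  have b1 : |phicheck φ r| ≤ 2 ^ N * 36 * r ^ (-(3 : ℝ) / 2) := by
    have := d.level (r := r) (S := 24 * (√D / (2 * r) ^ 2)) (by positivity)
      fun s t _ hst ht => hB.small_int hst (small_mono ht hβr)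
    refine this.trans ?_
    rw [mul_assoc, ← rpow_half hr0]
    refine mul_le_mul_of_nonneg_left ?_ (by positivity)
    calc _ = (Real.cosh (Real.pi * r) * √D) * (6 / r ^ 2) := by field_simp; ring
      _ ≤ (6 * √r) * (6 / r ^ 2) := by gcongr
      _ = _ := by ring
  -- second bound
  have b2 : |phicheck φ r| ≤ (κ * 2 ^ N * 10000 + 1000) * r ^ (-(3 : ℝ) / 2) * (x / (r * T)) := by
    obtain ⟨I, hI, hcov, -, hm⟩ := d.hI
    set K := κ * x ^ 2 / (a * T) with hKdef
    have hK0 : 0 < K := by positivity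
    set U := 3 / 2 * (a / x) with hUdef
    have hU0 : 0 < U := by positivity
    set S := 150 * (√D * U / (2 * r) ^ 3) with hSdef
    have hS0 : 0 ≤ S := by positivity
    have hS : ∀ s t, α ≤ s → s ≤ t → t ≤ β →
        |∫ y in s..t, Real.exp y * PP (2 * r) (kk (2 * r)) (kk1 (2 * r)) y| ≤ S :=
      fun s t hs hst ht => hB.small_int_PP hst (by linarith [d.h3]) (small_mono ht hβr)
        ((Real.exp_le_exp.2 ht).trans d.hβ)
    have hcP : ContinuousOn (fun y => Real.exp y * PP (2 * r) (kk (2 * r)) (kk1 (2 * r)) y)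
        (Set.Icc α β) := Real.continuous_exp.continuousOn.mul (hB.contOn_PP hβr)
    have hmd : Measurable fun y => deriv φ (Real.exp y) :=
      (measurable_deriv φ).comp Real.measurable_exp
    have l1 := level_set_bound (m := fun y => Real.exp y * PP (2 * r) (kk (2 * r)) (kk1 (2 * r)) y)
      (g := fun y => deriv φ (Real.exp y) + K) (B := 2 * K) hS0 (by positivity) d.hαβ
      hcP.integrableOn_Icc (hmd.add_const K)
      (fun y => by linarith [(abs_le.1 (d.hK (Real.exp y))).1])
      (fun y => by linarith [(abs_le.1 (d.hK (Real.exp y))).2]) hS I hI (hcov _)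
      (fun i => by
        rcases hm i with h | h
        · exact Or.inl fun y hy z hz hyz => add_le_add (h hy hz hyz) le_rfl
        · exact Or.inr fun y hy z hz hyz => add_le_add (h hy hz hyz) le_rfl)
    have hiP : IntervalIntegrable (fun y => Real.exp y * PP (2 * r) (kk (2 * r)) (kk1 (2 * r)) y)
        volume α β := hcP.intervalIntegrable_of_Icc d.hαβ
    have hi1 : IntervalIntegrable (fun y => deriv φ (Real.exp y) *
        (Real.exp y * PP (2 * r) (kk (2 * r)) (kk1 (2 * r)) y)) volume α β := by
      rw [intervalIntegrable_iff_integrableOn_Icc_of_le d.hαβ] at hiP ⊢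
      exact Integrable.bdd_mul (c := K) hiP hmd.aestronglyMeasurable
        (Eventually.of_forall fun y => d.hK _)
    simp only [add_mul] at l1
    rw [intervalIntegral.integral_add hi1 (hiP.const_mul K),
      intervalIntegral.integral_const_mul] at l1
    have l2 := hS α β le_rfl d.hαβ le_rfl
    have l3 : |∫ y in α..β, deriv φ (Real.exp y) *
        (Real.exp y * PP (2 * r) (kk (2 * r)) (kk1 (2 * r)) y)| ≤ 3 * K * (2 ^ N * S) := by
      have h1 : K * S ≤ K * (2 ^ N * S) := by
        have : (1 : ℝ) ≤ 2 ^ N := one_le_pow₀ (by norm_num)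
        have := mul_le_mul_of_nonneg_right this hS0
        gcongr
        linarith
      have h2 := mul_le_mul_of_nonneg_left l2 hK0.le
      rw [← abs_of_pos hK0, ← abs_mul, abs_of_pos hK0] at h2
      have h3 := abs_le.1 l1
      have h4 := abs_le.1 h2
      rw [abs_le]
      constructor <;> linarith
    have l4 := hB.parts d.hαβ d.h3 hβr d.hd
      (fun t => by rw [abs_of_nonneg (d.hφ0 t)]; exact d.hφ1 t) d.hK d.hza d.hzb
    have l5 : |∫ y in α..β, φ (Real.exp y) * kk (2 * r) y| ≤
        3 * K * (2 ^ N * S) + 300 * (√D / (2 * r) ^ 3) := l4.trans (by linarith)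
    rw [d.heq, abs_mul, abs_of_pos hc, ← rpow_half hr0]
    have hxT : 3 ≤ x / T := by rw [le_div_iff₀ hT0]; linarith
    have hKU : K * U = 3 / 2 * κ * (x / T) := by rw [hKdef, hUdef]; field_simp
    calc _ ≤ Real.cosh (Real.pi * r) * (3 * K * (2 ^ N * S) + 300 * (√D / (2 * r) ^ 3)) := by
          gcongr
      _ = (Real.cosh (Real.pi * r) * √D) * ((450 * 2 ^ N * (K * U) + 300) / (2 * r) ^ 3) := by
          rw [hSdef]; ring
      _ ≤ (6 * √r) * ((450 * 2 ^ N * (K * U) + 300) / (2 * r) ^ 3) := by gcongr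
      _ = (√r / r ^ 2) * (1 / r) * (6 / 8 * (450 * 2 ^ N * (3 / 2 * κ * (x / T)) + 300)) := by
          rw [hKU]; field_simp; ring
      _ ≤ (√r / r ^ 2) * (1 / r) * ((κ * 2 ^ N * 10000 + 1000) * (x / T)) := by
          refine mul_le_mul_of_nonneg_left ?_ (by positivity)
          have : 0 ≤ κ * 2 ^ N * (x / T) := by positivity
          nlinarith
      _ = _ := by field_simp
  set C1 := (2 : ℝ) ^ N * 36
  set C2 := κ * 2 ^ N * 10000 + 1000
  have hC1 : 0 ≤ C1 := by positivity
  have hC2 : 0 ≤ C2 := by positivity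
  have hX : 0 ≤ x / (r * T) := by positivity
  rcases min_choice 1 (x / (r * T)) with h | h <;> rw [h]
  · refine b1.trans ?_
    nlinarith [mul_nonneg hC2 hp.le]
  · refine b2.trans ?_
    nlinarith [mul_nonneg (mul_nonneg hC1 hp.le) hX]

end Helpers

/-- Theorem 5.1 (Andersen–Duke; cf. Andersen–Ahlgren): for every `κ > 0` and `N ≥ 1` there is
`C > 0` such that for all `a > 0`, `x ≥ 3`, `1 ≤ T ≤ x/3` and every `(a,x,T,κ,N)`-admissible
`φ`, the transform `φ̌` satisfies
`|φ̌(r)| ≤ C r^{-3/2}` for `0 < r ≤ 1`; `|φ̌(r)| ≤ C e^{-r/2}` for `1 ≤ r ≤ a/(8x)`;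
`|φ̌(r)| ≤ C r^{-1}` for `max(a/(8x),1) ≤ r ≤ a/x`; and
`|φ̌(r)| ≤ C r^{-3/2} min(1, x/(rT))` for `r ≥ max(a/x, 1)`. -/
theorem phicheck_estimates :
    ∀ κ : ℝ, 0 < κ → ∀ N : ℕ, 0 < N → ∃ C : ℝ, 0 < C ∧
      ∀ a x T : ℝ, 0 < a → 3 ≤ x → 1 ≤ T → T ≤ x / 3 →
        ∀ φ : ℝ → ℝ, Admissible a x T κ N φ →
          (∀ r : ℝ, 0 < r → r ≤ 1 → |phicheck φ r| ≤ C * r ^ (-(3 : ℝ)/2)) ∧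
          (∀ r : ℝ, 1 ≤ r → r ≤ a / (8 * x) → |phicheck φ r| ≤ C * Real.exp (-r/2)) ∧
          (∀ r : ℝ, max (a / (8 * x)) 1 ≤ r → r ≤ a / x → |phicheck φ r| ≤ C / r) ∧
          (∀ r : ℝ, max (a / x) 1 ≤ r →
            |phicheck φ r| ≤ C * r ^ (-(3 : ℝ)/2) * min 1 (x / (r * T))) := by
  intro κ hκ N hN
  obtain ⟨C1, h1⟩ := regime1
  obtain ⟨C2, h2⟩ := regime2
  obtain ⟨C3, h3⟩ := regime3 N
  obtain ⟨C4, hC4, h4⟩ := regime4 κ hκ N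
  have a1 := abs_nonneg C1
  have a2 := abs_nonneg C2
  have a3 := abs_nonneg C3
  have l1 := le_abs_self C1
  have l2 := le_abs_self C2
  have l3 := le_abs_self C3
  refine ⟨|C1| + |C2| + |C3| + C4 + 1, by positivity, fun a x T ha hx hT hTx φ hφ => ?_⟩
  obtain ⟨α, β, d⟩ := exists_dat ha hx hT hTx hφ
  have hx0 : 0 < x := by linarith
  refine ⟨fun r hr hr1 => ?_, fun r hr hra => ?_, fun r hr _ => ?_, fun r hr => ?_⟩
  · refine (h1 κ a x T N φ α β d r hr hr1).trans ?_
    exact mul_le_mul_of_nonneg_right (by linarith) (Real.rpow_nonneg hr.le _)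
  · refine (h2 κ a x T N φ α β d r hx0 hr hra).trans ?_
    exact mul_le_mul_of_nonneg_right (by linarith) (Real.exp_pos _).le
  · have hr1 : 1 ≤ r := (le_max_right _ _).trans hr
    refine (h3 κ a x T φ α β d r hr1).trans ?_
    exact div_le_div_of_nonneg_right (by linarith) (by linarith)
  · have hr1 : 1 ≤ r := (le_max_right _ _).trans hr
    refine (h4 a x T φ α β ha hx hT hTx d r ((le_max_left _ _).trans hr) hr1).trans ?_
    have hr0 : 0 < r := by linarith
    have hT0 : 0 < T := by linarith
    have hm : 0 ≤ min 1 (x / (r * T)) := le_min zero_le_one (by positivity)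
    refine mul_le_mul_of_nonneg_right ?_ hm
    exact mul_le_mul_of_nonneg_right (by linarith) (Real.rpow_nonneg hr0.le _)

end
end

section
/- There exists a constant C > 0 such that for all real v ≥ 1 and all real z with 0 < z ≤ 3/4, one has | e^{πv/2} K_{iv}(vz) − (√(2π) / (v^{1/2} (1−z²)^{1/4})) [ cos(v w(z) − π/4) + sin(v w(z) − π/4) · (3z² + 2)/(24 v (1−z²)^{3/2}) ] | ≤ C v^{−5/2}, where w(z) = arccosh(1/z) − √(1−z²). -/
open Complex Finset Filter

noncomputable section

/-- `w(z) = arccosh(1/z) - √(1-z²)` for `0 < z < 1`,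
where `arccosh(1/z) = log(1/z + √(1/z² - 1))`. -/
def wfun (z : ℝ) : ℝ :=
  Real.log (1 / z + Real.sqrt (1 / z ^ 2 - 1)) - Real.sqrt (1 - z ^ 2)

/-- The phase along the diagonal line through the saddle point. -/
def phs (a s : ℝ) : ℂ :=
  I * ((s : ℂ) * (1 - I) - a * (Complex.cosh ((s : ℂ) * (1 - I)) - 1)
    - Complex.sinh ((s : ℂ) * (1 - I)))

/-- The polynomial correction. -/
def corr (v a s : ℝ) : ℂ :=
  1 + v * ((-1 + I) / 3 * s ^ 3 + I * a / 6 * s ^ 4 + (1 + I) / 30 * s ^ 5)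
    + v ^ 2 * (((-1 + I) / 3) ^ 2 * s ^ 6 / 2 + (-1 + I) / 3 * (I * a / 6) * s ^ 7)
    + v ^ 3 * (((-1 + I) / 3) ^ 3 * s ^ 9 / 6)

lemma norm_one_sub_I : ‖(1 - I : ℂ)‖ = √2 := by
  rw [Complex.norm_eq_sqrt_sq_add_sq]; norm_num

lemma poly_le_exp (n : ℕ) (k : ℝ) (hk : 0 < k) :
    ∃ C : ℝ, 0 < C ∧ ∀ X : ℝ, 0 ≤ X → (1 + X) ^ n ≤ C * Real.exp (k * X) := by
  refine ⟨n.factorial / k ^ n * Real.exp k, by positivity, fun X hX => ?_⟩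
  have h := Real.pow_div_factorial_le_exp (x := k * (1 + X)) (by positivity) n
  rw [div_le_iff₀ (by positivity), mul_pow] at h
  have : Real.exp (k * (1 + X)) = Real.exp k * Real.exp (k * X) := by
    rw [← Real.exp_add]; ring_nf
  rw [this] at h
  have hkn : 0 < k ^ n := by positivity
  calc (1 + X) ^ n = (k ^ n * (1 + X) ^ n) / k ^ n := by field_simp
    _ ≤ (Real.exp k * Real.exp (k * X) * n.factorial) / k ^ n := by gcongr
    _ = _ := by ring

lemma phs_taylor (a s : ℝ) (ha0 : 0 ≤ a) (ha : a ≤ 1) (hs : |s| ≤ 1 / 4) :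
    ∃ e : ℂ, ‖e‖ ≤ 1 / 2 ∧ phs a s = -a * s ^ 2 + (-1 + I) / 3 * s ^ 3 + I * a / 6 * s ^ 4
      + (1 + I) / 30 * s ^ 5 + e * s ^ 6 := by
  by_cases h0 : s = 0
  · refine ⟨0, by simp, ?_⟩
    simp [h0, phs]
  set u : ℂ := (s : ℂ) * (1 - I) with hu
  have hun : ‖u‖ = |s| * √2 := by
    rw [hu, norm_mul, norm_one_sub_I, Complex.norm_real, Real.norm_eq_abs]
  have hu6 : ‖u‖ ^ 6 = 8 * s ^ 6 := by
    rw [hun, mul_pow]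
    have : √2 ^ 6 = 8 := by
      rw [show √2 ^ 6 = (√2 ^ 2) ^ 3 by ring, Real.sq_sqrt (by norm_num)]; norm_num
    rw [this, Even.pow_abs (by decide)]; ring
  have h2 : √2 ≤ 2 := by
    rw [Real.sqrt_le_left (by norm_num)]; norm_num
  have hu1 : ‖u‖ ≤ 1 := by
    rw [hun]; nlinarith [abs_nonneg s, Real.sqrt_nonneg 2]
  have hT : ∀ x : ℂ, ‖x‖ ≤ 1 → ‖x‖ ^ 6 = 8 * s ^ 6 →
      ‖Complex.exp x - (1 + x + x ^ 2 / 2 + x ^ 3 / 6 + x ^ 4 / 24 + x ^ 5 / 120)‖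
        ≤ s ^ 6 / 50 := by
    intro x hx hx6
    have hb1 := Complex.exp_bound hx (n := 6) (by norm_num)
    rw [hx6] at hb1
    simp only [Finset.sum_range_succ, Finset.sum_range_zero, Nat.factorial] at hb1
    norm_num at hb1
    have : 0 ≤ s ^ 6 := by positivity
    linarith
  have hb1 := hT u hu1 hu6
  have hb2 := hT (-u) (by rwa [norm_neg]) (by rwa [norm_neg])
  obtain ⟨r1, hr1⟩ : ∃ r, r = Complex.exp u -
    (1 + u + u ^ 2 / 2 + u ^ 3 / 6 + u ^ 4 / 24 + u ^ 5 / 120) := ⟨_, rfl⟩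
  obtain ⟨r2, hr2⟩ : ∃ r, r = Complex.exp (-u) -
    (1 + -u + (-u) ^ 2 / 2 + (-u) ^ 3 / 6 + (-u) ^ 4 / 24 + (-u) ^ 5 / 120) := ⟨_, rfl⟩
  rw [← hr1] at hb1
  rw [← hr2] at hb2
  have he1 : Complex.exp u = (1 + u + u ^ 2 / 2 + u ^ 3 / 6 + u ^ 4 / 24 + u ^ 5 / 120) + r1 := by
    rw [hr1]; ring
  have he2 : Complex.exp (-u) =
      (1 + -u + (-u) ^ 2 / 2 + (-u) ^ 3 / 6 + (-u) ^ 4 / 24 + (-u) ^ 5 / 120) + r2 := by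
    rw [hr2]; ring
  have hs6 : 0 < s ^ 6 := by positivity
  have hsc : (s : ℂ) ^ 6 ≠ 0 := by exact_mod_cast hs6.ne'
  refine ⟨I * (-a * ((r1 + r2) / 2) - (r1 - r2) / 2) / s ^ 6, ?_, ?_⟩
  · rw [norm_div, norm_mul, norm_I, one_mul, norm_pow, Complex.norm_real, Real.norm_eq_abs,
      Even.pow_abs (by decide), div_le_iff₀ hs6]
    have n1 : ‖(r1 + r2) / 2‖ ≤ s ^ 6 / 50 := by
      rw [norm_div]; have := norm_add_le r1 r2; norm_num; linarith
    have n2 : ‖(r1 - r2) / 2‖ ≤ s ^ 6 / 50 := by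
      rw [norm_div]; have := norm_sub_le r1 r2; norm_num; linarith
    have n3 : ‖-(a : ℂ) * ((r1 + r2) / 2)‖ ≤ s ^ 6 / 50 := by
      rw [norm_mul, norm_neg, Complex.norm_real, Real.norm_eq_abs, abs_of_nonneg ha0]
      calc a * _ ≤ 1 * ‖(r1 + r2) / 2‖ := by gcongr
        _ ≤ _ := by rw [one_mul]; exact n1
    have := norm_sub_le (-(a : ℂ) * ((r1 + r2) / 2)) ((r1 - r2) / 2)
    linarith
  · rw [div_mul_cancel₀ _ hsc]
    unfold phs
    rw [← hu, Complex.cosh, Complex.sinh, he1, he2, hu]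
    have hI : I ^ 2 = -1 := I_sq
    have hI3 : I ^ 3 = -I := I_pow_three
    have hI4 : I ^ 4 = 1 := I_pow_four
    have hI5 : I ^ 5 = I := by rw [pow_succ, hI4, one_mul]
    have hI6 : I ^ 6 = -1 := by rw [pow_succ, hI5, I_mul_I]
    ring_nf
    simp only [hI, hI3, hI4, hI5, hI6]
    ring_nf

lemma norm_A : ‖((-1 + I) / 3 : ℂ)‖ ≤ 1 / 2 := by
  rw [norm_div, Complex.norm_eq_sqrt_sq_add_sq]
  norm_num
  rw [div_le_iff₀ (by norm_num), Real.sqrt_le_left (by norm_num)]; norm_num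

lemma norm_D : ‖((1 + I) / 30 : ℂ)‖ ≤ 1 / 15 := by
  rw [norm_div, Complex.norm_eq_sqrt_sq_add_sq]
  norm_num
  rw [div_le_iff₀ (by norm_num), Real.sqrt_le_left (by norm_num)]; norm_num

lemma norm_B (a : ℝ) (ha0 : 0 ≤ a) (ha : a ≤ 1) : ‖(I * a / 6 : ℂ)‖ ≤ 1 / 6 := by
  rw [norm_div, norm_mul, norm_I, Complex.norm_real, Real.norm_eq_abs, abs_of_nonneg ha0]
  norm_num
  linarith

lemma near_bound : ∃ C : ℝ, 0 < C ∧ ∀ v a s : ℝ, 1 ≤ v → 13 / 20 ≤ a → a ≤ 1 → |s| ≤ 1 / 4 →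
    ‖Complex.exp (v * phs a s) - (Real.exp (-(v * a) * s ^ 2) : ℝ) * corr v a s‖
      ≤ C / v ^ 2 * Real.exp (-(v / 10) * s ^ 2) := by
  obtain ⟨C, hC, hCX⟩ := poly_le_exp 6 (1 / 10) (by norm_num)
  refine ⟨4 * C, by positivity, fun v a s hv ha1 ha2 hs => ?_⟩
  have ha0 : 0 ≤ a := by linarith
  obtain ⟨e, he, hphs⟩ := phs_taylor a s ha0 ha2 hs
  have hA := norm_A
  have hD := norm_D
  have hB := norm_B a ha0 ha2
  set A : ℂ := (-1 + I) / 3 with hAdef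
  set D : ℂ := (1 + I) / 30 with hDdef
  set B : ℂ := I * a / 6 with hBdef
  obtain ⟨b, hb⟩ : ∃ b, b = B + D * s + e * s ^ 2 := ⟨_, rfl⟩
  obtain ⟨c, hc⟩ : ∃ c, c = D + e * s := ⟨_, rfl⟩
  have hsn : ‖(s : ℂ)‖ = |s| := by rw [Complex.norm_real, Real.norm_eq_abs]
  have hs0 := abs_nonneg s
  have hvn : ‖(v : ℂ)‖ = v := by
    rw [Complex.norm_real, Real.norm_eq_abs, abs_of_nonneg (by linarith)]
  have hcn : ‖c‖ ≤ 1 / 2 := by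
    have h1 := norm_add_le D (e * s)
    rw [norm_mul, hsn, ← hc] at h1
    nlinarith [norm_nonneg e]
  have hbn : ‖b‖ ≤ 1 / 2 := by
    have h1 := norm_add_le B (c * s)
    rw [norm_mul, hsn] at h1
    have h2 : B + c * s = b := by rw [hb, hc]; ring
    rw [h2] at h1
    nlinarith [norm_nonneg c]
  set P : ℂ := v * (A * s ^ 3 + B * s ^ 4 + D * s ^ 5 + e * s ^ 6) with hP
  set X : ℝ := v * s ^ 2 with hX
  have hX0 : 0 ≤ X := by positivity
  have hexp : Complex.exp (v * phs a s) = (Real.exp (-(v * a) * s ^ 2) : ℝ) * Complex.exp P := by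
    rw [Complex.ofReal_exp, ← Complex.exp_add, hphs, hP]
    congr 1; push_cast; ring
  have hPe : P = v * (s ^ 3 * (A + b * s)) := by rw [hP, hb]; ring
  have hAb : ‖A + b * s‖ ≤ 1 := by
    have h1 := norm_add_le A (b * s)
    rw [norm_mul, hsn] at h1
    nlinarith [norm_nonneg b]
  have hPn : ‖P‖ ≤ v * |s| ^ 3 := by
    rw [hPe, norm_mul, norm_mul, norm_pow, hsn, hvn]
    have : |s| ^ 3 * ‖A + b * s‖ ≤ |s| ^ 3 * 1 := by gcongr
    rw [mul_one] at this
    gcongr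
  have hPX : ‖P‖ ≤ X / 4 := by
    refine hPn.trans ?_
    rw [hX, ← sq_abs s]
    have : |s| ^ 2 * |s| ≤ |s| ^ 2 * (1 / 4) := by gcongr
    nlinarith
  have hv2 : (0 : ℝ) < v ^ 2 := by positivity
  have hP4 : ‖P‖ ^ 4 ≤ X ^ 6 / v ^ 2 := by
    calc ‖P‖ ^ 4 ≤ (v * |s| ^ 3) ^ 4 := by gcongr
      _ = X ^ 6 / v ^ 2 := by
        rw [hX, ← sq_abs s]; field_simp
  have hE := Complex.norm_exp_sub_sum_le_norm_mul_exp P 4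
  simp only [Finset.sum_range_succ, Finset.sum_range_zero, Nat.factorial] at hE
  norm_num at hE
  have key : Complex.exp P - corr v a s = (Complex.exp P - (1 + P + P ^ 2 / 2 + P ^ 3 / 6))
      + v * s ^ 6 * e + v ^ 2 * s ^ 8 * ((2 * A * c + b ^ 2) / 2)
      + v ^ 3 * s ^ 10 * ((3 * A ^ 2 * b + 3 * A * b ^ 2 * s + b ^ 3 * s ^ 2) / 6) := by
    unfold corr
    rw [← hAdef, ← hBdef, ← hDdef, hP, hb, hc]
    ring
  have t1 : ‖Complex.exp P - (1 + P + P ^ 2 / 2 + P ^ 3 / 6)‖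
      ≤ X ^ 6 / v ^ 2 * Real.exp (X / 4) := by
    refine hE.trans ?_
    gcongr
  have t2 : ‖(v : ℂ) * s ^ 6 * e‖ ≤ X ^ 3 / v ^ 2 := by
    rw [norm_mul, norm_mul, norm_pow, hsn, hvn, Even.pow_abs (by decide)]
    calc v * s ^ 6 * ‖e‖ ≤ v * s ^ 6 * 1 := by gcongr; linarith
      _ = X ^ 3 / v ^ 2 := by rw [hX]; field_simp
  have t3 : ‖(v : ℂ) ^ 2 * s ^ 8 * ((2 * A * c + b ^ 2) / 2)‖ ≤ X ^ 4 / v ^ 2 := by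
    have h1 : ‖(2 * A * c + b ^ 2) / 2‖ ≤ 1 := by
      rw [norm_div]
      have h1 := norm_add_le (2 * A * c) (b ^ 2)
      rw [norm_mul, norm_mul, norm_pow] at h1
      norm_num at h1 ⊢
      nlinarith [norm_nonneg A, norm_nonneg b, norm_nonneg c]
    rw [norm_mul, norm_mul, norm_pow, norm_pow, hsn, hvn, Even.pow_abs (by decide)]
    calc v ^ 2 * s ^ 8 * _ ≤ v ^ 2 * s ^ 8 * 1 := by gcongr
      _ = X ^ 4 / v ^ 2 := by rw [hX]; field_simp
  have t4 : ‖(v : ℂ) ^ 3 * s ^ 10 * ((3 * A ^ 2 * b + 3 * A * b ^ 2 * s + b ^ 3 * s ^ 2) / 6)‖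
      ≤ X ^ 5 / v ^ 2 := by
    have h1 : ‖(3 * A ^ 2 * b + 3 * A * b ^ 2 * s + b ^ 3 * s ^ 2) / 6‖ ≤ 1 := by
      rw [norm_div]
      have h1 := norm_add₃_le (a := 3 * A ^ 2 * b) (b := 3 * A * b ^ 2 * s) (c := b ^ 3 * s ^ 2)
      simp only [norm_mul, norm_pow, hsn] at h1
      norm_num at h1 ⊢
      have q1 : 3 * ‖A‖ ^ 2 * ‖b‖ ≤ 3 * (1 / 2) ^ 2 * (1 / 2) := by gcongr
      have q2 : 3 * ‖A‖ * ‖b‖ ^ 2 * |s| ≤ 3 * (1 / 2) * (1 / 2) ^ 2 * (1 / 4) := by gcongr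
      have q3 : ‖b‖ ^ 3 * |s| ^ 2 ≤ (1 / 2) ^ 3 * (1 / 4) ^ 2 := by gcongr
      rw [sq_abs] at q3
      rw [div_le_one (by norm_num)]
      norm_num at q1 q2 q3
      linarith
    rw [norm_mul, norm_mul, norm_pow, norm_pow, hsn, hvn, Even.pow_abs (by decide)]
    calc v ^ 3 * s ^ 10 * _ ≤ v ^ 3 * s ^ 10 * 1 := by gcongr
      _ = X ^ 5 / v ^ 2 := by rw [hX]; field_simp
  have hbig : ‖Complex.exp P - corr v a s‖ ≤ 4 * (1 + X) ^ 6 / v ^ 2 * Real.exp (X / 4) := by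
    rw [key]
    refine (norm_add_le _ _).trans ?_
    refine (add_le_add (norm_add₃_le) le_rfl).trans ?_
    have hone : 1 ≤ Real.exp (X / 4) := Real.one_le_exp (by positivity)
    have hm : ∀ n ≤ 6, X ^ n / v ^ 2 ≤ (1 + X) ^ 6 / v ^ 2 * Real.exp (X / 4) := by
      intro n hn
      have h1 : X ^ n ≤ (1 + X) ^ 6 :=
        (pow_le_pow_left₀ hX0 (by linarith) n).trans (pow_le_pow_right₀ (by linarith) hn)
      calc X ^ n / v ^ 2 ≤ (1 + X) ^ 6 / v ^ 2 := by gcongr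
        _ = (1 + X) ^ 6 / v ^ 2 * 1 := by ring
        _ ≤ _ := by gcongr
    have t1' : X ^ 6 / v ^ 2 * Real.exp (X / 4) ≤ (1 + X) ^ 6 / v ^ 2 * Real.exp (X / 4) := by
      gcongr; linarith
    have := hm 3 (by norm_num)
    have := hm 4 (by norm_num)
    have := hm 5 (by norm_num)
    have e4 : 4 * (1 + X) ^ 6 / v ^ 2 * Real.exp (X / 4)
      = 4 * ((1 + X) ^ 6 / v ^ 2 * Real.exp (X / 4)) := by ring
    linarith
  rw [hexp, ← mul_sub, norm_mul, Complex.norm_real, Real.norm_eq_abs, Real.abs_exp]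
  have hfin : Real.exp (-(v * a) * s ^ 2) * (Real.exp (1 / 10 * X) * Real.exp (X / 4))
      ≤ Real.exp (-(v / 10) * s ^ 2) := by
    rw [← Real.exp_add, ← Real.exp_add, Real.exp_le_exp]
    have : 13 / 20 * X ≤ a * X := by gcongr
    have e1 : -(v * a) * s ^ 2 = - (a * X) := by rw [hX]; ring
    have e2 : -(v / 10) * s ^ 2 = - (X / 10) := by rw [hX]; ring
    rw [e1, e2]; linarith
  calc _ ≤ Real.exp (-(v * a) * s ^ 2) * (4 * (C * Real.exp (1 / 10 * X)) / v ^ 2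
        * Real.exp (X / 4)) := by
        refine mul_le_mul_of_nonneg_left (hbig.trans ?_) (Real.exp_pos _).le
        have := hCX X hX0
        gcongr
    _ = 4 * C / v ^ 2 * (Real.exp (-(v * a) * s ^ 2) * (Real.exp (1 / 10 * X) * Real.exp (X / 4))) := by ring
    _ ≤ _ := by gcongr

lemma far_gauss : ∃ C : ℝ, 0 < C ∧ ∀ v a s : ℝ, 1 ≤ v → 13 / 20 ≤ a → a ≤ 1 → 1 / 4 ≤ |s| →
    ‖(Real.exp (-(v * a) * s ^ 2) : ℝ) * corr v a s‖
      ≤ C / v ^ 2 * Real.exp (-(v / 10) * s ^ 2) := by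
  obtain ⟨C, hC, hCX⟩ := poly_le_exp 8 (1 / 10) (by norm_num)
  refine ⟨7 * 256 * C, by positivity, fun v a s hv ha1 ha2 hs => ?_⟩
  have ha0 : 0 ≤ a := by linarith
  have hA := norm_A
  have hD := norm_D
  have hB := norm_B a ha0 ha2
  set A : ℂ := (-1 + I) / 3 with hAdef
  set D : ℂ := (1 + I) / 30 with hDdef
  set B : ℂ := I * a / 6 with hBdef
  have hsn : ‖(s : ℂ)‖ = |s| := by rw [Complex.norm_real, Real.norm_eq_abs]
  have hs0 := abs_nonneg s
  have hvn : ‖(v : ℂ)‖ = v := by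
    rw [Complex.norm_real, Real.norm_eq_abs, abs_of_nonneg (by linarith)]
  set X : ℝ := v * s ^ 2 with hX
  have hX0 : 0 ≤ X := by positivity
  have hv2 : (0 : ℝ) < v ^ 2 := by positivity
  set Y : ℝ := 1 + X with hY
  have hY1 : 1 ≤ Y := by linarith
  have hXY : X ≤ Y := by linarith
  have hXs : X = v * |s| ^ 2 := by rw [sq_abs]
  have hsY : |s| ≤ Y := by
    have : s ^ 2 ≤ X := by rw [hX]; nlinarith [sq_nonneg s]
    nlinarith [sq_abs s, sq_nonneg (|s| - 1)]
  have hvY : v ≤ 16 * Y := by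
    have : (1 / 4) ^ 2 ≤ |s| ^ 2 := by gcongr
    rw [sq_abs] at this
    nlinarith
  have hpw : ∀ n ≤ 6, Y ^ n ≤ Y ^ 6 := fun n hn => pow_le_pow_right₀ hY1 hn
  have hcorr : ‖corr v a s‖ ≤ 7 * Y ^ 6 := by
    have m1 : v * |s| ^ 3 ≤ Y ^ 6 := by
      calc v * |s| ^ 3 = X * |s| := by rw [hXs]; ring
        _ ≤ Y * Y := by gcongr
        _ = Y ^ 2 := by ring
        _ ≤ _ := hpw 2 (by norm_num)
    have m2 : v * |s| ^ 4 ≤ Y ^ 6 := by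
      calc v * |s| ^ 4 = X * |s| ^ 2 := by rw [hXs]; ring
        _ ≤ Y * Y ^ 2 := by gcongr
        _ = Y ^ 3 := by ring
        _ ≤ _ := hpw 3 (by norm_num)
    have m3 : v * |s| ^ 5 ≤ Y ^ 6 := by
      calc v * |s| ^ 5 = X * |s| ^ 3 := by rw [hXs]; ring
        _ ≤ Y * Y ^ 3 := by gcongr
        _ = Y ^ 4 := by ring
        _ ≤ _ := hpw 4 (by norm_num)
    have m4 : v ^ 2 * |s| ^ 6 ≤ Y ^ 6 := by
      calc v ^ 2 * |s| ^ 6 = X ^ 2 * |s| ^ 2 := by rw [hXs]; ring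
        _ ≤ Y ^ 2 * Y ^ 2 := by gcongr
        _ = Y ^ 4 := by ring
        _ ≤ _ := hpw 4 (by norm_num)
    have m5 : v ^ 2 * |s| ^ 7 ≤ Y ^ 6 := by
      calc v ^ 2 * |s| ^ 7 = X ^ 2 * |s| ^ 3 := by rw [hXs]; ring
        _ ≤ Y ^ 2 * Y ^ 3 := by gcongr
        _ = Y ^ 5 := by ring
        _ ≤ _ := hpw 5 (by norm_num)
    have m6 : v ^ 3 * |s| ^ 9 ≤ Y ^ 6 := by
      calc v ^ 3 * |s| ^ 9 = X ^ 3 * |s| ^ 3 := by rw [hXs]; ring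
        _ ≤ Y ^ 3 * Y ^ 3 := by gcongr
        _ = Y ^ 6 := by ring
    have m0 : 1 ≤ Y ^ 6 := one_le_pow₀ hY1
    have ec : corr v a s = 1 + v * s ^ 3 * A + v * s ^ 4 * B + v * s ^ 5 * D
        + v ^ 2 * s ^ 6 * (A ^ 2 / 2) + v ^ 2 * s ^ 7 * (A * B) + v ^ 3 * s ^ 9 * (A ^ 3 / 6) := by
      unfold corr; rw [← hAdef, ← hBdef, ← hDdef]; ring
    have hg : ∀ (j k : ℕ) (q : ℂ), ‖q‖ ≤ 1 → v ^ j * |s| ^ k ≤ Y ^ 6 →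
        ‖(v : ℂ) ^ j * s ^ k * q‖ ≤ Y ^ 6 := by
      intro j k q hq h
      rw [norm_mul, norm_mul, norm_pow, norm_pow, hsn, hvn]
      calc v ^ j * |s| ^ k * ‖q‖ ≤ Y ^ 6 * 1 := by gcongr
        _ = _ := mul_one _
    have hA2 : ‖A ^ 2 / 2‖ ≤ 1 := by
      rw [norm_div, norm_pow]; norm_num; nlinarith [norm_nonneg A]
    have hAB : ‖A * B‖ ≤ 1 := by
      rw [norm_mul]; nlinarith [norm_nonneg A, norm_nonneg B]
    have hA3 : ‖A ^ 3 / 6‖ ≤ 1 := by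
      rw [norm_div, norm_pow]
      have : ‖A‖ ^ 3 ≤ (1 / 2) ^ 3 := by gcongr
      norm_num at this ⊢; linarith
    have g1 := hg 1 3 A (by linarith) (by simpa using m1)
    have g2 := hg 1 4 B (by linarith) (by simpa using m2)
    have g3 := hg 1 5 D (by linarith) (by simpa using m3)
    have g4 := hg 2 6 _ hA2 m4
    have g5 := hg 2 7 _ hAB m5
    have g6 := hg 3 9 _ hA3 m6
    rw [pow_one] at g1 g2 g3
    rw [ec]
    refine (norm_add_le _ _).trans ?_
    refine (add_le_add (norm_add_le _ _) le_rfl).trans ?_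
    refine (add_le_add (add_le_add (norm_add_le _ _) le_rfl) le_rfl).trans ?_
    refine (add_le_add (add_le_add (add_le_add (norm_add_le _ _) le_rfl) le_rfl) le_rfl).trans ?_
    refine (add_le_add (add_le_add (add_le_add (add_le_add norm_add₃_le le_rfl) le_rfl) le_rfl)
      le_rfl).trans ?_
    rw [norm_one]
    linarith
  rw [norm_mul, Complex.norm_real, Real.norm_eq_abs, Real.abs_exp]
  have hY6 : Y ^ 6 ≤ 256 * Y ^ 8 / v ^ 2 := by
    rw [le_div_iff₀ hv2]
    calc Y ^ 6 * v ^ 2 ≤ Y ^ 6 * (16 * Y) ^ 2 := by gcongr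
      _ = _ := by ring
  have hfin : Real.exp (-(v * a) * s ^ 2) * Real.exp (1 / 10 * X)
      ≤ Real.exp (-(v / 10) * s ^ 2) := by
    rw [← Real.exp_add, Real.exp_le_exp]
    have : 13 / 20 * X ≤ a * X := by gcongr
    have e1 : -(v * a) * s ^ 2 = - (a * X) := by rw [hX]; ring
    have e2 : -(v / 10) * s ^ 2 = - (X / 10) := by rw [hX]; ring
    rw [e1, e2]; linarith
  calc _ ≤ Real.exp (-(v * a) * s ^ 2) * (7 * (256 * (C * Real.exp (1 / 10 * X)) / v ^ 2)) := by
        refine mul_le_mul_of_nonneg_left (hcorr.trans ?_) (Real.exp_pos _).le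
        have h8 := hCX X hX0
        have : 256 * Y ^ 8 / v ^ 2 ≤ 256 * (C * Real.exp (1 / 10 * X)) / v ^ 2 := by gcongr
        linarith
    _ = 7 * 256 * C / v ^ 2 * (Real.exp (-(v * a) * s ^ 2) * Real.exp (1 / 10 * X)) := by ring
    _ ≤ _ := by gcongr

lemma phs_re (a s : ℝ) :
    (phs a s).re = s - Real.sin s * (Real.cosh s + a * Real.sinh s) := by
  have e : (s : ℂ) * (1 - I) = s + (-s : ℝ) * I := by push_cast; ring
  unfold phs
  rw [e, Complex.cosh_add, Complex.sinh_add, Complex.cosh_mul_I, Complex.sinh_mul_I]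
  simp only [← Complex.ofReal_cosh, ← Complex.ofReal_sinh, ← Complex.ofReal_cos,
    ← Complex.ofReal_sin]
  simp [-Complex.ofReal_sin, -Complex.ofReal_cos, -Complex.ofReal_sinh, -Complex.ofReal_cosh]
  ring

lemma re_bound (t0 s : ℝ) (ht1 : 13 / 20 ≤ Real.tanh t0) (ht0 : 1 / 4 ≤ t0)
    (hs : 1 / 4 ≤ |s|) (hl : -t0 ≤ s) (hr : s ≤ Real.pi / 2) :
    (phs (Real.tanh t0) s).re ≤ -|s| / 40 := by
  rw [phs_re]
  rcases le_total 0 s with h | h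
  · rw [abs_of_nonneg h] at hs ⊢
    have h1 := Real.sin_gt_sub_cube (x := s) (by linarith)
    have h2 := Real.one_le_cosh s
    have h3 := Real.self_le_sinh_iff.2 h
    have hpi := Real.pi_lt_d2
    have hs16 : s ≤ 1.58 := by norm_num at hpi ⊢; linarith
    have hpos : 0 ≤ s - s ^ 3 / 6 := by
      have : s ^ 2 ≤ 6 := by nlinarith
      nlinarith
    have h4 : 13 / 20 * s ≤ Real.tanh t0 * Real.sinh s := by gcongr
    have h5 : (s - s ^ 3 / 6) * (1 + 13 / 20 * s)
        ≤ Real.sin s * (Real.cosh s + Real.tanh t0 * Real.sinh s) := by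
      have : 0 ≤ Real.sin s := by linarith
      gcongr
    have h6 : s - (s - s ^ 3 / 6) * (1 + 13 / 20 * s)
        = -s ^ 2 * (13 / 20 - s / 6 - 13 / 120 * s ^ 2) := by ring
    have h7 : 1 / 10 ≤ 13 / 20 - s / 6 - 13 / 120 * s ^ 2 := by
      norm_num at hs16; nlinarith
    have h8 : s ^ 2 * (1 / 10) ≤ s ^ 2 * (13 / 20 - s / 6 - 13 / 120 * s ^ 2) := by gcongr
    nlinarith
  · obtain ⟨σ, rfl⟩ : ∃ σ, s = -σ := ⟨-s, by ring⟩
    rw [abs_of_nonpos h, neg_neg] at *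
    rw [Real.sin_neg, Real.cosh_neg, Real.sinh_neg]
    have hσ : σ ≤ t0 := by linarith
    have hc0 : 0 < Real.cosh t0 := Real.cosh_pos _
    have hN : ∀ x, Real.cosh x - Real.tanh t0 * Real.sinh x
        = Real.cosh (t0 - x) / Real.cosh t0 := by
      intro x
      rw [Real.cosh_sub, Real.tanh_eq_sinh_div_cosh]; field_simp
    have h1 : Real.cosh σ - Real.tanh t0 * Real.sinh σ
        ≤ Real.cosh (1 / 4) - Real.tanh t0 * Real.sinh (1 / 4) := by
      rw [hN, hN]
      gcongr 
      rw [Real.cosh_le_cosh, abs_of_nonneg (by linarith), abs_of_nonneg (by linarith)]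
      linarith
    have h2 : 0 ≤ Real.cosh σ - Real.tanh t0 * Real.sinh σ := by rw [hN]; positivity
    have h3 : Real.cosh (1 / 4) ≤ 1 + 1 / 20 := by
      refine (Real.cosh_le_exp_half_sq _).trans ?_
      refine (Real.exp_bound_div_one_sub_of_interval (by norm_num) (by norm_num)).trans ?_
      norm_num
    have h4 : (1 / 4 : ℝ) ≤ Real.sinh (1 / 4) := Real.self_le_sinh_iff.2 (by norm_num)
    have h5 : 13 / 20 * (1 / 4) ≤ Real.tanh t0 * Real.sinh (1 / 4) := by gcongr
    have h6 : Real.cosh σ - Real.tanh t0 * Real.sinh σ ≤ 9 / 10 := by linarith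
    have h7 : Real.sin σ ≤ σ := Real.sin_le (by linarith)
    have h8 : Real.sin σ * (Real.cosh σ - Real.tanh t0 * Real.sinh σ) ≤ σ * (9 / 10) := by
      calc _ ≤ σ * (Real.cosh σ - Real.tanh t0 * Real.sinh σ) := by gcongr
        _ ≤ _ := by gcongr
    linarith

lemma exp_far (v r c : ℝ) (hv : 1 ≤ v) (hr : 1 / 4 ≤ |r|) (hc : c ≤ -|r| / 40) :
    Real.exp (v * c) ≤ (24 * 40 ^ 4 * 272) / v ^ 3 * (1 + r ^ 2)⁻¹ := by
  have h1 : v * c ≤ -(v * |r| / 40) := by nlinarith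
  have h2 := Real.pow_div_factorial_le_exp (x := v * |r| / 40) (by positivity) 4
  have hr0 : 0 < |r| := by linarith
  have h3 : 1 + r ^ 2 ≤ 272 * |r| ^ 4 := by
    rw [← sq_abs]
    have h4 : (1 / 4) ^ 2 ≤ |r| ^ 2 := by gcongr
    nlinarith
  calc Real.exp (v * c) ≤ Real.exp (-(v * |r| / 40)) := Real.exp_le_exp.2 h1
    _ = (Real.exp (v * |r| / 40))⁻¹ := Real.exp_neg _
    _ ≤ ((v * |r| / 40) ^ 4 / (4 : ℕ).factorial)⁻¹ := by gcongr
    _ = 24 * 40 ^ 4 / v ^ 4 * (|r| ^ 4)⁻¹ := by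
      simp only [Nat.factorial]; push_cast; field_simp
    _ ≤ 24 * 40 ^ 4 / v ^ 3 * (272 * (1 + r ^ 2)⁻¹) := by
      gcongr
      · norm_num
      · rw [← div_eq_mul_inv, inv_eq_one_div, div_le_div_iff₀ (by positivity) (by positivity)]
        linarith
    _ = _ := by ring

lemma mom_integrable (b : ℝ) (hb : 0 < b) (n : ℕ) :
    MeasureTheory.Integrable (fun s : ℝ => s ^ n * Real.exp (-b * s ^ 2)) := by
  have h := integrable_rpow_mul_exp_neg_mul_sq hb (s := (n : ℝ))
    (by have : (0 : ℝ) ≤ n := Nat.cast_nonneg n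
        linarith)
  simpa only [Real.rpow_natCast] using h

lemma mom_odd (b : ℝ) (n : ℕ) (hn : Odd n) :
    ∫ s : ℝ, s ^ n * Real.exp (-b * s ^ 2) = 0 := by
  have h := MeasureTheory.integral_neg_eq_self (fun s : ℝ => s ^ n * Real.exp (-b * s ^ 2))
    MeasureTheory.volume
  have h2 : (fun s : ℝ => (-s) ^ n * Real.exp (-b * (-s) ^ 2))
      = fun s => -(s ^ n * Real.exp (-b * s ^ 2)) := by
    funext s; rw [hn.neg_pow, neg_sq]; ring
  rw [h2, MeasureTheory.integral_neg] at h
  linarith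

lemma mom_even (b : ℝ) (hb : 0 < b) (k : ℕ) :
    ∫ s : ℝ, s ^ (2 * k) * Real.exp (-b * s ^ 2)
      = b ^ (-((k : ℝ) + 1 / 2)) * Real.Gamma (k + 1 / 2) := by
  have h1 := integral_comp_abs (f := fun s : ℝ => s ^ (2 * k) * Real.exp (-b * s ^ 2))
  simp only [sq_abs, pow_mul] at h1
  have h2 := _root_.integral_rpow_mul_exp_neg_mul_rpow (p := 2) (q := ((2 * k : ℕ) : ℝ)) (b := b)
    (by norm_num) (by have : (0 : ℝ) ≤ ((2 * k : ℕ) : ℝ) := Nat.cast_nonneg _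
                      linarith) hb
  simp only [Real.rpow_natCast, Real.rpow_two, pow_mul] at h2
  simp only [pow_mul]
  rw [h1, h2]
  have e1 : (((2 * k : ℕ) : ℝ) + 1) / 2 = k + 1 / 2 := by push_cast; ring
  have e2 : -(((2 * k : ℕ) : ℝ) + 1) / 2 = -((k : ℝ) + 1 / 2) := by push_cast; ring
  rw [e1, e2]; ring

lemma mom_val (b : ℝ) (hb : 0 < b) :
    (∫ s : ℝ, s ^ 0 * Real.exp (-b * s ^ 2) = √(Real.pi / b)) ∧
    (∫ s : ℝ, s ^ 4 * Real.exp (-b * s ^ 2) = 3 / (4 * b ^ 2) * √(Real.pi / b)) ∧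
    (∫ s : ℝ, s ^ 6 * Real.exp (-b * s ^ 2) = 15 / (8 * b ^ 3) * √(Real.pi / b)) := by
  have hh : √(Real.pi / b) = b ^ (-(1 / 2 : ℝ)) * √Real.pi := by
    rw [Real.sqrt_div Real.pi_pos.le, Real.rpow_neg hb.le, ← Real.sqrt_eq_rpow]; ring
  refine ⟨?_, ?_, ?_⟩
  · simp only [pow_zero, one_mul]; exact integral_gaussian b
  · have := mom_even b hb 2
    rw [Real.Gamma_nat_add_half] at this
    rw [this, hh]
    have e : b ^ (-(((2 : ℕ) : ℝ) + 1 / 2)) = (b ^ 2)⁻¹ * b ^ (-(1 / 2 : ℝ)) := by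
      rw [neg_add, Real.rpow_add hb, Real.rpow_neg hb.le, Real.rpow_natCast]
    rw [e]
    simp [Nat.doubleFactorial]
    ring
  · have := mom_even b hb 3
    rw [Real.Gamma_nat_add_half] at this
    rw [this, hh]
    have e : b ^ (-(((3 : ℕ) : ℝ) + 1 / 2)) = (b ^ 3)⁻¹ * b ^ (-(1 / 2 : ℝ)) := by
      rw [neg_add, Real.rpow_add hb, Real.rpow_neg hb.le, Real.rpow_natCast]
    rw [e]
    simp [Nat.doubleFactorial]
    ring

lemma gauss_corr (v a : ℝ) (hv : 0 < v) (ha : 0 < a) :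
    MeasureTheory.Integrable
      (fun s : ℝ => ((Real.exp (-(v * a) * s ^ 2) : ℝ) : ℂ) * corr v a s) ∧
    ∫ s : ℝ, ((Real.exp (-(v * a) * s ^ 2) : ℝ) : ℂ) * corr v a s
      = √(Real.pi / (v * a)) * (1 - I * ((5 - 3 * a ^ 2) / (24 * v * a ^ 3))) := by
  have hb : 0 < v * a := by positivity
  set b := v * a with hbdef
  set A : ℂ := (-1 + I) / 3 with hAdef
  set D : ℂ := (1 + I) / 30 with hDdef
  set B : ℂ := I * a / 6 with hBdef
  have hM : ∀ (n : ℕ) (q : ℂ), MeasureTheory.Integrable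
      (fun s : ℝ => ((s ^ n * Real.exp (-b * s ^ 2) : ℝ) : ℂ) * q) := fun n q =>
    (mom_integrable b hb n).ofReal.mul_const q
  have hV : ∀ (n : ℕ) (q : ℂ), ∫ s : ℝ, ((s ^ n * Real.exp (-b * s ^ 2) : ℝ) : ℂ) * q
      = ((∫ s : ℝ, s ^ n * Real.exp (-b * s ^ 2) : ℝ) : ℂ) * q := fun n q => by
    rw [MeasureTheory.integral_mul_const, integral_complex_ofReal]
  have e : (fun s : ℝ => ((Real.exp (-b * s ^ 2) : ℝ) : ℂ) * corr v a s) =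
      fun s : ℝ => ((((((((s ^ 0 * Real.exp (-b * s ^ 2) : ℝ) : ℂ) * 1
        + ((s ^ 3 * Real.exp (-b * s ^ 2) : ℝ) : ℂ) * (v * A))
        + ((s ^ 4 * Real.exp (-b * s ^ 2) : ℝ) : ℂ) * (v * B))
        + ((s ^ 5 * Real.exp (-b * s ^ 2) : ℝ) : ℂ) * (v * D))
        + ((s ^ 6 * Real.exp (-b * s ^ 2) : ℝ) : ℂ) * (v ^ 2 * A ^ 2 / 2))
        + ((s ^ 7 * Real.exp (-b * s ^ 2) : ℝ) : ℂ) * (v ^ 2 * A * B))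
        + ((s ^ 9 * Real.exp (-b * s ^ 2) : ℝ) : ℂ) * (v ^ 3 * A ^ 3 / 6)) := by
    funext s
    unfold corr
    rw [← hAdef, ← hBdef, ← hDdef]
    push_cast
    ring
  have i1 := (hM 0 1).add (hM 3 (v * A))
  have i2 := i1.add (hM 4 (v * B))
  have i3 := i2.add (hM 5 (v * D))
  have i4 := i3.add (hM 6 (v ^ 2 * A ^ 2 / 2))
  have i5 := i4.add (hM 7 (v ^ 2 * A * B))
  have i6 := i5.add (hM 9 (v ^ 3 * A ^ 3 / 6))
  rw [e]
  refine ⟨i6, ?_⟩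
  obtain ⟨v0, v4, v6⟩ := mom_val b hb
  have h1 := MeasureTheory.integral_add (hM 0 1) (hM 3 (v * A))
  have h2 := MeasureTheory.integral_add i1 (hM 4 (v * B))
  have h3 := MeasureTheory.integral_add i2 (hM 5 (v * D))
  have h4 := MeasureTheory.integral_add i3 (hM 6 (v ^ 2 * A ^ 2 / 2))
  have h5 := MeasureTheory.integral_add i4 (hM 7 (v ^ 2 * A * B))
  have h6 := MeasureTheory.integral_add i5 (hM 9 (v ^ 3 * A ^ 3 / 6))
  simp only [Pi.add_apply] at h1 h2 h3 h4 h5 h6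
  rw [h6, h5, h4, h3, h2, h1]
  simp only [hV, v0, v4, v6, mom_odd b 3 (by decide), mom_odd b 5 (by decide),
    mom_odd b 7 (by decide), mom_odd b 9 (by decide)]
  have hvc : (v : ℂ) ≠ 0 := by exact_mod_cast hv.ne'
  have hac : (a : ℂ) ≠ 0 := by exact_mod_cast ha.ne'
  have hA2 : A ^ 2 = -2 * I / 9 := by
    rw [hAdef, div_pow, add_sq, I_sq]; ring
  rw [hA2, hBdef, hbdef]
  push_cast
  generalize ((√(Real.pi / (v * a)) : ℝ) : ℂ) = R
  field_simp
  ring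

lemma seg_int (f G : ℂ → ℂ) (R : ℝ) (hf : Continuous f)
    (hG : ∀ z ∈ Metric.ball (0 : ℂ) R, HasDerivAt G (f z) z) (c d : ℂ) (α β : ℝ)
    (hs : ∀ s ∈ Set.uIcc α β, c + (s : ℂ) * d ∈ Metric.ball (0 : ℂ) R) :
    ∫ s in α..β, f (c + s * d) * d = G (c + β * d) - G (c + α * d) := by
  refine intervalIntegral.integral_eq_sub_of_hasDerivAt (f := fun s : ℝ => G (c + s * d)) ?_ ?_
  · intro s hsm
    have h1 := hG _ (hs s hsm)
    have h2 : HasDerivAt (fun x : ℂ => c + x * d) d (s : ℂ) := by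
      simpa using ((hasDerivAt_id (s : ℂ)).mul_const d).const_add c
    exact (HasDerivAt.comp (s : ℂ) h1 h2).comp_ofReal
  · exact Continuous.intervalIntegrable (by fun_prop) _ _

/-- The integrand after rotating. -/
def fint (v z : ℝ) (t : ℂ) : ℂ := Complex.exp (I * v * (t - z * Complex.sinh t))

lemma fint_diff (v z : ℝ) : Differentiable ℂ (fint v z) := by
  unfold fint; fun_prop

lemma contour (v z t0 : ℝ) (ht : 0 ≤ t0) :
    ∫ τ in (0 : ℝ)..(t0 + Real.pi / 2), Real.exp (Real.pi * v / 2 - v * z * Real.cosh τ)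
        * Real.cos (v * τ)
      = (∫ s in (-t0)..(Real.pi / 2), fint v z (t0 + s * (1 - I)) * (1 - I)).re := by
  have hpi := Real.pi_pos
  set R : ℝ := 4 * (t0 + Real.pi + 1) with hR
  obtain ⟨G, hG⟩ := (fint_diff v z).differentiableOn.isExactOn_ball (c := 0) (r := R)
  have hc := (fint_diff v z).continuous
  have hnr : ∀ x : ℝ, ‖(x : ℂ)‖ = |x| := fun x => by rw [Complex.norm_real, Real.norm_eq_abs]
  have h1 := seg_int _ G R hc hG (-(Real.pi / 2 : ℝ) * I) 1 0 (t0 + Real.pi / 2) (by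
    intro s hs
    rw [Set.uIcc_of_le (by positivity)] at hs
    rw [mem_ball_zero_iff]
    refine (norm_add_le _ _).trans_lt ?_
    simp only [norm_mul, norm_neg, norm_I, hnr, mul_one]
    rw [abs_of_nonneg (by positivity), abs_of_nonneg hs.1, hR]
    linarith [hs.2])
  have h2 := seg_int _ G R hc hG 0 I (-(Real.pi / 2)) t0 (by
    intro s hs
    rw [Set.uIcc_of_le (by linarith)] at hs
    rw [mem_ball_zero_iff, zero_add]
    simp only [norm_mul, norm_I, hnr, mul_one]
    rw [abs_lt]; constructor <;> linarith [hs.2, hs.1])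
  have h3 := seg_int _ G R hc hG t0 (1 - I) (-t0) (Real.pi / 2) (by
    intro s hs
    rw [Set.uIcc_of_le (by linarith)] at hs
    rw [mem_ball_zero_iff]
    refine (norm_add_le _ _).trans_lt ?_
    rw [norm_mul, hnr, hnr]
    have : ‖(1 - I : ℂ)‖ ≤ 2 := by
      refine (norm_sub_le _ _).trans ?_
      rw [norm_one, norm_I]; norm_num
    have h4 : |s| ≤ t0 + Real.pi / 2 := by
      rw [abs_le]; constructor <;> linarith [hs.2, hs.1]
    have h5 : |s| * ‖(1 - I : ℂ)‖ ≤ (t0 + Real.pi / 2) * 2 := by gcongr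
    rw [abs_of_nonneg ht]
    linarith)
  have e2 : (∫ s in (-(Real.pi / 2))..t0, fint v z (0 + s * I) * I).re = 0 := by
    have : ∀ s : ℝ, fint v z (0 + s * I) * I
        = ((Real.exp (-(v * (s - z * Real.sin s))) : ℝ) : ℂ) * I := by
      intro s
      unfold fint
      rw [zero_add, Complex.sinh_mul_I, Complex.ofReal_exp]
      congr 2
      push_cast
      linear_combination (v * (s - z * Complex.sin s)) * I_mul_I
    simp only [this]
    rw [intervalIntegral.integral_mul_const, intervalIntegral.integral_ofReal]
    simp
  have e1 : ∫ τ in (0 : ℝ)..(t0 + Real.pi / 2), Real.exp (Real.pi * v / 2 - v * z * Real.cosh τ)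
        * Real.cos (v * τ)
      = (∫ s in (0 : ℝ)..(t0 + Real.pi / 2), fint v z (-(Real.pi / 2 : ℝ) * I + s * 1) * 1).re := by
    have hcl := Complex.reCLM.intervalIntegral_comp_comm (μ := MeasureTheory.volume)
      (a := 0) (b := t0 + Real.pi / 2)
      (f := fun s : ℝ => fint v z (-(Real.pi / 2 : ℝ) * I + s * 1) * 1)
      (Continuous.intervalIntegrable (hc.comp (by fun_prop) |>.mul continuous_const) _ _)
    simp only [Complex.reCLM_apply] at hcl
    rw [← hcl]
    congr 1
    funext s
    unfold fint
    have es : Complex.sinh (-(Real.pi / 2 : ℝ) * I + s * 1) = -I * Real.cosh s := by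
      rw [Complex.sinh_add, neg_mul, Complex.sinh_neg, Complex.cosh_neg, Complex.sinh_mul_I,
        Complex.cosh_mul_I, ← Complex.ofReal_sin, ← Complex.ofReal_cos, Real.sin_pi_div_two,
        Real.cos_pi_div_two]
      simp
    rw [es]
    have ee : I * v * (-(Real.pi / 2 : ℝ) * I + s * 1 - z * (-I * Real.cosh s))
        = ((Real.pi * v / 2 - v * z * Real.cosh s : ℝ) : ℂ) + (v * s : ℝ) * I := by
      push_cast
      linear_combination (-(v * (Real.pi / 2)) + v * z * Complex.cosh s) * I_mul_I
    rw [ee, mul_one, Complex.exp_re]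
    simp [-Complex.ofReal_cosh]
  rw [e1, h1, h3]
  rw [h2] at e2
  rw [Complex.sub_re] at e2 ⊢
  rw [Complex.sub_re]
  have a1 : (-(Real.pi / 2 : ℝ) * I + ((t0 + Real.pi / 2 : ℝ) : ℂ) * 1)
    = t0 + ((Real.pi / 2 : ℝ) : ℂ) * (1 - I) := by push_cast; ring
  have a2 : (0 + (t0 : ℂ) * I) = t0 + ((-t0 : ℝ) : ℂ) * (1 - I) := by push_cast; ring
  have a3 : (0 + ((-(Real.pi / 2) : ℝ) : ℂ) * I) = -(Real.pi / 2 : ℝ) * I + ((0 : ℝ) : ℂ) * 1 := by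
    push_cast; ring
  rw [a2, a3] at e2
  rw [a1]
  linarith

lemma fint_saddle (v t0 s : ℝ) :
    fint v (1 / Real.cosh t0) (t0 + s * (1 - I))
      = Complex.exp ((v * (t0 - Real.tanh t0) : ℝ) * I)
        * Complex.exp (v * phs (Real.tanh t0) s) := by
  unfold fint phs
  rw [← Complex.exp_add]
  congr 1
  have hc : Complex.cosh t0 ≠ 0 := by
    rw [← Complex.ofReal_cosh]; exact_mod_cast (Real.cosh_pos t0).ne'
  rw [Complex.sinh_add, Real.tanh_eq_sinh_div_cosh]
  push_cast
  field_simp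
  ring

lemma saddle_int : ∃ C : ℝ, 0 < C ∧ ∀ v t0 : ℝ, 1 ≤ v → 13 / 20 ≤ Real.tanh t0 →
    Real.tanh t0 ≤ 1 → 1 / 4 < t0 →
    ‖(∫ s in (-t0)..(Real.pi / 2), Complex.exp (v * phs (Real.tanh t0) s))
      - √(Real.pi / (v * Real.tanh t0)) *
        (1 - I * ((5 - 3 * Real.tanh t0 ^ 2) / (24 * v * Real.tanh t0 ^ 3)))‖
      ≤ C * v ^ (-(5 : ℝ) / 2) := by
  obtain ⟨C1, hC1, h1⟩ := near_bound
  obtain ⟨C2, hC2, h2⟩ := far_gauss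
  set K : ℝ := 24 * 40 ^ 4 * 272 with hK
  have hK0 : 0 < K := by rw [hK]; norm_num
  have hpi := Real.pi_gt_three
  have hpi0 := Real.pi_pos
  refine ⟨(C1 + C2) * √(Real.pi * 10) + K * Real.pi, by positivity, fun v t0 hv ha1 ha2 ht => ?_⟩
  set a := Real.tanh t0 with ha
  have hv0 : 0 < v := by linarith
  have ha0 : 0 < a := by linarith
  obtain ⟨hgi, hgv⟩ := gauss_corr v a hv0 ha0
  rw [← hgv]
  have hcont : Continuous (fun s : ℝ => Complex.exp (v * phs a s)) := by
    unfold phs; fun_prop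
  rw [intervalIntegral.integral_of_le (by linarith),
    ← MeasureTheory.integral_indicator measurableSet_Ioc]
  have hii : MeasureTheory.Integrable
      ((Set.Ioc (-t0) (Real.pi / 2)).indicator (fun s : ℝ => Complex.exp (v * phs a s))) := by
    rw [MeasureTheory.integrable_indicator_iff measurableSet_Ioc]
    exact hcont.integrableOn_Ioc
  rw [← MeasureTheory.integral_sub hii hgi]
  have hb1 : MeasureTheory.Integrable
      (fun s : ℝ => (C1 + C2) / v ^ 2 * Real.exp (-(v / 10) * s ^ 2)) :=
    (integrable_exp_neg_mul_sq (by positivity)).const_mul _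
  have hb2 : MeasureTheory.Integrable (fun s : ℝ => K / v ^ 3 * (1 + s ^ 2)⁻¹) :=
    integrable_inv_one_add_sq.const_mul _
  refine (MeasureTheory.norm_integral_le_of_norm_le (hb1.add hb2)
    (Eventually.of_forall fun s => ?_)).trans ?_
  · simp only [Pi.add_apply]
    have hp1 : 0 ≤ K / v ^ 3 * (1 + s ^ 2)⁻¹ := by positivity
    have hp2 : (C1 + C2) / v ^ 2 * Real.exp (-(v / 10) * s ^ 2)
      = C1 / v ^ 2 * Real.exp (-(v / 10) * s ^ 2) + C2 / v ^ 2 * Real.exp (-(v / 10) * s ^ 2) := by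
      ring
    have hp3 : 0 ≤ C1 / v ^ 2 * Real.exp (-(v / 10) * s ^ 2) := by positivity
    have hp4 : 0 ≤ C2 / v ^ 2 * Real.exp (-(v / 10) * s ^ 2) := by positivity
    rcases le_total |s| (1 / 4) with hs | hs
    · have hmem : s ∈ Set.Ioc (-t0) (Real.pi / 2) := by
        rw [abs_le] at hs
        constructor <;> linarith [hs.1, hs.2]
      rw [Set.indicator_of_mem hmem]
      have := h1 v a s hv ha1 ha2 hs
      linarith
    · have hg := h2 v a s hv ha1 ha2 hs
      have hi : ‖(Set.Ioc (-t0) (Real.pi / 2)).indicator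
          (fun s : ℝ => Complex.exp (v * phs a s)) s‖ ≤ K / v ^ 3 * (1 + s ^ 2)⁻¹ := by
        by_cases hmem : s ∈ Set.Ioc (-t0) (Real.pi / 2)
        · rw [Set.indicator_of_mem hmem, Complex.norm_exp]
          have := re_bound t0 s ha1 ht.le hs hmem.1.le hmem.2
          have e : (v * phs a s).re = v * (phs a s).re := by simp
          rw [e]
          exact exp_far v s _ hv hs this
        · rw [Set.indicator_of_notMem hmem, norm_zero]; exact hp1
      have := norm_sub_le ((Set.Ioc (-t0) (Real.pi / 2)).indicator
          (fun s : ℝ => Complex.exp (v * phs a s)) s)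
          (((Real.exp (-(v * a) * s ^ 2) : ℝ) : ℂ) * corr v a s)
      linarith
  · have hadd := MeasureTheory.integral_add hb1 hb2
    simp only [Pi.add_apply]
    rw [hadd, MeasureTheory.integral_const_mul, MeasureTheory.integral_const_mul,
      integral_gaussian, integral_univ_inv_one_add_sq]
    have e1 : √(Real.pi / (v / 10)) = √(Real.pi * 10) * v ^ (-(1 : ℝ) / 2) := by
      rw [show Real.pi / (v / 10) = Real.pi * 10 / v by field_simp,
        Real.sqrt_div (by positivity), neg_div, Real.rpow_neg hv0.le, ← Real.sqrt_eq_rpow]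
      rfl
    have e2 : v ^ (-(5 : ℝ) / 2) = v ^ (-(1 : ℝ) / 2) / v ^ 2 := by
      rw [← Real.rpow_natCast v 2, ← Real.rpow_sub hv0]; norm_num
    have e3 : 1 / v ^ 3 ≤ v ^ (-(5 : ℝ) / 2) := by
      have : 1 / v ^ 3 = v ^ (-(3 : ℝ)) := by
        rw [Real.rpow_neg hv0.le, one_div]; norm_cast
      rw [this]
      exact Real.rpow_le_rpow_of_exponent_le hv (by norm_num)
    rw [e1]
    have e4 : (C1 + C2) / v ^ 2 * (√(Real.pi * 10) * v ^ (-(1 : ℝ) / 2))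
      = (C1 + C2) * √(Real.pi * 10) * v ^ (-(5 : ℝ) / 2) := by rw [e2]; ring
    have e5 : K / v ^ 3 * Real.pi ≤ K * Real.pi * v ^ (-(5 : ℝ) / 2) := by
      calc K / v ^ 3 * Real.pi = K * Real.pi * (1 / v ^ 3) := by ring
        _ ≤ _ := by gcongr
    rw [e4, add_mul]
    linarith

lemma tail_int : ∃ C : ℝ, 0 < C ∧ ∀ v t0 : ℝ, 1 ≤ v → 13 / 20 ≤ Real.tanh t0 →
    MeasureTheory.IntegrableOn (fun τ => Real.exp (Real.pi * v / 2
      - v * (1 / Real.cosh t0) * Real.cosh τ) * Real.cos (v * τ)) (Set.Ioi (t0 + Real.pi / 2)) ∧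
    |∫ τ in Set.Ioi (t0 + Real.pi / 2), Real.exp (Real.pi * v / 2
      - v * (1 / Real.cosh t0) * Real.cosh τ) * Real.cos (v * τ)| ≤ C * v ^ (-(5 : ℝ) / 2) := by
  set K : ℝ := 24 * 40 ^ 4 * 272 with hK
  have hK0 : 0 < K := by rw [hK]; norm_num
  have hpi := Real.pi_gt_three
  have hpi0 := Real.pi_pos
  refine ⟨K * Real.pi, by positivity, fun v t0 hv ha1 => ?_⟩
  have hv0 : 0 < v := by linarith
  set H := fun τ => Real.exp (Real.pi * v / 2
      - v * (1 / Real.cosh t0) * Real.cosh τ) * Real.cos (v * τ) with hH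
  have hHc : Continuous H := by rw [hH]; fun_prop
  have hb0 : MeasureTheory.Integrable (fun s : ℝ => K / v ^ 3 * (1 + (s - t0) ^ 2)⁻¹) :=
    (integrable_inv_one_add_sq.comp_sub_right t0).const_mul _
  have hle : ∀ τ ∈ Set.Ioi (t0 + Real.pi / 2), ‖H τ‖ ≤ K / v ^ 3 * (1 + (τ - t0) ^ 2)⁻¹ := by
    intro τ hτ
    rw [Set.mem_Ioi] at hτ
    obtain ⟨r, rfl⟩ : ∃ r, τ = t0 + r := ⟨τ - t0, by ring⟩
    have hr : Real.pi / 2 < r := by linarith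
    have hr0 : 0 < r := by linarith
    have e1 : 1 / Real.cosh t0 * Real.cosh (t0 + r)
        = Real.cosh r + Real.tanh t0 * Real.sinh r := by
      have := (Real.cosh_pos t0).ne'
      rw [Real.cosh_add, Real.tanh_eq_sinh_div_cosh]; field_simp
    have h3 := Real.self_le_sinh_iff.2 hr0.le
    have h4 : 13 / 20 * r ≤ Real.tanh t0 * Real.sinh r := by gcongr
    have h5 : r ≤ Real.cosh r := h3.trans (Real.sinh_lt_cosh r).le
    rw [hH]
    simp only [norm_mul, Real.norm_eq_abs, Real.abs_exp]
    have hcos := Real.abs_cos_le_one (v * (t0 + r))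
    have e2 : Real.pi * v / 2 - v * (1 / Real.cosh t0) * Real.cosh (t0 + r)
        = v * (Real.pi / 2 - (Real.cosh r + Real.tanh t0 * Real.sinh r)) := by
      rw [← e1]; ring
    rw [e2]
    have h6 := exp_far v r (Real.pi / 2 - (Real.cosh r + Real.tanh t0 * Real.sinh r)) hv
      (by rw [abs_of_pos hr0]; linarith) (by rw [abs_of_pos hr0]; linarith)
    have e3 : t0 + r - t0 = r := by ring
    rw [e3]
    calc _ ≤ Real.exp (v * (Real.pi / 2 - (Real.cosh r + Real.tanh t0 * Real.sinh r))) * 1 := by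
          gcongr
      _ ≤ _ := by rw [mul_one]; exact h6
  have hae : ∀ᵐ τ ∂(MeasureTheory.volume.restrict (Set.Ioi (t0 + Real.pi / 2))),
      ‖H τ‖ ≤ K / v ^ 3 * (1 + (τ - t0) ^ 2)⁻¹ :=
    (MeasureTheory.ae_restrict_iff' measurableSet_Ioi).2 (Eventually.of_forall hle)
  refine ⟨MeasureTheory.Integrable.mono' hb0.integrableOn hHc.aestronglyMeasurable hae, ?_⟩
  rw [← Real.norm_eq_abs]
  refine (MeasureTheory.norm_integral_le_of_norm_le hb0.integrableOn hae).trans ?_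
  refine (MeasureTheory.setIntegral_le_integral hb0
    (Eventually.of_forall fun s => by simp only [Pi.zero_apply]; positivity)).trans ?_
  rw [MeasureTheory.integral_const_mul,
    MeasureTheory.integral_sub_right_eq_self (fun s : ℝ => (1 + s ^ 2)⁻¹),
    integral_univ_inv_one_add_sq]
  have e3 : 1 / v ^ 3 ≤ v ^ (-(5 : ℝ) / 2) := by
    have : 1 / v ^ 3 = v ^ (-(3 : ℝ)) := by
      rw [Real.rpow_neg hv0.le, one_div]; norm_cast
    rw [this]
    exact Real.rpow_le_rpow_of_exponent_le hv (by norm_num)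
  calc K / v ^ 3 * Real.pi = K * Real.pi * (1 / v ^ 3) := by ring
    _ ≤ _ := by gcongr

lemma main_re (v a θ c : ℝ) (hv : 0 < v) (ha : 0 < a) :
    (Complex.exp (θ * I) * ((1 - I) * (√(Real.pi / (v * a)) * (1 - I * c)))).re
      = √(2 * Real.pi) / (√v * √a) *
        (Real.cos (θ - Real.pi / 4) + Real.sin (θ - Real.pi / 4) * c) := by
  rw [Real.cos_sub, Real.sin_sub, Real.cos_pi_div_four, Real.sin_pi_div_four,
    Real.sqrt_div Real.pi_pos.le, Real.sqrt_mul hv.le, Real.sqrt_mul (by norm_num : (0:ℝ) ≤ 2),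
    Complex.exp_mul_I, ← Complex.ofReal_cos, ← Complex.ofReal_sin]
  simp [-Complex.ofReal_cos, -Complex.ofReal_sin, -Complex.ofReal_div]
  have h2 : √2 * √2 = 2 := Real.mul_self_sqrt (by norm_num)
  generalize √2 = q at *
  linear_combination (-(√Real.pi / (√v * √a)) * (Real.cos θ + Real.sin θ
    + (Real.sin θ - Real.cos θ) * c) / 2) * h2

/-- Proposition A.1 (Andersen–Duke): there is `C > 0` such that for all `v ≥ 1` and
`0 < z ≤ 3/4`,
`|e^{πv/2} K_{iv}(vz) - √(2π)/(v^{1/2}(1-z²)^{1/4}) [cos(v w(z) - π/4)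
  + sin(v w(z) - π/4)(3z²+2)/(24v(1-z²)^{3/2})]| ≤ C v^{-5/2}`. -/
theorem kbessel_asymptotic_small :
    ∃ C : ℝ, 0 < C ∧
      ∀ v z : ℝ, 1 ≤ v → 0 < z → z ≤ 3/4 →
        |Real.exp (Real.pi * v / 2) * Kbes v (v * z)
            - Real.sqrt (2 * Real.pi) / (v ^ ((1 : ℝ)/2) * (1 - z ^ 2) ^ ((1 : ℝ)/4)) *
              (Real.cos (v * wfun z - Real.pi / 4)
                + Real.sin (v * wfun z - Real.pi / 4) *
                    ((3 * z ^ 2 + 2) / (24 * v * (1 - z ^ 2) ^ ((3 : ℝ)/2))))|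
          ≤ C * v ^ (-(5 : ℝ)/2) := by
  obtain ⟨C1, hC1, hs⟩ := saddle_int
  obtain ⟨C2, hC2, htl⟩ := tail_int
  refine ⟨√2 * C1 + C2, by positivity, fun v z hv hz hz1 => ?_⟩
  have hv0 : 0 < v := by linarith
  have hz2 : z ^ 2 ≤ 9 / 16 := by nlinarith
  have h1z : 4 / 3 ≤ 1 / z := by rw [le_div_iff₀ hz]; linarith
  obtain ⟨t0, ht0⟩ : ∃ t0, t0 = Real.arcosh (1 / z) := ⟨_, rfl⟩
  have ht0n : 0 ≤ t0 := by rw [ht0]; exact Real.arcosh_nonneg (by linarith)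
  have hch : Real.cosh t0 = 1 / z := by rw [ht0]; exact Real.cosh_arcosh (by linarith)
  obtain ⟨a, ha⟩ : ∃ a, a = √(1 - z ^ 2) := ⟨_, rfl⟩
  have hth : Real.tanh t0 = a := by
    rw [ht0, Real.tanh_arcosh (by linarith), ha]
    rw [show (1 / z) ^ 2 - 1 = (1 - z ^ 2) / z ^ 2 by field_simp,
      Real.sqrt_div (by linarith), Real.sqrt_sq hz.le]
    field_simp
  have hw : wfun z = t0 - a := by
    rw [wfun, ht0, Real.arcosh, ha, one_div_pow]
  have hzc : 1 / Real.cosh t0 = z := by rw [hch]; field_simp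
  have ha2 : a ^ 2 = 1 - z ^ 2 := by rw [ha, Real.sq_sqrt (by linarith)]
  have ha0 : 0 ≤ a := by rw [ha]; exact Real.sqrt_nonneg _
  have hal : 13 / 20 ≤ a := by nlinarith
  have hau : a ≤ 1 := by nlinarith [sq_nonneg z]
  have hap : 0 < a := by linarith
  have htq : 1 / 4 < t0 := by
    have h3 : Real.cosh (1 / 4) ≤ 1 + 1 / 20 := by
      refine (Real.cosh_le_exp_half_sq _).trans ?_
      refine (Real.exp_bound_div_one_sub_of_interval (by norm_num) (by norm_num)).trans ?_
      norm_num
    have : Real.cosh (1 / 4) < Real.cosh t0 := by rw [hch]; linarith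
    rw [Real.cosh_lt_cosh, abs_of_nonneg ht0n, abs_of_nonneg (by norm_num)] at this
    exact this
  have hs' := hs v t0 hv (by rw [hth]; exact hal) (by rw [hth]; exact hau) htq
  obtain ⟨hti, htb⟩ := htl v t0 hv (by rw [hth]; exact hal)
  rw [hth] at hs'
  rw [hzc] at hti htb
  set H := fun τ => Real.exp (Real.pi * v / 2 - v * z * Real.cosh τ) * Real.cos (v * τ) with hH
  have hHc : Continuous H := by rw [hH]; fun_prop
  have hK : Real.exp (Real.pi * v / 2) * Kbes v (v * z) = ∫ τ in Set.Ioi (0 : ℝ), H τ := by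
    rw [Kbes, ← MeasureTheory.integral_const_mul]
    congr 1
    funext τ
    rw [hH, ← mul_assoc, ← Real.exp_add]
    congr 2; ring
  have hT : 0 ≤ t0 + Real.pi / 2 := by have := Real.pi_pos; positivity
  have hsplit : ∫ τ in Set.Ioi (0 : ℝ), H τ
      = (∫ τ in (0 : ℝ)..(t0 + Real.pi / 2), H τ) + ∫ τ in Set.Ioi (t0 + Real.pi / 2), H τ := by
    rw [intervalIntegral.integral_of_le hT, ← Set.Ioc_union_Ioi_eq_Ioi hT]
    exact MeasureTheory.setIntegral_union Set.Ioc_disjoint_Ioi_same measurableSet_Ioi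
      hHc.integrableOn_Ioc hti
  have hcont := contour v z t0 ht0n
  set J := ∫ s in (-t0)..(Real.pi / 2), Complex.exp (v * phs a s) with hJ
  set S : ℂ := √(Real.pi / (v * a)) * (1 - I * ((5 - 3 * a ^ 2) / (24 * v * a ^ 3))) with hS
  have hhead : ∫ τ in (0 : ℝ)..(t0 + Real.pi / 2), H τ
      = (Complex.exp ((v * (t0 - a) : ℝ) * I) * ((1 - I) * J)).re := by
    rw [hH, hcont]
    congr 1
    have : ∀ s : ℝ, fint v z (t0 + s * (1 - I)) * (1 - I)
        = (Complex.exp ((v * (t0 - a) : ℝ) * I) * (1 - I)) * Complex.exp (v * phs a s) := by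
      intro s
      have h := fint_saddle v t0 s
      rw [hzc, hth] at h
      rw [h]; ring
    simp only [this]
    rw [intervalIntegral.integral_const_mul, mul_assoc]
  have hmain : (Complex.exp ((v * (t0 - a) : ℝ) * I) * ((1 - I) * S)).re
      = Real.sqrt (2 * Real.pi) / (v ^ ((1 : ℝ)/2) * (1 - z ^ 2) ^ ((1 : ℝ)/4)) *
              (Real.cos (v * wfun z - Real.pi / 4)
                + Real.sin (v * wfun z - Real.pi / 4) *
                    ((3 * z ^ 2 + 2) / (24 * v * (1 - z ^ 2) ^ ((3 : ℝ)/2)))) := by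
    have h := main_re v a (v * (t0 - a)) ((5 - 3 * a ^ 2) / (24 * v * a ^ 3)) hv0 hap
    have e0 : (((5 - 3 * a ^ 2) / (24 * v * a ^ 3) : ℝ) : ℂ)
      = (5 - 3 * a ^ 2) / (24 * v * a ^ 3) := by push_cast; rfl
    rw [e0] at h
    rw [hS, h, hw]
    have e1 : (1 - z ^ 2) ^ ((1 : ℝ) / 4) = √a := by
      rw [← ha2, Real.sqrt_eq_rpow, ← Real.rpow_natCast, ← Real.rpow_mul ha0]; norm_num
    have e2 : (1 - z ^ 2) ^ ((3 : ℝ) / 2) = a ^ 3 := by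
      rw [← ha2, ← Real.rpow_natCast, ← Real.rpow_mul ha0, ← Real.rpow_natCast]; norm_num
    have e3 : 5 - 3 * a ^ 2 = 3 * z ^ 2 + 2 := by rw [ha2]; ring
    rw [e1, e2, e3, ← Real.sqrt_eq_rpow]
  rw [hK, hsplit, hhead, ← hmain]
  have hdiff : |(Complex.exp ((v * (t0 - a) : ℝ) * I) * ((1 - I) * J)).re
      - (Complex.exp ((v * (t0 - a) : ℝ) * I) * ((1 - I) * S)).re|
      ≤ √2 * (C1 * v ^ (-(5 : ℝ) / 2)) := by
    rw [← Complex.sub_re, ← mul_sub, ← mul_sub]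
    refine (Complex.abs_re_le_norm _).trans ?_
    rw [norm_mul, norm_mul, Complex.norm_exp_ofReal_mul_I, one_mul, norm_one_sub_I]
    gcongr
  have := abs_add_le ((Complex.exp ((v * (t0 - a) : ℝ) * I) * ((1 - I) * J)).re
      - (Complex.exp ((v * (t0 - a) : ℝ) * I) * ((1 - I) * S)).re)
      (∫ τ in Set.Ioi (t0 + Real.pi / 2), H τ)
  have e : ∀ x y w : ℝ, x + y - w = (x - w) + y := fun x y w => by ring
  rw [e]
  calc _ ≤ _ := this
    _ ≤ √2 * (C1 * v ^ (-(5 : ℝ) / 2)) + C2 * v ^ (-(5 : ℝ) / 2) := add_le_add hdiff htb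
    _ = _ := by ring

end
end
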